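/- There exist constants ε₀ ∈ (0,1/2) and c₀ > 0, depending only on n ≥ 2, with the following property. Let E ⊆ ℝⁿ be an open bounded set with |E| = |B| and bar(E) = 0 whose boundary is ∂E = {(1+u(x))x : x ∈ ∂B} for a Lipschitz function u : ∂B → ℝ with ‖u‖_{W^{1,∞}(∂B)} < ε₀. Then for every s ∈ (0,1): P_s(E) − P_s(B) ≥ (c₀·s·P_s(B)/(n·ω_n))·‖u‖²_{L¹(∂B)}. -/

import Mathlib

open MeasureTheory Metric Bornology
open scoped ENNReal symmDiff

/-- The fractional `s`-perimeter of a set `E ⊆ ℝⁿ`: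
`P_s(E) = ∫_E ∫_{Eᶜ} |x - y|^{-(n+s)} dx dy`. -/
noncomputable def fracPer (n : ℕ) (s : ℝ) (E : Set (EuclideanSpace ℝ (Fin n))) : ℝ≥0∞ :=
  ∫⁻ x in E, ∫⁻ y in Eᶜ, ENNReal.ofReal (‖x - y‖ ^ (-((n : ℝ) + s)))

/-- The radius of the ball centered at the origin with the same volume as `E`. -/
noncomputable def matchRad (n : ℕ) (E : Set (EuclideanSpace ℝ (Fin n))) : ℝ :=
  ((volume E).toReal / (volume (ball (0 : EuclideanSpace ℝ (Fin n)) 1)).toReal) ^ ((1 : ℝ) / n)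

/-- The `s`-isoperimetric deficit `δ_s(E) = (P_s(E) - P_s(B(m)))/P_s(B(m))`, where `B(m)` is the
ball centered at the origin with `|B(m)| = |E|`. -/
noncomputable def sDeficit (n : ℕ) (s : ℝ) (E : Set (EuclideanSpace ℝ (Fin n))) : ℝ :=
  ((fracPer n s E).toReal
      - (fracPer n s (ball (0 : EuclideanSpace ℝ (Fin n)) (matchRad n E))).toReal)
    / (fracPer n s (ball (0 : EuclideanSpace ℝ (Fin n)) (matchRad n E))).toReal

/-- The barycenter `bar(E) = (1/|E|) ∫_E x dx`. -/
noncomputable def barycenter (n : ℕ) (E : Set (EuclideanSpace ℝ (Fin n))) :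
    EuclideanSpace ℝ (Fin n) :=
  ((volume E).toReal)⁻¹ • ∫ x in E, x

/-- The barycentric asymmetry `λ₀(E) = |E ∆ (bar(E) + B(m))| / |E|`. -/
noncomputable def barAsym (n : ℕ) (E : Set (EuclideanSpace ℝ (Fin n))) : ℝ :=
  (volume (E ∆ ball (barycenter n E) (matchRad n E))).toReal / (volume E).toReal

/-- The Euclidean space `ℝⁿ`. -/
abbrev Eucl (n : ℕ) := EuclideanSpace ℝ (Fin n)

/-- The unit sphere of `ℝⁿ`. -/
abbrev Sph (n : ℕ) : Set (Eucl n) := sphere (0 : Eucl n) 1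

/-- The surface measure on the unit sphere of `ℝⁿ`. -/
noncomputable abbrev surf (n : ℕ) : Measure (Sph n) := (volume : Measure (Eucl n)).toSphere

section Basics

variable {n : ℕ}

lemma Sph.norm_eq (x : Sph n) : ‖(x : Eucl n)‖ = 1 := by simp

lemma lintegral_polar (f : Eucl n → ℝ≥0∞) (hf : Measurable f) :
    ∫⁻ z in ({0}ᶜ : Set (Eucl n)), f z =
      ∫⁻ x, ∫⁻ r in Set.Ioi (0 : ℝ), ENNReal.ofReal (r ^ (n - 1)) * f (r • (x : Eucl n)) ∂(volume) ∂(surf n) := by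
  have hmp := (volume : Measure (Eucl n)).measurePreserving_homeomorphUnitSphereProd
  simp only [finrank_euclideanSpace, Fintype.card_fin] at hmp
  have hsubt : ∫⁻ z in ({0}ᶜ : Set (Eucl n)), f z
      = ∫⁻ z : ({0}ᶜ : Set (Eucl n)), f z ∂((volume : Measure (Eucl n)).comap (↑)) :=
    (lintegral_subtype_comap (measurableSet_singleton _).compl f).symm
  rw [hsubt]
  have h2 := hmp.lintegral_comp_emb (Homeomorph.measurableEmbedding _)
    (fun p : Sph n × Set.Ioi (0 : ℝ) => f ((p.2 : ℝ) • (p.1 : Eucl n)))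
  have h3 : ∀ z : ({0}ᶜ : Set (Eucl n)),
      f (((homeomorphUnitSphereProd (Eucl n) z).2 : ℝ) • ((homeomorphUnitSphereProd (Eucl n) z).1 : Eucl n)) = f z := by
    intro z
    have hz : (z : Eucl n) ≠ 0 := z.2
    simp [hz]
  simp only [h3] at h2
  rw [h2, lintegral_prod _ (by fun_prop)]
  refine lintegral_congr fun x => ?_
  rw [Measure.volumeIoiPow, lintegral_withDensity_eq_lintegral_mul _ (by fun_prop) (by fun_prop)]
  rw [← lintegral_subtype_comap measurableSet_Ioi]
  rfl

lemma lintegral_polar' (hn : 1 ≤ n) (f : Eucl n → ℝ≥0∞) (hf : Measurable f) :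
    ∫⁻ z, f z =
      ∫⁻ x, ∫⁻ r in Set.Ioi (0 : ℝ), ENNReal.ofReal (r ^ (n - 1)) * f (r • (x : Eucl n)) ∂(volume) ∂(surf n) := by
  have : Nonempty (Fin n) := ⟨⟨0, hn⟩⟩
  rw [← lintegral_polar f hf, restrict_compl_singleton]

/-- The action of a linear isometry on the unit sphere. -/
noncomputable def Sph.act (g : Eucl n ≃ₗᵢ[ℝ] Eucl n) (x : Sph n) : Sph n :=
  ⟨g x, by simp⟩

@[simp] lemma Sph.coe_act (g : Eucl n ≃ₗᵢ[ℝ] Eucl n) (x : Sph n) :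
    ((Sph.act g x : Sph n) : Eucl n) = g x := rfl

lemma Sph.isometry_act (g : Eucl n ≃ₗᵢ[ℝ] Eucl n) : Isometry (Sph.act g) := by
  intro x y
  simp [Subtype.edist_eq]

lemma Sph.continuous_act (g : Eucl n ≃ₗᵢ[ℝ] Eucl n) : Continuous (Sph.act g) :=
  (Sph.isometry_act g).continuous

open Pointwise in
lemma Sph.measurePreserving_act (g : Eucl n ≃ₗᵢ[ℝ] Eucl n) :
    MeasurePreserving (Sph.act g) (surf n) (surf n) := by
  refine ⟨(Sph.continuous_act g).measurable, ?_⟩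
  ext s hs
  rw [Measure.map_apply (Sph.continuous_act g).measurable hs, Measure.toSphere_apply' _ hs,
    Measure.toSphere_apply' _ ((Sph.continuous_act g).measurable hs)]
  congr 1
  have h := (g.measurePreserving).measure_preimage_emb
    (g.toHomeomorph.measurableEmbedding) (Set.Ioo (0 : ℝ) 1 • ((↑) '' s))
  rw [← h]
  congr 1
  ext z
  simp only [Set.mem_smul, Set.mem_image, Set.mem_preimage]
  constructor
  · rintro ⟨r, hr, _, ⟨x, hx, rfl⟩, rfl⟩
    exact ⟨r, hr, _, ⟨_, hx, rfl⟩, by simp⟩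
  · rintro ⟨r, hr, _, ⟨x, hx, rfl⟩, hz⟩
    refine ⟨r, hr, _, ⟨Sph.act g.symm x, ?_, rfl⟩, ?_⟩
    · have : Sph.act g (Sph.act g.symm x) = x := Subtype.ext (by simp)
      simpa [this] using hx
    · apply g.injective
      simpa using hz

lemma Sph.integral_act (g : Eucl n ≃ₗᵢ[ℝ] Eucl n) (f : Sph n → ℝ) :
    ∫ x, f (Sph.act g x) ∂(surf n) = ∫ x, f x ∂(surf n) := by
  have hemb : MeasurableEmbedding (Sph.act g) :=
    (Sph.isometry_act g).isClosedEmbedding.measurableEmbedding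
  exact (Sph.measurePreserving_act g).integral_comp hemb f

lemma Sph.lintegral_act (g : Eucl n ≃ₗᵢ[ℝ] Eucl n) (f : Sph n → ℝ≥0∞) :
    ∫⁻ x, f (Sph.act g x) ∂(surf n) = ∫⁻ x, f x ∂(surf n) := by
  have hemb : MeasurableEmbedding (Sph.act g) :=
    (Sph.isometry_act g).isClosedEmbedding.measurableEmbedding
  exact (Sph.measurePreserving_act g).lintegral_comp_emb hemb f

/-- The reflection across the hyperplane orthogonal to `e`. -/
noncomputable abbrev hypRefl (e : Eucl n) : Eucl n ≃ₗᵢ[ℝ] Eucl n := (ℝ ∙ e)ᗮ.reflection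

lemma hypRefl_apply (e : Eucl n) (he : ‖e‖ = 1) (x : Eucl n) :
    hypRefl e x = x - (2 * inner ℝ x e) • e := by
  rw [hypRefl, Submodule.reflection_orthogonal_apply, Submodule.reflection_singleton_apply]
  simp [he, real_inner_comm]
  module

lemma exists_isometry_map (x y : Sph n) : ∃ g : Eucl n ≃ₗᵢ[ℝ] Eucl n, Sph.act g x = y :=
  ⟨_, Subtype.ext (Submodule.reflection_sub (v := (x : Eucl n)) (w := y) (by simp))⟩

lemma norm_sub_sq_sph (x y : Sph n) : ‖(x : Eucl n) - y‖ ^ 2 = 2 - 2 * inner ℝ (x : Eucl n) y := by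
  rw [norm_sub_sq_real]; simp; ring

lemma abs_inner_sph_le (x y : Sph n) : |inner ℝ (x : Eucl n) (y : Eucl n)| ≤ 1 := by
  simpa using abs_real_inner_le_norm (x : Eucl n) y

end Basics

section Forms

variable {n : ℕ}

/-- The zonal kernel on the sphere with profile `k`. -/
noncomputable def zon (k : ℝ → ℝ) (x y : Sph n) : ℝ := k (inner ℝ (x : Eucl n) (y : Eucl n))

/-- The eigenvalue of a zonal kernel on linear functions. -/
noncomputable def linEig (n : ℕ) (k : ℝ → ℝ) : ℝ :=
  (∫ x : Sph n, ∫ y : Sph n, zon k x y * inner ℝ (x : Eucl n) (y : Eucl n) ∂(surf n) ∂(surf n))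
    / (surf n).real Set.univ

/-- The quadratic form `μ‖u‖² - ⟨Ku, u⟩` of a zonal kernel, `μ` being its eigenvalue on linear
functions. -/
noncomputable def defForm (k : ℝ → ℝ) (u : Sph n → ℝ) : ℝ :=
  linEig n k * ∫ x, u x ^ 2 ∂(surf n) -
    ∫ z : Sph n × Sph n, zon k z.1 z.2 * u z.1 * u z.2 ∂((surf n).prod (surf n))

lemma integrable_of_continuous_sph {f : Sph n → ℝ} (hf : Continuous f) :
    Integrable f (surf n) :=
  hf.integrable_of_hasCompactSupport (HasCompactSupport.of_compactSpace f)

lemma integrable_of_continuous_sph2 {f : Sph n × Sph n → ℝ} (hf : Continuous f) :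
    Integrable f ((surf n).prod (surf n)) :=
  hf.integrable_of_hasCompactSupport (HasCompactSupport.of_compactSpace f)

lemma surf_univ_pos (hn : 1 ≤ n) : 0 < (surf n).real Set.univ := by
  have : Nonempty (Fin n) := ⟨⟨0, hn⟩⟩
  rw [Measure.toSphere_real_apply_univ]
  have h1 : 0 < (volume : Measure (Eucl n)).real (ball 0 1) :=
    ENNReal.toReal_pos (measure_ball_pos _ _ one_pos).ne' measure_ball_lt_top.ne
  have : 0 < Module.finrank ℝ (Eucl n) := by rw [finrank_euclideanSpace_fin]; omega
  positivity

lemma continuous_zon {k : ℝ → ℝ} (hk : Continuous k) :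
    Continuous (fun z : Sph n × Sph n => zon k z.1 z.2) := by
  unfold zon; fun_prop

lemma zon_act (k : ℝ → ℝ) (g : Eucl n ≃ₗᵢ[ℝ] Eucl n) (x y : Sph n) :
    zon k (Sph.act g x) (Sph.act g y) = zon k x y := by
  simp [zon]

lemma integral_zon_inner_self (hn : 1 ≤ n) (k : ℝ → ℝ) (x : Sph n) :
    ∫ y : Sph n, zon k x y * inner ℝ (x : Eucl n) (y : Eucl n) ∂(surf n) = linEig n k := by
  have key : ∀ x' : Sph n, ∫ y : Sph n, zon k x' y * inner ℝ (x' : Eucl n) (y : Eucl n) ∂(surf n)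
      = ∫ y : Sph n, zon k x y * inner ℝ (x : Eucl n) (y : Eucl n) ∂(surf n) := by
    intro x'
    obtain ⟨g, rfl⟩ := exists_isometry_map x x'
    rw [← Sph.integral_act g]
    simp [zon]
  have hpos := surf_univ_pos hn
  rw [linEig]
  simp_rw [key]
  rw [integral_const, smul_eq_mul]
  field_simp

lemma integral_zon_inner (hn : 1 ≤ n) {k : ℝ → ℝ} (hk : Continuous k) (x : Sph n) (e : Eucl n) :
    ∫ y : Sph n, zon k x y * inner ℝ (y : Eucl n) e ∂(surf n)
      = linEig n k * inner ℝ (x : Eucl n) e := by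
  have hx := Sph.norm_eq x
  set a : ℝ := inner ℝ (x : Eucl n) e
  set e' : Eucl n := e - a • (x : Eucl n)
  have hperp : inner ℝ (x : Eucl n) e' = 0 := by
    simp [e', inner_sub_right, inner_smul_right, a]
  have hc : ∀ w : Eucl n, Continuous (fun y : Sph n => zon k x y * inner ℝ (y : Eucl n) w) := by
    intro w
    exact ((continuous_zon hk).comp (by fun_prop : Continuous fun y : Sph n => (x, y))).mul
      (by fun_prop)
  have hzero : ∫ y : Sph n, zon k x y * inner ℝ (y : Eucl n) e' ∂(surf n) = 0 := by
    have h1 := Sph.integral_act (hypRefl e')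
      (fun y : Sph n => zon k x y * inner ℝ (y : Eucl n) e')
    have hxx : Sph.act (hypRefl e') x = x := by
      apply Subtype.ext
      simp only [Sph.coe_act]
      apply Submodule.reflection_mem_subspace_eq_self
      rw [Submodule.mem_orthogonal_singleton_iff_inner_left]
      exact hperp
    have h2 : ∀ y : Sph n, zon k x (Sph.act (hypRefl e') y)
        * inner ℝ ((Sph.act (hypRefl e') y : Sph n) : Eucl n) e'
        = -(zon k x y * inner ℝ (y : Eucl n) e') := by
      intro y
      have : zon k x (Sph.act (hypRefl e') y) = zon k x y := by
        rw [← zon_act k (hypRefl e') x y, hxx]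
      rw [this, Sph.coe_act]
      have : inner ℝ (hypRefl e' (y : Eucl n)) e' = - inner ℝ (y : Eucl n) e' := by
        have h3 : hypRefl e' e' = -e' := Submodule.reflection_orthogonalComplement_singleton_eq_neg e'
        have h4 := (hypRefl e').inner_map_map (y : Eucl n) e'
        rw [h3, inner_neg_right] at h4
        linarith
      rw [this]; ring
    simp_rw [h2, integral_neg] at h1
    linarith
  have hdec : ∀ y : Sph n, zon k x y * inner ℝ (y : Eucl n) e
      = a * (zon k x y * inner ℝ (x : Eucl n) (y : Eucl n)) + zon k x y * inner ℝ (y : Eucl n) e' := by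
    intro y
    simp only [e', inner_sub_right, inner_smul_right, real_inner_comm]
    ring
  simp_rw [hdec]
  have hc' : Continuous (fun y : Sph n => zon k x y * inner ℝ (x : Eucl n) (y : Eucl n)) := by
    simpa [real_inner_comm] using hc x
  rw [integral_add ((integrable_of_continuous_sph hc').const_mul a)
    (integrable_of_continuous_sph (hc e')), hzero, integral_const_mul,
    integral_zon_inner_self hn]
  ring

lemma integral_sq_inner (hn : 1 ≤ n) (x : Sph n) :
    ∫ y : Sph n, inner ℝ (x : Eucl n) (y : Eucl n) ^ 2 ∂(surf n) = (surf n).real Set.univ / n := by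
  have key : ∀ x' : Sph n, ∫ y : Sph n, inner ℝ (x' : Eucl n) (y : Eucl n) ^ 2 ∂(surf n)
      = ∫ y : Sph n, inner ℝ (x : Eucl n) (y : Eucl n) ^ 2 ∂(surf n) := by
    intro x'
    obtain ⟨g, rfl⟩ := exists_isometry_map x x'
    rw [← Sph.integral_act g]
    simp
  have hsum : ∑ i : Fin n, ∫ y : Sph n, inner ℝ (EuclideanSpace.single i (1 : ℝ)) (y : Eucl n) ^ 2 ∂(surf n)
      = (surf n).real Set.univ := by
    rw [← integral_finsetSum]
    · have : ∀ y : Sph n, ∑ i : Fin n, inner ℝ (EuclideanSpace.single i (1 : ℝ)) (y : Eucl n) ^ 2 = 1 := by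
        intro y
        have := EuclideanSpace.real_norm_sq_eq (y : Eucl n)
        simp at this
        simp [EuclideanSpace.inner_single_left, ← this]
      simp [this]
    · intro i _
      exact integrable_of_continuous_sph (by fun_prop)
  have h2 : ∀ i : Fin n, ∫ y : Sph n, inner ℝ (EuclideanSpace.single i (1 : ℝ)) (y : Eucl n) ^ 2 ∂(surf n)
      = ∫ y : Sph n, inner ℝ (x : Eucl n) (y : Eucl n) ^ 2 ∂(surf n) := by
    intro i
    exact key ⟨EuclideanSpace.single i (1 : ℝ), by simp⟩
  simp only [h2, Finset.sum_const, Finset.card_univ, Fintype.card_fin, nsmul_eq_mul] at hsum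
  have : (n : ℝ) ≠ 0 := by positivity
  field_simp
  linarith

end Forms

section OddRep

variable {n : ℕ}

/-- The antisymmetrization of a zonal kernel under the reflection orthogonal to `e`. -/
noncomputable def oddKer (k : ℝ → ℝ) (e : Eucl n) (x y : Sph n) : ℝ :=
  zon k x y - zon k x (Sph.act (hypRefl e) y)

lemma continuous_oddKer {k : ℝ → ℝ} (hk : Continuous k) (e : Eucl n) :
    Continuous (fun z : Sph n × Sph n => oddKer k e z.1 z.2) := by
  have h1 := continuous_zon (n := n) hk
  have h2 := h1.comp (continuous_fst.prodMk ((Sph.continuous_act (hypRefl e)).comp continuous_snd))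
  exact h1.sub h2

lemma act_act_refl (e : Eucl n) (x : Sph n) :
    Sph.act (hypRefl e) (Sph.act (hypRefl e) x) = x :=
  Subtype.ext (by simp)

lemma oddKer_symm (k : ℝ → ℝ) (e : Eucl n) (x y : Sph n) : oddKer k e x y = oddKer k e y x := by
  unfold oddKer
  rw [← zon_act k (hypRefl e) x (Sph.act (hypRefl e) y), act_act_refl]
  simp [zon, real_inner_comm]

lemma inner_refl_self (e : Eucl n) (x : Eucl n) :
    inner ℝ (hypRefl e x) e = - inner ℝ x e := by
  have h3 : hypRefl e e = -e := Submodule.reflection_orthogonalComplement_singleton_eq_neg e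
  have h4 := (hypRefl e).inner_map_map x e
  rw [h3, inner_neg_right] at h4
  linarith

lemma integral_oddKer_inner (hn : 1 ≤ n) {k : ℝ → ℝ} (hk : Continuous k) (e : Eucl n) (x : Sph n) :
    ∫ y : Sph n, oddKer k e x y * inner ℝ (y : Eucl n) e ∂(surf n)
      = 2 * linEig n k * inner ℝ (x : Eucl n) e := by
  have h1 := integral_zon_inner hn hk x e
  have h2 := Sph.integral_act (hypRefl e)
    (fun y : Sph n => zon k x (Sph.act (hypRefl e) y) * inner ℝ (y : Eucl n) e)
  simp only [act_act_refl, Sph.coe_act, inner_refl_self, mul_neg, integral_neg] at h2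
  have hcx : Continuous (fun y : Sph n => zon k x y) :=
    (continuous_zon hk).comp (by fun_prop : Continuous fun y : Sph n => (x, y))
  have hc : Continuous (fun y : Sph n => zon k x y * inner ℝ (y : Eucl n) e) :=
    hcx.mul (by fun_prop)
  have hc2 : Continuous (fun y : Sph n => zon k x (Sph.act (hypRefl e) y) * inner ℝ (y : Eucl n) e) :=
    (hcx.comp (Sph.continuous_act _)).mul (by fun_prop)
  simp only [oddKer, sub_mul]
  rw [integral_sub (integrable_of_continuous_sph hc) (integrable_of_continuous_sph hc2), ← h2, h1]
  ring

lemma integrable_prod_of_bounded {F : Sph n × Sph n → ℝ} (hF : Measurable F) {C : ℝ}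
    (hC : ∀ z, |F z| ≤ C) : Integrable F ((surf n).prod (surf n)) :=
  Integrable.of_bound hF.aestronglyMeasurable C (Filter.Eventually.of_forall hC)

lemma defForm_odd (hn : 1 ≤ n) {k : ℝ → ℝ} (hk : Continuous k) (e : Eucl n)
    {u : Sph n → ℝ} (hu : Continuous u) (hodd : ∀ x, u (Sph.act (hypRefl e) x) = - u x)
    {f : Sph n → ℝ} (hf : Measurable f) {B : ℝ} (hB : ∀ x, |f x| ≤ B)
    (huf : ∀ x : Sph n, u x = f x * inner ℝ (x : Eucl n) e) :
    defForm k u = 1 / 4 * ∫ z : Sph n × Sph n, oddKer k e z.1 z.2 * inner ℝ (z.1 : Eucl n) e *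
      inner ℝ (z.2 : Eucl n) e * (f z.1 - f z.2) ^ 2 ∂((surf n).prod (surf n)) := by
  have hocont := continuous_oddKer hk e
  set W : Sph n × Sph n → ℝ := fun z => oddKer k e z.1 z.2 * inner ℝ (z.1 : Eucl n) e *
      inner ℝ (z.2 : Eucl n) e with hW
  have hWc : Continuous W := by
    apply (hocont.mul _).mul <;> fun_prop
  obtain ⟨CW, hCW⟩ : ∃ C, ∀ z, |W z| ≤ C := by
    obtain ⟨C, hC⟩ := isCompact_univ.exists_bound_of_continuousOn hWc.continuousOn
    exact ⟨C, fun z => hC z (Set.mem_univ z)⟩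
  have hb : ∀ a b : Sph n, |f a * f b| ≤ B * B := by
    intro a b
    rw [abs_mul]
    exact mul_le_mul (hB a) (hB b) (abs_nonneg _) ((abs_nonneg _).trans (hB a))
  have hintble : ∀ φ ψ : Sph n × Sph n → Sph n, Measurable φ → Measurable ψ →
      Integrable (fun z => W z * (f (φ z) * f (ψ z))) ((surf n).prod (surf n)) := by
    intro φ ψ hφ hψ
    refine integrable_prod_of_bounded (C := CW * (B * B))
      (hWc.measurable.mul ((hf.comp hφ).mul (hf.comp hψ))) fun z => ?_
    rw [abs_mul]
    exact mul_le_mul (hCW z) (hb _ _) (abs_nonneg _) ((abs_nonneg _).trans (hCW z))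
  have hexp : ∀ z, W z * (f z.1 - f z.2) ^ 2 = W z * (f z.1 * f z.1) + W z * (f z.2 * f z.2)
      - 2 * (W z * (f z.1 * f z.2)) := fun z => by ring
  have e1 : ∫ z, W z * (f z.1 * f z.1) ∂((surf n).prod (surf n))
      = 2 * linEig n k * ∫ x, u x ^ 2 ∂(surf n) := by
    rw [integral_prod _ (hintble _ _ measurable_fst measurable_fst), ← integral_const_mul]
    refine integral_congr_ae (Filter.Eventually.of_forall fun x => ?_)
    have := integral_oddKer_inner hn hk e x
    simp only [hW]
    have h' : ∀ y : Sph n, oddKer k e x y * inner ℝ (x : Eucl n) e * inner ℝ (y : Eucl n) e *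
        (f x * f x) = (inner ℝ (x : Eucl n) e * (f x * f x)) *
          (oddKer k e x y * inner ℝ (y : Eucl n) e) := fun y => by ring
    simp_rw [h', integral_const_mul, this, huf]
    ring
  have hsymm : ∀ z : Sph n × Sph n, W z.swap = W z := by
    intro z
    simp only [hW, Prod.fst_swap, Prod.snd_swap]
    rw [oddKer_symm]; ring
  have e2 : ∫ z, W z * (f z.2 * f z.2) ∂((surf n).prod (surf n))
      = ∫ z, W z * (f z.1 * f z.1) ∂((surf n).prod (surf n)) := by
    have := integral_prod_swap (μ := surf n) (ν := surf n) (fun z => W z * (f z.1 * f z.1))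
    rw [← this]
    refine integral_congr_ae (Filter.Eventually.of_forall fun z => ?_)
    show W z * (f z.2 * f z.2) = W z.swap * (f z.2 * f z.2)
    rw [hsymm]
  have e3 : ∫ z, W z * (f z.1 * f z.2) ∂((surf n).prod (surf n))
      = 2 * ∫ z : Sph n × Sph n, zon k z.1 z.2 * u z.1 * u z.2 ∂((surf n).prod (surf n)) := by
    have h1 : ∀ z, W z * (f z.1 * f z.2) = zon k z.1 z.2 * u z.1 * u z.2
        - zon k z.1 (Sph.act (hypRefl e) z.2) * u z.1 * u z.2 := by
      intro z
      simp only [hW, huf, oddKer]; ring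
    have hzc := continuous_zon (n := n) hk
    have c1 : Continuous fun z : Sph n × Sph n => zon k z.1 z.2 * u z.1 * u z.2 :=
      (hzc.mul (hu.comp continuous_fst)).mul (hu.comp continuous_snd)
    have c2 : Continuous fun z : Sph n × Sph n =>
        zon k z.1 (Sph.act (hypRefl e) z.2) * u z.1 * u z.2 :=
      ((hzc.comp (continuous_fst.prodMk ((Sph.continuous_act (hypRefl e)).comp continuous_snd))).mul
        (hu.comp continuous_fst)).mul (hu.comp continuous_snd)
    simp_rw [h1]
    rw [integral_sub (integrable_of_continuous_sph2 c1) (integrable_of_continuous_sph2 c2)]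
    have h2 : ∫ z : Sph n × Sph n, zon k z.1 (Sph.act (hypRefl e) z.2) * u z.1 * u z.2
        ∂((surf n).prod (surf n))
        = - ∫ z : Sph n × Sph n, zon k z.1 z.2 * u z.1 * u z.2 ∂((surf n).prod (surf n)) := by
      rw [integral_prod _ (integrable_of_continuous_sph2 c1),
        integral_prod _ (integrable_of_continuous_sph2 c2), ← integral_neg]
      refine integral_congr_ae (Filter.Eventually.of_forall fun x => ?_)
      have := Sph.integral_act (hypRefl e)
        (fun y : Sph n => zon k x (Sph.act (hypRefl e) y) * u x * u y)
      simp only [act_act_refl, hodd, mul_neg, integral_neg] at this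
      exact this.symm
    rw [h2]; ring
  have hfold : ∫ z : Sph n × Sph n, oddKer k e z.1 z.2 * inner ℝ (z.1 : Eucl n) e *
      inner ℝ (z.2 : Eucl n) e * (f z.1 - f z.2) ^ 2 ∂((surf n).prod (surf n))
      = ∫ z, (W z * (f z.1 * f z.1) + W z * (f z.2 * f z.2)
      - 2 * (W z * (f z.1 * f z.2))) ∂((surf n).prod (surf n)) :=
    integral_congr_ae (Filter.Eventually.of_forall hexp)
  have i1 := hintble _ _ measurable_fst measurable_fst
  have i2 := hintble _ _ measurable_snd measurable_snd
  have i3 := (hintble _ _ measurable_fst measurable_snd).const_mul 2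
  have hs := integral_sub (i1.add i2) i3
  have ha := integral_add i1 i2
  simp only [Pi.add_apply] at hs
  rw [hfold, hs, ha, integral_const_mul, e2, e1, e3, defForm]
  ring

end OddRep

section Compactness

open scoped BoundedContinuousFunction

variable {n : ℕ}

lemma continuous_quad {Z : Type*} [TopologicalSpace Z] [CompactSpace Z] [MeasurableSpace Z]
    [OpensMeasurableSpace Z] (m : Measure Z) [IsFiniteMeasure m]
    {X : Type*} [TopologicalSpace X] {K : Z → ℝ} (hK : Continuous K) {α β : Z → X}
    (hα : Continuous α) (hβ : Continuous β) :
    Continuous fun v : X →ᵇ ℝ => ∫ z, K z * v (α z) * v (β z) ∂m := by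
  obtain ⟨C, hC⟩ := isCompact_univ.exists_bound_of_continuousOn hK.continuousOn
  rw [continuous_iff_continuousAt]
  intro v₀
  have hnb : ∀ᶠ v : X →ᵇ ℝ in nhds v₀, ‖v‖ < ‖v₀‖ + 1 :=
    (continuous_norm.tendsto v₀).eventually (gt_mem_nhds (lt_add_one _))
  refine continuousAt_of_dominated (bound := fun _ => C * (‖v₀‖ + 1) * (‖v₀‖ + 1)) ?_ ?_ ?_ ?_
  · refine Filter.Eventually.of_forall fun v => ?_
    exact ((hK.mul (v.continuous.comp hα)).mul (v.continuous.comp hβ)).measurable.aestronglyMeasurable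
  · filter_upwards [hnb] with v hv
    refine Filter.Eventually.of_forall fun z => ?_
    rw [norm_mul, norm_mul]
    have h1 := (v.norm_coe_le_norm (α z)).trans hv.le
    have h2 := (v.norm_coe_le_norm (β z)).trans hv.le
    have h3 := hC z (Set.mem_univ z)
    have : 0 ≤ C := (norm_nonneg _).trans h3
    gcongr
  · exact integrable_const _
  · refine Filter.Eventually.of_forall fun z => ?_
    have : ∀ x : X, Continuous fun v : X →ᵇ ℝ => v x := fun x =>
      (BoundedContinuousFunction.lipschitz_eval_const x).continuous
    exact ((continuous_const.mul (this _)).mul (this _)).continuousAt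

lemma continuous_bcf_integral {X : Type*} [TopologicalSpace X] [MeasurableSpace X]
    [OpensMeasurableSpace X] (m : Measure X) [IsFiniteMeasure m] :
    Continuous fun v : X →ᵇ ℝ => ∫ x, v x ∂m := by
  rw [continuous_iff_continuousAt]
  intro v₀
  have hnb : ∀ᶠ v : X →ᵇ ℝ in nhds v₀, ‖v‖ < ‖v₀‖ + 1 :=
    (continuous_norm.tendsto v₀).eventually (gt_mem_nhds (lt_add_one _))
  refine continuousAt_of_dominated (bound := fun _ => ‖v₀‖ + 1) ?_ ?_ (integrable_const _) ?_
  · exact Filter.Eventually.of_forall fun v => v.continuous.measurable.aestronglyMeasurable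
  · filter_upwards [hnb] with v hv
    exact Filter.Eventually.of_forall fun z => (v.norm_coe_le_norm z).trans hv.le
  · exact Filter.Eventually.of_forall fun x =>
      (BoundedContinuousFunction.lipschitz_eval_const x).continuous.continuousAt

lemma defForm_act (k : ℝ → ℝ) (u : Sph n → ℝ) (g : Eucl n ≃ₗᵢ[ℝ] Eucl n) :
    defForm k (fun x => u (Sph.act g x)) = defForm k u := by
  unfold defForm
  rw [Sph.integral_act g (fun x => u x ^ 2)]
  have hemb : MeasurableEmbedding (Sph.act g) :=
    (Sph.isometry_act g).isClosedEmbedding.measurableEmbedding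
  have hmp := (Sph.measurePreserving_act g).prod (Sph.measurePreserving_act g)
  have := hmp.integral_comp (hemb.prodMap hemb)
    (fun z : Sph n × Sph n => zon k z.1 z.2 * u z.1 * u z.2)
  simp only [Prod.map_fst, Prod.map_snd, zon_act] at this
  simp only [this]

lemma quad_parallelogram {Z : Type*} [TopologicalSpace Z] [CompactSpace Z] [MeasurableSpace Z]
    [OpensMeasurableSpace Z] (m : Measure Z) [IsFiniteMeasure m]
    {X : Type*} [TopologicalSpace X] {K : Z → ℝ} (hK : Continuous K) {α β : Z → X}
    (hα : Continuous α) (hβ : Continuous β) {u v : X → ℝ} (hu : Continuous u) (hv : Continuous v) :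
    ∫ z, K z * (1 / 2 * (u (α z) + v (α z))) * (1 / 2 * (u (β z) + v (β z))) ∂m +
      ∫ z, K z * (1 / 2 * (u (α z) - v (α z))) * (1 / 2 * (u (β z) - v (β z))) ∂m
      = 1 / 2 * (∫ z, K z * u (α z) * u (β z) ∂m + ∫ z, K z * v (α z) * v (β z) ∂m) := by
  have hi : ∀ {F : Z → ℝ}, Continuous F → Integrable F m := fun hF =>
    hF.integrable_of_hasCompactSupport (HasCompactSupport.of_compactSpace _)
  rw [← integral_add (hi (by fun_prop)) (hi (by fun_prop)),
    ← integral_add (hi (by fun_prop)) (hi (by fun_prop)), ← integral_const_mul]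
  congr 1
  ext z
  ring

lemma defForm_eq_quad (k : ℝ → ℝ) (u : Sph n → ℝ) : defForm k u =
    linEig n k * ∫ x, 1 * u x * u x ∂(surf n) -
    ∫ z : Sph n × Sph n, zon k z.1 z.2 * u z.1 * u z.2 ∂((surf n).prod (surf n)) := by
  simp [defForm, sq]

lemma defForm_parallelogram {k : ℝ → ℝ} (hk : Continuous k) {u v : Sph n → ℝ} (hu : Continuous u)
    (hv : Continuous v) :
    defForm k (fun x => 1 / 2 * (u x + v x)) + defForm k (fun x => 1 / 2 * (u x - v x))
      = 1 / 2 * (defForm k u + defForm k v) := by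
  have h1 := quad_parallelogram (surf n) (K := fun _ => 1) continuous_const continuous_id
    continuous_id hu hv
  have h2 := quad_parallelogram ((surf n).prod (surf n)) (continuous_zon (n := n) hk)
    continuous_fst continuous_snd hu hv
  simp only [id] at h1
  simp only [defForm_eq_quad]
  linear_combination (linEig n k) * h1 - h2

/-- If the form of a zonal kernel is nonnegative on Lipschitz functions that are odd with respect
to some reflection, then it is nonnegative on all Lipschitz functions of mean zero. -/
lemma defForm_nonneg_of_odd {k : ℝ → ℝ} (hk : Continuous k)
    (hodd : ∀ (e : Eucl n) (w : Sph n → ℝ) (L : NNReal), ‖e‖ = 1 → LipschitzWith L w →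
      (∀ x, w (Sph.act (hypRefl e) x) = - w x) → 0 ≤ defForm k w)
    {u : Sph n → ℝ} {L : NNReal} (hu : LipschitzWith L u) (hmean : ∫ x, u x ∂(surf n) = 0) :
    0 ≤ defForm k u := by
  let ub : Sph n →ᵇ ℝ := BoundedContinuousFunction.mkOfCompact ⟨u, hu.continuous⟩
  let A : Set (Sph n →ᵇ ℝ) := {v | LipschitzWith L v ∧ (∀ x, v x ∈ Set.Icc (-‖ub‖) ‖ub‖) ∧
    ∫ x, v x ∂(surf n) = 0 ∧ defForm k v ≤ defForm k u}
  have hq2 : Continuous fun v : Sph n →ᵇ ℝ => ∫ x, 1 * v x * v x ∂(surf n) :=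
    continuous_quad (surf n) (K := fun _ => 1) continuous_const continuous_id continuous_id
  have hqd : Continuous fun v : Sph n →ᵇ ℝ => defForm k v := by
    simp only [defForm_eq_quad]
    exact (continuous_const.mul hq2).sub
      (continuous_quad _ (continuous_zon (n := n) hk) continuous_fst continuous_snd)
  have hmeanc : Continuous fun v : Sph n →ᵇ ℝ => ∫ x, v x ∂(surf n) :=
    continuous_bcf_integral (surf n)
  have hclosed : IsClosed A := by
    have h1 : IsClosed {v : Sph n →ᵇ ℝ | LipschitzWith L v} := by
      have : {v : Sph n →ᵇ ℝ | LipschitzWith L v}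
          = ⋂ x : Sph n, ⋂ y : Sph n, {v | dist (v x) (v y) ≤ L * dist x y} := by
        ext v; simp [lipschitzWith_iff_dist_le_mul]
      rw [this]
      refine isClosed_iInter fun x => isClosed_iInter fun y => isClosed_le ?_ continuous_const
      exact (BoundedContinuousFunction.lipschitz_eval_const x).continuous.dist
        (BoundedContinuousFunction.lipschitz_eval_const y).continuous
    have h2 : IsClosed {v : Sph n →ᵇ ℝ | ∀ x, v x ∈ Set.Icc (-‖ub‖) ‖ub‖} := by
      have : {v : Sph n →ᵇ ℝ | ∀ x, v x ∈ Set.Icc (-‖ub‖) ‖ub‖}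
          = ⋂ x : Sph n, {v | v x ∈ Set.Icc (-‖ub‖) ‖ub‖} := by
        ext v; simp
      rw [this]
      exact isClosed_iInter fun x => isClosed_Icc.preimage
        (BoundedContinuousFunction.lipschitz_eval_const x).continuous
    exact h1.inter (h2.inter ((isClosed_eq hmeanc continuous_const).inter
      (isClosed_le hqd continuous_const)))
  have hcomp : IsCompact A := by
    refine BoundedContinuousFunction.arzela_ascoli₂ (Set.Icc (-‖ub‖) ‖ub‖) isCompact_Icc A hclosed
      (fun f x hf => hf.2.1 x) ?_
    exact (LipschitzWith.uniformEquicontinuous (fun f : A => (f : Sph n → ℝ)) L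
      (fun f => f.2.1)).equicontinuous
  have hne : ub ∈ A := by
    refine ⟨hu, fun x => ?_, hmean, le_rfl⟩
    exact abs_le.mp (ub.norm_coe_le_norm x)
  obtain ⟨v, ⟨hvL, hvB, hvm, hvd⟩, hvmin⟩ :=
    hcomp.exists_isMinOn ⟨ub, hne⟩ hq2.continuousOn
  have hvc : Continuous v := v.continuous
  have hinv : ∀ e : Eucl n, ‖e‖ = 1 → ∀ x, v (Sph.act (hypRefl e) x) = v x := by
    intro e he
    set vr : Sph n → ℝ := fun x => v (Sph.act (hypRefl e) x) with hvr
    have hvrL : LipschitzWith L vr := by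
      have := hvL.comp (Sph.isometry_act (hypRefl e)).lipschitz
      rwa [mul_one] at this
    have hvrc : Continuous vr := hvrL.continuous
    have hPL : LipschitzWith L fun x => 1 / 2 * (v x + vr x) := by
      refine LipschitzWith.of_dist_le_mul fun x y => ?_
      have h1 := hvL.dist_le_mul x y
      have h2 := hvrL.dist_le_mul x y
      rw [Real.dist_eq] at h1 h2 ⊢
      rw [abs_le] at h1 h2 ⊢
      constructor <;> linarith
    have hML : LipschitzWith L fun x => 1 / 2 * (v x - vr x) := by
      refine LipschitzWith.of_dist_le_mul fun x y => ?_
      have h1 := hvL.dist_le_mul x y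
      have h2 := hvrL.dist_le_mul x y
      rw [Real.dist_eq] at h1 h2 ⊢
      rw [abs_le] at h1 h2 ⊢
      constructor <;> linarith
    have hMnn : 0 ≤ defForm k fun x => 1 / 2 * (v x - vr x) := by
      refine hodd e _ L he hML fun x => ?_
      simp only [hvr, act_act_refl]; ring
    have hpar := defForm_parallelogram hk hvc hvrc
    have hact : defForm k vr = defForm k v := defForm_act k v (hypRefl e)
    have hPd : defForm k (fun x => 1 / 2 * (v x + vr x)) ≤ defForm k u := by
      rw [hact] at hpar; linarith
    let P : Sph n →ᵇ ℝ := BoundedContinuousFunction.mkOfCompact ⟨_, hPL.continuous⟩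
    have hPA : P ∈ A := by
      refine ⟨hPL, fun x => ?_, ?_, hPd⟩
      · have h1 := hvB x
        have h2 := hvB (Sph.act (hypRefl e) x)
        simp only [P, BoundedContinuousFunction.mkOfCompact_apply, ContinuousMap.coe_mk, hvr]
        constructor <;> linarith [h1.1, h1.2, h2.1, h2.2]
      · have : ∫ x, P x ∂(surf n) = ∫ x, 1 / 2 * (v x + vr x) ∂(surf n) := rfl
        rw [this, integral_const_mul, integral_add (integrable_of_continuous_sph hvc)
          (integrable_of_continuous_sph hvrc), hvm, Sph.integral_act (hypRefl e) v, hvm]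
        simp
    have hmin : ∫ x, 1 * v x * v x ∂(surf n) ≤ ∫ x, 1 * P x * P x ∂(surf n) := hvmin hPA
    have hpar2 := quad_parallelogram (surf n) (K := fun _ => 1) continuous_const continuous_id
      continuous_id hvc hvrc
    simp only [id] at hpar2
    have hvr2 : ∫ x, 1 * vr x * vr x ∂(surf n) = ∫ x, 1 * v x * v x ∂(surf n) :=
      Sph.integral_act (hypRefl e) (fun x => 1 * v x * v x)
    have hP2 : ∫ x, 1 * P x * P x ∂(surf n)
      = ∫ x, 1 * (1 / 2 * (v x + vr x)) * (1 / 2 * (v x + vr x)) ∂(surf n) := rfl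
    have hM0 : ∫ x, 1 * (1 / 2 * (v x - vr x)) * (1 / 2 * (v x - vr x)) ∂(surf n) = 0 := by
      apply le_antisymm
      · rw [hP2] at hmin; rw [hvr2] at hpar2; linarith
      · refine integral_nonneg fun x => ?_
        simp only [one_mul, Pi.zero_apply]
        exact mul_self_nonneg _
    have hMc : Continuous fun x => 1 * (1 / 2 * (v x - vr x)) * (1 / 2 * (v x - vr x)) := by
      fun_prop
    intro x
    by_contra hne
    have hM0' := Continuous.integral_pos_of_hasCompactSupport_nonneg_nonzero (μ := surf n) (x := x)
      hMc (HasCompactSupport.of_compactSpace _) (fun x => by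
        simp only [one_mul, Pi.zero_apply]; exact mul_self_nonneg _) (by
      simp only [one_mul, hvr]
      have : v x - v (Sph.act (hypRefl e) x) ≠ 0 := sub_ne_zero.mpr (Ne.symm hne)
      positivity)
    linarith
  have hconst : ∀ x y, v x = v y := by
    intro x y
    by_cases hxy : x = y
    · rw [hxy]
    · have hne : (x : Eucl n) - y ≠ 0 := sub_ne_zero.mpr (fun h => hxy (Subtype.ext h))
      set e : Eucl n := (‖(x : Eucl n) - y‖⁻¹ : ℝ) • ((x : Eucl n) - y) with he
      have he1 : ‖e‖ = 1 := by
        rw [he, norm_smul, norm_inv, norm_norm, inv_mul_cancel₀ (norm_ne_zero_iff.mpr hne)]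
      have hax : Sph.act (hypRefl e) x = y := by
        apply Subtype.ext
        have hs : (ℝ ∙ e) = (ℝ ∙ ((x : Eucl n) - y)) :=
          Submodule.span_singleton_smul_eq
            (IsUnit.mk0 _ (inv_ne_zero (norm_ne_zero_iff.mpr hne))) _
        simp only [Sph.coe_act, hypRefl, hs]
        exact Submodule.reflection_sub (by simp)
      rw [← hinv e he1 x, hax]
  by_cases hX : Nonempty (Sph n)
  · obtain ⟨x₀⟩ := hX
    have hv0 : ∀ x, v x = 0 := by
      have h1 : ∫ x, v x ∂(surf n) = (surf n).real Set.univ * v x₀ := by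
        simp_rw [hconst _ x₀]
        simp
      have hpos : (surf n).real Set.univ ≠ 0 := by
        refine (ENNReal.toReal_pos ?_ (measure_ne_top _ _)).ne'
        exact isOpen_univ.measure_ne_zero _ ⟨x₀, Set.mem_univ _⟩
      intro x
      rw [hconst x x₀]
      rw [hvm] at h1
      rcases mul_eq_zero.mp h1.symm with h | h
      · exact absurd h hpos
      · exact h
    have : defForm k v = 0 := by
      simp [defForm, hv0]
    linarith
  · have : IsEmpty (Sph n) := not_nonempty_iff.mp hX
    have : defForm k u = 0 := by
      simp [defForm, Measure.eq_zero_of_isEmpty]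
    linarith

end Compactness

section Homog

variable {n : ℕ}

/-- The extension of a function on the sphere to a function homogeneous of degree zero. -/
noncomputable def homExt (f : Sph n → ℝ) : Eucl n → ℝ :=
  Function.extend (Subtype.val : ({0}ᶜ : Set (Eucl n)) → Eucl n)
    (fun z => f (homeomorphUnitSphereProd (Eucl n) z).1) 0

lemma homExt_smul (f : Sph n → ℝ) {r : ℝ} (hr : 0 < r) (x : Sph n) :
    homExt f (r • (x : Eucl n)) = f x := by
  have hne : r • (x : Eucl n) ∈ ({0}ᶜ : Set (Eucl n)) := by
    have : (x : Eucl n) ≠ 0 := by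
      intro h
      have := Sph.norm_eq x
      rw [h, norm_zero] at this
      exact zero_ne_one this
    simp [hr.ne', this]
  have h1 := Subtype.val_injective.extend_apply
    (fun z : ({0}ᶜ : Set (Eucl n)) => f (homeomorphUnitSphereProd (Eucl n) z).1) 0 ⟨_, hne⟩
  unfold homExt
  rw [h1]
  congr 1
  apply Subtype.ext
  simp [norm_smul, abs_of_pos hr, smul_smul, hr.ne']

lemma measurable_homExt {f : Sph n → ℝ} (hf : Measurable f) : Measurable (homExt f) := by
  refine (MeasurableEmbedding.subtype_coe (measurableSet_singleton 0).compl).measurable_extend ?_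
    measurable_const
  exact hf.comp (measurable_fst.comp (homeomorphUnitSphereProd (Eucl n)).continuous.measurable)

end Homog

section Chain

variable {n : ℕ}

/-- Localized weight of a pair of nearby points in a half annulus. -/
noncomputable def chainW (e : Eucl n) (M : ℕ) (p q : Eucl n) : ℝ :=
  open Classical in
  if ‖p - q‖ ≤ 4 / M ∧ (1 / 2 ≤ ‖p‖ ∧ ‖p‖ ≤ 2) ∧ (1 / 2 ≤ ‖q‖ ∧ ‖q‖ ≤ 2) ∧
      (0 < inner ℝ p e ∧ 0 < inner ℝ q e) then
    min (inner ℝ p e * inner ℝ q e) ((inner ℝ p e * inner ℝ q e) ^ 2 * M ^ 2) else 0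

lemma chainW_nonneg (e : Eucl n) (M : ℕ) (p q : Eucl n) : 0 ≤ chainW e M p q := by
  unfold chainW
  split_ifs with h
  · have := h.2.2.2
    have := mul_pos this.1 this.2
    exact le_min this.le (by positivity)
  · exact le_rfl

lemma measurable_chainW (e : Eucl n) (M : ℕ) :
    Measurable fun z : Eucl n × Eucl n => chainW e M z.1 z.2 := by
  unfold chainW
  refine Measurable.ite ?_ (by fun_prop) measurable_const
  have m1 : MeasurableSet {z : Eucl n × Eucl n | ‖z.1 - z.2‖ ≤ 4 / M} :=
    measurableSet_le (by fun_prop) (by fun_prop)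
  have m2 : ∀ φ : Eucl n × Eucl n → Eucl n, Measurable φ →
      MeasurableSet {z : Eucl n × Eucl n | 1 / 2 ≤ ‖φ z‖ ∧ ‖φ z‖ ≤ 2} := fun φ hφ =>
    (measurableSet_le measurable_const hφ.norm).inter (measurableSet_le hφ.norm measurable_const)
  have m4 : ∀ φ : Eucl n × Eucl n → Eucl n, Measurable φ →
      MeasurableSet {z : Eucl n × Eucl n | (0 : ℝ) < inner ℝ (φ z) e} := fun φ hφ =>
    measurableSet_lt measurable_const (hφ.inner_const)
  have m3 : MeasurableSet {z : Eucl n × Eucl n | 0 < inner ℝ z.1 e ∧ 0 < inner ℝ z.2 e} :=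
    (m4 _ measurable_fst).inter (m4 _ measurable_snd)
  exact m1.inter ((m2 _ measurable_fst).inter ((m2 _ measurable_snd).inter m3))

lemma sq_norm_segment_ge {a b : Eucl n} (ha : 1 ≤ ‖a‖) (hb : 1 ≤ ‖b‖)
    (hab : -(‖a‖ * ‖b‖ / 2) ≤ inner ℝ a b) {t : ℝ} (h0 : 0 ≤ t) (h1 : t ≤ 1) :
    1 / 2 ≤ ‖(1 - t) • a + t • b‖ := by
  have h2 : ‖(1 - t) • a + t • b‖ ^ 2 = (1 - t) ^ 2 * ‖a‖ ^ 2 + 2 * ((1 - t) * t * inner ℝ a b)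
      + t ^ 2 * ‖b‖ ^ 2 := by
    rw [norm_add_sq_real, norm_smul, norm_smul, inner_smul_left, inner_smul_right, mul_pow, mul_pow]
    simp; ring
  have h3 : (1 - t) * t * (-(‖a‖ * ‖b‖ / 2)) ≤ (1 - t) * t * inner ℝ a b :=
    mul_le_mul_of_nonneg_left hab (mul_nonneg (by linarith) h0)
  have h4 : 1 ≤ (1 - t) * ‖a‖ + t * ‖b‖ := by nlinarith
  have h5 : (1 / 2 : ℝ) ^ 2 ≤ ‖(1 - t) • a + t • b‖ ^ 2 := by
    rw [h2]
    nlinarith [sq_nonneg ((1 - t) * ‖a‖ - t * ‖b‖)]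
  exact le_of_sq_le_sq h5 (norm_nonneg _) 

lemma chain_pointwise {e : Eucl n} (he : ‖e‖ = 1) (g : Eucl n → ℝ) {M : ℕ} (hM : 1 ≤ M)
    {a v : Eucl n} (ha1 : 1 ≤ ‖a‖) (ha2 : ‖a‖ ≤ 2) (hae : 0 < inner ℝ a e)
    (hb : ‖a + (M : ℝ) • v - (3 / 2 : ℝ) • e‖ ≤ 1 / 2) :
    inner ℝ a e ^ 2 * (g a - g (a + (M : ℝ) • v)) ^ 2 ≤
      4 * M * ∑ j ∈ Finset.range M, chainW e M (a + (j : ℝ) • v) (a + ((j : ℝ) + 1) • v) *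
        (g (a + (j : ℝ) • v) - g (a + ((j : ℝ) + 1) • v)) ^ 2 := by
  have hM0 : (0 : ℝ) < M := by exact_mod_cast hM
  set b := a + (M : ℝ) • v with hbdef
  have hee : inner ℝ e e = (1 : ℝ) := by rw [real_inner_self_eq_norm_sq, he]; norm_num
  have hbe : 1 ≤ inner ℝ b e := by
    have h1 := abs_real_inner_le_norm (b - (3 / 2 : ℝ) • e) e
    rw [inner_sub_left, inner_smul_left, hee, he] at h1
    have := (abs_le.mp h1).1
    simp at this
    linarith
  have hbn1 : 1 ≤ ‖b‖ := by
    have := abs_real_inner_le_norm b e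
    rw [he, mul_one] at this
    exact hbe.trans ((le_abs_self _).trans this)
  have hbn2 : ‖b‖ ≤ 2 := by
    have : b = (b - (3 / 2 : ℝ) • e) + (3 / 2 : ℝ) • e := by abel
    rw [this]
    refine (norm_add_le _ _).trans ?_
    rw [norm_smul, he]; norm_num; linarith
  have hab : -(‖a‖ * ‖b‖ / 2) ≤ inner ℝ a b := by
    have h1 := abs_real_inner_le_norm a (b - (3 / 2 : ℝ) • e)
    rw [inner_sub_right, inner_smul_right] at h1
    have h2 := (abs_le.mp h1).1
    have h3 : ‖a‖ * ‖b - (3 / 2 : ℝ) • e‖ ≤ ‖a‖ * (1 / 2) := by gcongr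
    nlinarith [norm_nonneg a]
  have hv : v = (1 / M : ℝ) • (b - a) := by
    rw [hbdef]; simp [smul_smul, hM0.ne']
  have hvn : ‖v‖ ≤ 4 / M := by
    rw [hv, norm_smul, Real.norm_eq_abs, abs_of_pos (by positivity)]
    have := norm_sub_le b a
    rw [div_mul_eq_mul_div, one_mul]
    gcongr; linarith
  have hpt : ∀ t : ℝ, a + t • v = (1 - t / M) • a + (t / M) • b := by
    intro t
    rw [hbdef, smul_add, smul_smul, div_mul_cancel₀ _ hM0.ne']
    module
  have hin : ∀ t : ℝ, inner ℝ (a + t • v) e = (1 - t / M) * inner ℝ a e + t / M * inner ℝ b e := by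
    intro t
    rw [hpt, inner_add_left, inner_smul_left, inner_smul_left]; simp
  have hae2 : inner ℝ a e ≤ 2 := by
    have := abs_real_inner_le_norm a e
    rw [he, mul_one] at this
    exact ((le_abs_self _).trans this).trans ha2
  have hpos : ∀ t : ℝ, 0 ≤ t → t ≤ M → inner ℝ a e / 2 ≤ inner ℝ (a + t • v) e ∧
      t / M ≤ inner ℝ (a + t • v) e ∧ 1 / 2 ≤ ‖a + t • v‖ ∧ ‖a + t • v‖ ≤ 2 := by
    intro t ht0 ht1
    have hs0 : 0 ≤ t / M := by positivity
    have hs1 : t / M ≤ 1 := (div_le_one hM0).mpr ht1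
    refine ⟨?_, ?_, ?_, ?_⟩
    · rw [hin]; nlinarith
    · rw [hin]; nlinarith
    · rw [hpt]; exact sq_norm_segment_ge ha1 hbn1 hab hs0 hs1
    · rw [hpt]
      refine (norm_add_le _ _).trans ?_
      rw [norm_smul, norm_smul, Real.norm_eq_abs, Real.norm_eq_abs, abs_of_nonneg hs0,
        abs_of_nonneg (by linarith)]
      nlinarith
  have htel : g a - g b = ∑ j ∈ Finset.range M, (g (a + (j : ℝ) • v) - g (a + ((j : ℝ) + 1) • v)) := by
    have := Finset.sum_range_sub' (fun j : ℕ => g (a + (j : ℝ) • v)) M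
    simp only [Nat.cast_add, Nat.cast_one, Nat.cast_zero, zero_smul, add_zero] at this
    rw [this]
  have hcs : (g a - g b) ^ 2 ≤ M *
      ∑ j ∈ Finset.range M, (g (a + (j : ℝ) • v) - g (a + ((j : ℝ) + 1) • v)) ^ 2 := by
    rw [htel]
    simpa using sq_sum_le_card_mul_sum_sq (s := Finset.range M)
      (f := fun j : ℕ => g (a + (j : ℝ) • v) - g (a + ((j : ℝ) + 1) • v))
  calc inner ℝ a e ^ 2 * (g a - g b) ^ 2 ≤ inner ℝ a e ^ 2 * (M *
      ∑ j ∈ Finset.range M, (g (a + (j : ℝ) • v) - g (a + ((j : ℝ) + 1) • v)) ^ 2) := by gcongr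
    _ = M * ∑ j ∈ Finset.range M,
        inner ℝ a e ^ 2 * (g (a + (j : ℝ) • v) - g (a + ((j : ℝ) + 1) • v)) ^ 2 := by
      rw [← Finset.mul_sum]; ring
    _ ≤ M * ∑ j ∈ Finset.range M, 4 * (chainW e M (a + (j : ℝ) • v) (a + ((j : ℝ) + 1) • v) *
        (g (a + (j : ℝ) • v) - g (a + ((j : ℝ) + 1) • v)) ^ 2) := by
      refine mul_le_mul_of_nonneg_left (Finset.sum_le_sum fun j hj => ?_) hM0.le
      have hjM : (j : ℝ) + 1 ≤ M := by exact_mod_cast Finset.mem_range.mp hj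
      obtain ⟨p1, -, p3, p4⟩ := hpos j (by positivity) (by linarith)
      obtain ⟨q1, q2, q3, q4⟩ := hpos (j + 1) (by positivity) hjM
      rw [← mul_assoc]
      refine mul_le_mul_of_nonneg_right ?_ (sq_nonneg _)
      have hq5 : 1 / M ≤ inner ℝ (a + ((j : ℝ) + 1) • v) e := by
        refine le_trans ?_ q2
        gcongr
        linarith [(Nat.cast_nonneg j : (0 : ℝ) ≤ j)]
      have hcond : ‖(a + (j : ℝ) • v) - (a + ((j : ℝ) + 1) • v)‖ ≤ 4 / M := by
        have : (a + (j : ℝ) • v) - (a + ((j : ℝ) + 1) • v) = - v := by module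
        rw [this, norm_neg]; exact hvn
      have hp0 : 0 < inner ℝ (a + (j : ℝ) • v) e := by linarith
      have hq0 : 0 < inner ℝ (a + ((j : ℝ) + 1) • v) e := by linarith
      unfold chainW
      rw [if_pos ⟨hcond, ⟨p3, p4⟩, ⟨q3, q4⟩, hp0, hq0⟩]
      set P := inner ℝ (a + (j : ℝ) • v) e
      set Q := inner ℝ (a + ((j : ℝ) + 1) • v) e
      set A := inner ℝ a e
      have hPQ : A ^ 2 ≤ 4 * (P * Q) := by
        have := mul_le_mul p1 q1 (by positivity) hp0.le
        nlinarith
      rw [mul_min_of_nonneg _ _ (by norm_num)]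
      refine le_min hPQ ?_
      have hQM : 1 ≤ Q * M := by rwa [div_le_iff₀ hM0] at hq5
      have h1 : A ^ 2 ≤ (2 * P) ^ 2 := by gcongr; linarith
      have h2 : 1 ≤ (Q * M) ^ 2 := one_le_pow₀ hQM
      calc A ^ 2 ≤ (2 * P) ^ 2 * 1 := by linarith
        _ ≤ (2 * P) ^ 2 * (Q * M) ^ 2 := by gcongr
        _ = _ := by ring
    _ = _ := by rw [← Finset.mul_sum]; ring

end Chain

section Bulk

variable {n : ℕ}

lemma lintegral_add_smul_right (a : Eucl n) {r : ℝ} (hr : 0 < r) {G : Eucl n → ℝ≥0∞}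
    (hG : Measurable G) :
    ∫⁻ b, G b = ENNReal.ofReal (r ^ n) * ∫⁻ v, G (a + r • v) := by
  have h1 : ∫⁻ v, G (a + r • v) = ENNReal.ofReal ((r ^ n)⁻¹) * ∫⁻ w, G w := by
    have h2 : ∫⁻ v, G (a + r • v) = ∫⁻ w, G (a + w) ∂(Measure.map (r • ·) volume) := by
      rw [lintegral_map (by fun_prop) (by fun_prop)]
    rw [h2, Measure.map_addHaar_smul _ hr.ne', lintegral_smul_measure, lintegral_add_left_eq_self]
    simp [abs_of_pos hr]
  rw [h1, ← mul_assoc, ← ENNReal.ofReal_mul (by positivity), mul_inv_cancel₀ (by positivity)]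
  simp

lemma lintegral_lintegral_shift {Φ : Eucl n → Eucl n → ℝ≥0∞}
    (hΦ : Measurable (Function.uncurry Φ)) (t : ℝ) :
    ∫⁻ a, ∫⁻ v, Φ (a + t • v) (a + (t + 1) • v) = ∫⁻ p, ∫⁻ q, Φ p q := by
  have hm : Measurable fun z : Eucl n × Eucl n => Φ (z.1 + t • z.2) (z.1 + (t + 1) • z.2) :=
    hΦ.comp (by fun_prop : Measurable fun z : Eucl n × Eucl n =>
      (z.1 + t • z.2, z.1 + (t + 1) • z.2))
  have hm2 : Measurable fun z : Eucl n × Eucl n => Φ z.2 (z.2 + z.1) :=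
    hΦ.comp (by fun_prop : Measurable fun z : Eucl n × Eucl n => (z.2, z.2 + z.1))
  rw [lintegral_lintegral_swap hm.aemeasurable]
  have h1 : ∀ v : Eucl n, ∫⁻ a, Φ (a + t • v) (a + (t + 1) • v) = ∫⁻ p, Φ p (p + v) := by
    intro v
    rw [← lintegral_add_right_eq_self (fun p => Φ p (p + v)) (t • v)]
    refine lintegral_congr fun a => ?_
    congr 1
    module
  simp_rw [h1]
  rw [lintegral_lintegral_swap hm2.aemeasurable]
  refine lintegral_congr fun p => ?_
  exact lintegral_add_left_eq_self (fun q => Φ p q) p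

/-- The half annulus. -/
def halfAnn (e : Eucl n) : Set (Eucl n) := {a | 1 ≤ ‖a‖ ∧ ‖a‖ ≤ 2 ∧ 0 < inner ℝ a e}

lemma measurableSet_halfAnn (e : Eucl n) : MeasurableSet (halfAnn e) := by
  have h1 : MeasurableSet {a : Eucl n | 1 ≤ ‖a‖} := measurableSet_le (by fun_prop) (by fun_prop)
  have h2 : MeasurableSet {a : Eucl n | ‖a‖ ≤ 2} := measurableSet_le (by fun_prop) (by fun_prop)
  have h3 : MeasurableSet {a : Eucl n | (0 : ℝ) < inner ℝ a e} :=
    measurableSet_lt measurable_const (measurable_id.inner_const)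
  exact h1.inter (h2.inter h3)

lemma measurable_chain_integrand (e : Eucl n) (M : ℕ) {g : Eucl n → ℝ} (hg : Measurable g) :
    Measurable (Function.uncurry fun p q => ENNReal.ofReal (chainW e M p q * (g p - g q) ^ 2)) := by
  have h1 : Measurable fun z : Eucl n × Eucl n => g z.1 - g z.2 :=
    (hg.comp measurable_fst).sub (hg.comp measurable_snd)
  have h2 : Measurable fun z : Eucl n × Eucl n => chainW e M z.1 z.2 * (g z.1 - g z.2) ^ 2 :=
    (measurable_chainW e M).mul (h1.pow_const 2)
  exact ENNReal.measurable_ofReal.comp h2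

lemma bulk_chain {e : Eucl n} (he : ‖e‖ = 1) {g : Eucl n → ℝ} (hg : Measurable g) {M : ℕ}
    (hM : 1 ≤ M) :
    ∫⁻ a in halfAnn e, ∫⁻ b in closedBall ((3 / 2 : ℝ) • e) (1 / 2),
      ENNReal.ofReal (inner ℝ a e ^ 2 * (g a - g b) ^ 2) ≤
    ENNReal.ofReal (4 * M ^ (n + 2)) *
      ∫⁻ p, ∫⁻ q, ENNReal.ofReal (chainW e M p q * (g p - g q) ^ 2) := by
  have hM0 : (0 : ℝ) < M := by exact_mod_cast hM
  obtain ⟨Φ, hΦdef⟩ : ∃ Φ : Eucl n → Eucl n → ℝ≥0∞, ∀ p q,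
    ENNReal.ofReal (chainW e M p q * (g p - g q) ^ 2) = Φ p q := ⟨_, fun _ _ => rfl⟩
  have hΦ : Measurable (Function.uncurry Φ) := by
    have h : Function.uncurry Φ = Function.uncurry fun p q =>
        ENNReal.ofReal (chainW e M p q * (g p - g q) ^ 2) := by
      ext ⟨p, q⟩
      exact (hΦdef p q).symm
    rw [h]
    exact measurable_chain_integrand e M hg
  simp_rw [hΦdef]
  have hΦj : ∀ t : ℝ, Measurable fun z : Eucl n × Eucl n =>
      Φ (z.1 + t • z.2) (z.1 + (t + 1) • z.2) := fun t =>
    hΦ.comp (by fun_prop : Measurable fun z : Eucl n × Eucl n =>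
      (z.1 + t • z.2, z.1 + (t + 1) • z.2))
  have hpt : ∀ a ∈ halfAnn e, ∫⁻ b in closedBall ((3 / 2 : ℝ) • e) (1 / 2),
      ENNReal.ofReal (inner ℝ a e ^ 2 * (g a - g b) ^ 2) ≤
      ENNReal.ofReal (M ^ n * (4 * M)) * ∑ j ∈ Finset.range M,
        ∫⁻ v, Φ (a + (j : ℝ) • v) (a + ((j : ℝ) + 1) • v) := by
    intro a ha
    rw [← lintegral_indicator measurableSet_closedBall, lintegral_add_smul_right a hM0
      (Measurable.indicator (by fun_prop) measurableSet_closedBall),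
      ENNReal.ofReal_mul (by positivity), mul_assoc]
    gcongr
    have hΦa : ∀ j : ℕ, Measurable fun v => Φ (a + (j : ℝ) • v) (a + ((j : ℝ) + 1) • v) :=
      fun j => (hΦj j).comp measurable_prodMk_left
    rw [← lintegral_finsetSum _ (fun j _ => hΦa j),
      ← lintegral_const_mul' _ _ ENNReal.ofReal_ne_top]
    refine lintegral_mono fun v => ?_
    by_cases hv : a + (M : ℝ) • v ∈ closedBall ((3 / 2 : ℝ) • e) (1 / 2)
    · rw [Set.indicator_of_mem hv]
      rw [mem_closedBall, dist_eq_norm] at hv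
      have := chain_pointwise he g hM ha.1 ha.2.1 ha.2.2 hv
      refine (ENNReal.ofReal_le_ofReal this).trans (le_of_eq ?_)
      rw [ENNReal.ofReal_mul (by positivity), ENNReal.ofReal_sum_of_nonneg]
      · simp_rw [hΦdef]
      intro j _
      exact mul_nonneg (chainW_nonneg _ _ _ _) (sq_nonneg _)
    · rw [Set.indicator_of_notMem hv]; exact zero_le
  calc _ ≤ ∫⁻ a in halfAnn e, ENNReal.ofReal (M ^ n * (4 * M)) * ∑ j ∈ Finset.range M,
        ∫⁻ v, Φ (a + (j : ℝ) • v) (a + ((j : ℝ) + 1) • v) :=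
        setLIntegral_mono' (measurableSet_halfAnn e) hpt
    _ ≤ ∫⁻ a, ENNReal.ofReal (M ^ n * (4 * M)) * ∑ j ∈ Finset.range M,
        ∫⁻ v, Φ (a + (j : ℝ) • v) (a + ((j : ℝ) + 1) • v) := setLIntegral_le_lintegral _ _
    _ = ENNReal.ofReal (M ^ n * (4 * M)) * ∑ j ∈ Finset.range M, ∫⁻ p, ∫⁻ q, Φ p q := by
      rw [lintegral_const_mul' _ _ ENNReal.ofReal_ne_top, lintegral_finsetSum]
      · simp_rw [lintegral_lintegral_shift hΦ]
      · intro j _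
        exact (hΦj j).lintegral_prod_right'
    _ = _ := by
      rw [Finset.sum_const, Finset.card_range, nsmul_eq_mul, ← mul_assoc]
      congr 1
      rw [← ENNReal.ofReal_natCast, ← ENNReal.ofReal_mul (by positivity)]
      congr 1
      ring

/-- The spherical weight dominating `chainW`. -/
noncomputable def sphW (e : Eucl n) (M : ℕ) (x y : Sph n) : ℝ :=
  open Classical in
  if ‖(x : Eucl n) - y‖ ≤ 8 / M ∧ (0 < inner ℝ (x : Eucl n) e ∧ 0 < inner ℝ (y : Eucl n) e) then
    min (inner ℝ (x : Eucl n) e * inner ℝ (y : Eucl n) e)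
      ((inner ℝ (x : Eucl n) e * inner ℝ (y : Eucl n) e) ^ 2 * M ^ 2) else 0

lemma sphW_nonneg (e : Eucl n) (M : ℕ) (x y : Sph n) : 0 ≤ sphW e M x y := by
  unfold sphW
  split_ifs with h
  · have := mul_pos h.2.1 h.2.2
    exact le_min this.le (by positivity)
  · exact le_rfl

lemma norm_smul_sub_smul_sq (x y : Sph n) (r ρ : ℝ) :
    ‖r • (x : Eucl n) - ρ • (y : Eucl n)‖ ^ 2 = (r - ρ) ^ 2 + r * ρ * ‖(x : Eucl n) - y‖ ^ 2 := by
  rw [norm_sub_sq_sph, norm_sub_sq_real, norm_smul, norm_smul, inner_smul_left, inner_smul_right,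
    mul_pow, mul_pow]
  simp
  ring

lemma chainW_smul_le (e : Eucl n) {M : ℕ} (hM : 1 ≤ M) (x y : Sph n) {r ρ : ℝ} (hr : 0 < r)
    (hρ : 0 < ρ) :
    chainW e M (r • (x : Eucl n)) (ρ • (y : Eucl n)) ≤
      16 * sphW e M x y ∧ (chainW e M (r • (x : Eucl n)) (ρ • (y : Eucl n)) ≠ 0 →
        (1 / 2 ≤ r ∧ r ≤ 2) ∧ (1 / 2 ≤ ρ ∧ ρ ≤ 2) ∧ |ρ - r| ≤ 4 / M) := by
  have hM0 : (0 : ℝ) < M := by exact_mod_cast hM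
  unfold chainW
  split_ifs with h
  · obtain ⟨h1, h2, h3, h4⟩ := h
    rw [norm_smul, Sph.norm_eq, mul_one, Real.norm_eq_abs, abs_of_pos hr] at h2
    rw [norm_smul, Sph.norm_eq, mul_one, Real.norm_eq_abs, abs_of_pos hρ] at h3
    rw [inner_smul_left, inner_smul_left] at h4
    simp only [conj_trivial] at h4
    have h5 : ‖r • (x : Eucl n) - ρ • (y : Eucl n)‖ ^ 2 ≤ (4 / M) ^ 2 := by gcongr
    rw [norm_smul_sub_smul_sq] at h5
    have hrρ : 1 / 4 ≤ r * ρ := by nlinarith [h2.1, h3.1]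
    have hrρ2 : r * ρ ≤ 4 := by nlinarith [h2.2, h3.2]
    have hd : ‖(x : Eucl n) - y‖ ≤ 8 / M := by
      have : ‖(x : Eucl n) - y‖ ^ 2 ≤ (8 / M) ^ 2 := by
        have : (8 / (M : ℝ)) ^ 2 = 4 * (4 / M) ^ 2 := by ring
        nlinarith [sq_nonneg (r - ρ), sq_nonneg ‖(x : Eucl n) - y‖]
      exact le_of_sq_le_sq this (by positivity)
    have hx : 0 < inner ℝ (x : Eucl n) e := by
      have := h4.1; exact (mul_pos_iff_of_pos_left hr).mp this
    have hy : 0 < inner ℝ (y : Eucl n) e := by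
      have := h4.2; exact (mul_pos_iff_of_pos_left hρ).mp this
    refine ⟨?_, fun _ => ⟨h2, h3, ?_⟩⟩
    · unfold sphW
      rw [if_pos ⟨hd, hx, hy⟩, inner_smul_left, inner_smul_left]
      simp only [conj_trivial]
      set X := inner ℝ (x : Eucl n) e
      set Y := inner ℝ (y : Eucl n) e
      have hXY := mul_pos hx hy
      have e1 : r * X * (ρ * Y) = (r * ρ) * (X * Y) := by ring
      rw [e1, mul_min_of_nonneg _ _ (by norm_num)]
      refine min_le_min ?_ ?_
      · nlinarith
      · have : (r * ρ * (X * Y)) ^ 2 ≤ 16 * (X * Y) ^ 2 := by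
          rw [mul_pow]
          gcongr
          nlinarith
        nlinarith [sq_nonneg (M : ℝ)]
    · rw [abs_sub_comm]
      have : |r - ρ| ^ 2 ≤ (4 / M) ^ 2 := by
        rw [sq_abs]
        have := mul_nonneg (by positivity : 0 ≤ r * ρ) (sq_nonneg ‖(x : Eucl n) - y‖)
        linarith
      exact le_of_sq_le_sq this (by positivity)
  · exact ⟨mul_nonneg (by norm_num) (sphW_nonneg _ _ _ _), fun h => absurd rfl h⟩

lemma bulk_to_sphere (hn : 1 ≤ n) (e : Eucl n) {f : Sph n → ℝ} (hf : Measurable f) {M : ℕ}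
    (hM : 1 ≤ M) :
    ∫⁻ p, ∫⁻ q, ENNReal.ofReal (chainW e M p q * (homExt f p - homExt f q) ^ 2) ≤
      ENNReal.ofReal (192 * 4 ^ (n - 1) / M) * ∫⁻ x, ∫⁻ y,
        ENNReal.ofReal (sphW e M x y * (f x - f y) ^ 2) ∂(surf n) ∂(surf n) := by
  have hM0 : (0 : ℝ) < M := by exact_mod_cast hM
  have hΦ := measurable_chain_integrand e M (measurable_homExt hf)
  obtain ⟨W, hW⟩ : ∃ W : Eucl n → Eucl n → ℝ, ∀ p q, chainW e M p q = W p q :=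
    ⟨_, fun _ _ => rfl⟩
  obtain ⟨S, hS⟩ : ∃ S : Sph n → Sph n → ℝ, ∀ p q, sphW e M p q = S p q :=
    ⟨_, fun _ _ => rfl⟩
  have hle := fun (x y : Sph n) (r ρ : ℝ) (hr : 0 < r) (hρ : 0 < ρ) =>
    chainW_smul_le e hM x y hr hρ
  have hWnn := chainW_nonneg e M
  simp only [hW, hS] at hΦ hle hWnn ⊢
  have hΦ1 : Measurable fun p => ∫⁻ q, ENNReal.ofReal (W p q *
    (homExt f p - homExt f q) ^ 2) := hΦ.lintegral_prod_right'
  have hΦ2 : ∀ p, Measurable fun q => ENNReal.ofReal (W p q *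
    (homExt f p - homExt f q) ^ 2) := fun p => hΦ.comp measurable_prodMk_left
  rw [lintegral_polar' hn _ hΦ1, ← lintegral_const_mul' _ _ ENNReal.ofReal_ne_top]
  refine lintegral_mono fun x => ?_
  have key : ∀ r ∈ Set.Ioi (0 : ℝ), ENNReal.ofReal (r ^ (n - 1)) *
      ∫⁻ q, ENNReal.ofReal (W (r • (x : Eucl n)) q *
        (homExt f (r • (x : Eucl n)) - homExt f q) ^ 2) ≤
      Set.indicator (Set.Icc (1 / 2) 2) (fun _ => ENNReal.ofReal (128 * 4 ^ (n - 1) / M) *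
        ∫⁻ y, ENNReal.ofReal (S x y * (f x - f y) ^ 2) ∂(surf n)) r := by
    intro r hr
    rw [lintegral_polar' hn _ (hΦ2 _),
      ← lintegral_const_mul' _ _ ENNReal.ofReal_ne_top]
    have hpt : ∀ y : Sph n, ENNReal.ofReal (r ^ (n - 1)) * ∫⁻ ρ in Set.Ioi (0 : ℝ),
        ENNReal.ofReal (ρ ^ (n - 1)) * ENNReal.ofReal (W (r • (x : Eucl n)) (ρ • (y : Eucl n)) *
        (homExt f (r • (x : Eucl n)) - homExt f (ρ • (y : Eucl n))) ^ 2) ≤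
        Set.indicator (Set.Icc (1 / 2) 2) (fun _ => ENNReal.ofReal (128 * 4 ^ (n - 1) / M) *
          ENNReal.ofReal (S x y * (f x - f y) ^ 2)) r := by
      intro y
      rw [← lintegral_const_mul' _ _ ENNReal.ofReal_ne_top]
      have hb : ∀ ρ ∈ Set.Ioi (0 : ℝ), ENNReal.ofReal (r ^ (n - 1)) *
          (ENNReal.ofReal (ρ ^ (n - 1)) * ENNReal.ofReal (W (r • (x : Eucl n)) (ρ • (y : Eucl n)) *
          (homExt f (r • (x : Eucl n)) - homExt f (ρ • (y : Eucl n))) ^ 2)) ≤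
          Set.indicator (Set.Icc (r - 4 / M) (r + 4 / M)) (fun _ =>
          Set.indicator (Set.Icc (1 / 2) 2) (fun _ => ENNReal.ofReal (16 * 4 ^ (n - 1)) *
          ENNReal.ofReal (S x y * (f x - f y) ^ 2)) r) ρ := by
        intro ρ hρ
        rw [homExt_smul f hr, homExt_smul f hρ]
        obtain ⟨h1, h2⟩ := hle x y r ρ hr hρ
        by_cases h0 : W (r • (x : Eucl n)) (ρ • (y : Eucl n)) = 0
        · simp [h0]
        · obtain ⟨hr2, hρ2, hd⟩ := h2 h0
          rw [abs_le] at hd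
          rw [Set.indicator_of_mem (Set.mem_Icc.mpr ⟨by linarith [hd.1], by linarith [hd.2]⟩),
            Set.indicator_of_mem (Set.mem_Icc.mpr hr2)]
          rw [Set.mem_Ioi] at hr hρ
          rw [← ENNReal.ofReal_mul (by positivity), ← ENNReal.ofReal_mul (by positivity),
            ← ENNReal.ofReal_mul (by positivity)]
          apply ENNReal.ofReal_le_ofReal
          have hc := hWnn (r • (x : Eucl n)) (ρ • (y : Eucl n))
          have hpow : r ^ (n - 1) * ρ ^ (n - 1) ≤ 4 ^ (n - 1) := by
            rw [← mul_pow]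
            gcongr
            nlinarith [hr2.2, hρ2.2]
          calc r ^ (n - 1) * (ρ ^ (n - 1) * (W (r • (x : Eucl n)) (ρ • (y : Eucl n)) *
              (f x - f y) ^ 2)) = (r ^ (n - 1) * ρ ^ (n - 1)) *
                (W (r • (x : Eucl n)) (ρ • (y : Eucl n)) * (f x - f y) ^ 2) := by ring
            _ ≤ 4 ^ (n - 1) * (16 * S x y * (f x - f y) ^ 2) := by gcongr
            _ = _ := by ring
      refine (setLIntegral_mono' measurableSet_Ioi hb).trans ((setLIntegral_le_lintegral _ _).trans ?_)
      rw [lintegral_indicator measurableSet_Icc, setLIntegral_const, Real.volume_Icc]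
      have : r + 4 / M - (r - 4 / M) = 8 / M := by ring
      rw [this]
      by_cases hrm : r ∈ Set.Icc (1 / 2 : ℝ) 2
      · rw [Set.indicator_of_mem hrm, Set.indicator_of_mem hrm, mul_right_comm,
          ← ENNReal.ofReal_mul (by positivity)]
        apply le_of_eq
        congr 2
        ring
      · rw [Set.indicator_of_notMem hrm, zero_mul]; exact zero_le
    refine (lintegral_mono hpt).trans ?_
    by_cases hrm : r ∈ Set.Icc (1 / 2 : ℝ) 2
    · simp only [Set.indicator_of_mem hrm]
      rw [lintegral_const_mul' _ _ ENNReal.ofReal_ne_top]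
    · simp only [Set.indicator_of_notMem hrm, lintegral_const, zero_mul, le_refl]
  refine (setLIntegral_mono' measurableSet_Ioi key).trans ((setLIntegral_le_lintegral _ _).trans ?_)
  rw [lintegral_indicator measurableSet_Icc, setLIntegral_const, Real.volume_Icc, mul_right_comm,
    ← ENNReal.ofReal_mul (by positivity), ← lintegral_const_mul' _ _ ENNReal.ofReal_ne_top,
    ← lintegral_const_mul' _ _ ENNReal.ofReal_ne_top]
  apply le_of_eq
  congr 1
  ext y
  congr 2
  ring

end Bulk

section Combine

variable {n : ℕ}

/-- The weighted mean over a ball of the squared increments of `g` from the value `f x`. -/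
noncomputable def ballOsc (e : Eucl n) (f : Sph n → ℝ) (x : Sph n) : ℝ≥0∞ :=
  ∫⁻ b in closedBall ((3 / 2 : ℝ) • e) (1 / 2),
    ENNReal.ofReal (inner ℝ (x : Eucl n) e ^ 2 * (f x - homExt f b) ^ 2)

lemma measurable_ballOsc (e : Eucl n) {f : Sph n → ℝ} (hf : Measurable f) :
    Measurable (ballOsc e f) := by
  have h1 : Measurable fun z : Sph n × Eucl n => f z.1 - homExt f z.2 :=
    (hf.comp measurable_fst).sub ((measurable_homExt hf).comp measurable_snd)
  have h2 : Measurable fun z : Sph n × Eucl n => inner ℝ (z.1 : Eucl n) e ^ 2 := by fun_prop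
  have h3 : Measurable fun z : Sph n × Eucl n =>
      ENNReal.ofReal (inner ℝ (z.1 : Eucl n) e ^ 2 * (f z.1 - homExt f z.2) ^ 2) :=
    ENNReal.measurable_ofReal.comp (h2.mul (h1.pow_const 2))
  exact h3.lintegral_prod_right'

lemma abs_inner_le_one {e : Eucl n} (he : ‖e‖ = 1) (x : Sph n) :
    inner ℝ (x : Eucl n) e ^ 2 ≤ 1 := by
  have := abs_real_inner_le_norm (x : Eucl n) e
  rw [he, Sph.norm_eq, mul_one] at this
  rw [← sq_abs]
  nlinarith [abs_nonneg (inner ℝ (x : Eucl n) e)]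

lemma volume_mul_osc_le {e : Eucl n} (he : ‖e‖ = 1) {f : Sph n → ℝ} (hf : Measurable f) :
    volume (closedBall ((3 / 2 : ℝ) • e) (1 / 2)) * ∫⁻ x, ∫⁻ y,
      ENNReal.ofReal (inner ℝ (x : Eucl n) e ^ 2 * inner ℝ (y : Eucl n) e ^ 2 * (f x - f y) ^ 2)
        ∂(surf n) ∂(surf n) ≤
      4 * surf n Set.univ * ∫⁻ x, ballOsc e f x ∂(surf n) := by
  set Z := closedBall ((3 / 2 : ℝ) • e) (1 / 2) with hZ
  have hZtop : volume Z ≠ ∞ := measure_closedBall_lt_top.ne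
  have hA := measurable_ballOsc e hf
  have hpt : ∀ x y : Sph n, volume Z * ENNReal.ofReal (inner ℝ (x : Eucl n) e ^ 2 *
      inner ℝ (y : Eucl n) e ^ 2 * (f x - f y) ^ 2) ≤ 2 * (ballOsc e f x + ballOsc e f y) := by
    intro x y
    rw [mul_comm, ← setLIntegral_const, ballOsc, ballOsc, ← lintegral_add_left, ← lintegral_const_mul']
    · refine lintegral_mono fun b => ?_
      have h2 : (2 : ℝ≥0∞) = ENNReal.ofReal 2 := by simp
      rw [← ENNReal.ofReal_add (by positivity) (by positivity)]
      refine le_trans ?_ (le_of_eq (congrArg (· * _) h2.symm))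
      dsimp only
      rw [← ENNReal.ofReal_mul (by norm_num)]
      apply ENNReal.ofReal_le_ofReal
      have hx := abs_inner_le_one he x
      have hy := abs_inner_le_one he y
      set a := inner ℝ (x : Eucl n) e ^ 2
      set c := inner ℝ (y : Eucl n) e ^ 2
      have ha : 0 ≤ a := sq_nonneg _
      have hc : 0 ≤ c := sq_nonneg _
      set p := f x - homExt f b
      set q := f y - homExt f b
      have hpq : f x - f y = p - q := by simp only [p, q]; ring
      rw [hpq]
      have h3 : (p - q) ^ 2 ≤ 2 * (p ^ 2 + q ^ 2) := by nlinarith [sq_nonneg (p + q)]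
      calc a * c * (p - q) ^ 2 ≤ a * c * (2 * (p ^ 2 + q ^ 2)) := by gcongr
        _ = 2 * ((a * c) * p ^ 2 + (a * c) * q ^ 2) := by ring
        _ ≤ 2 * (a * p ^ 2 + c * q ^ 2) := by
          have h4 : a * c ≤ a := mul_le_of_le_one_right ha hy
          have h5 : a * c ≤ c := mul_le_of_le_one_left hc hx
          gcongr
    · simp
    · have := measurable_homExt hf
      fun_prop
  rw [← lintegral_const_mul' _ _ hZtop]
  calc ∫⁻ x, volume Z * ∫⁻ y, ENNReal.ofReal (inner ℝ (x : Eucl n) e ^ 2 *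
        inner ℝ (y : Eucl n) e ^ 2 * (f x - f y) ^ 2) ∂(surf n) ∂(surf n)
      ≤ ∫⁻ x, ∫⁻ y, 2 * (ballOsc e f x + ballOsc e f y) ∂(surf n) ∂(surf n) := by
        refine lintegral_mono fun x => ?_
        rw [← lintegral_const_mul' _ _ hZtop]
        exact lintegral_mono fun y => hpt x y
    _ = _ := by
      have h1 : ∀ x, ∫⁻ y, 2 * (ballOsc e f x + ballOsc e f y) ∂(surf n)
          = 2 * (ballOsc e f x * surf n Set.univ + ∫⁻ y, ballOsc e f y ∂(surf n)) := by
        intro x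
        rw [lintegral_const_mul' _ _ (by simp), lintegral_add_left measurable_const, lintegral_const]
      simp_rw [h1]
      rw [lintegral_const_mul' _ _ (by simp), lintegral_add_right _ measurable_const,
        lintegral_const, lintegral_mul_const' _ _ (measure_ne_top _ _)]
      ring

lemma lintegral_ballOsc_le (hn : 1 ≤ n) {e : Eucl n} {f : Sph n → ℝ} (hf : Measurable f)
    (hev : ∀ x, f (Sph.act (hypRefl e) x) = f x) :
    ∫⁻ x, ballOsc e f x ∂(surf n) ≤ 2 * ∫⁻ a in halfAnn e,
      ∫⁻ b in closedBall ((3 / 2 : ℝ) • e) (1 / 2),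
      ENNReal.ofReal (inner ℝ a e ^ 2 * (homExt f a - homExt f b) ^ 2) := by
  classical
  have hA := measurable_ballOsc e hf
  set P : Set (Sph n) := {x | (0 : ℝ) < inner ℝ (x : Eucl n) e} with hP
  have hPm : MeasurableSet P :=
    measurableSet_lt measurable_const (measurable_subtype_coe.inner_const)
  set Ap : Sph n → ℝ≥0∞ := P.indicator (ballOsc e f) with hAp
  have hApm : Measurable Ap := hA.indicator hPm
  have hinv : ∀ x, ballOsc e f (Sph.act (hypRefl e) x) = ballOsc e f x := by
    intro x
    simp only [ballOsc, Sph.coe_act, inner_refl_self, hev, neg_sq]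
  have h1 : ∀ x, ballOsc e f x ≤ Ap x + Ap (Sph.act (hypRefl e) x) := by
    intro x
    by_cases hx : x ∈ P
    · simp [hAp, Set.indicator_of_mem hx]
    · by_cases hx2 : Sph.act (hypRefl e) x ∈ P
      · simp [hAp, Set.indicator_of_mem hx2, hinv]
      · simp only [hP, Set.mem_ofPred_eq, Sph.coe_act, inner_refl_self, not_lt] at hx hx2
        have : inner ℝ (x : Eucl n) e = 0 := by linarith
        simp [ballOsc, this]
  have h2 : ∫⁻ x, ballOsc e f x ∂(surf n) ≤ 2 * ∫⁻ x, Ap x ∂(surf n) := by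
    refine (lintegral_mono h1).trans ?_
    rw [lintegral_add_left hApm, Sph.lintegral_act (hypRefl e) Ap, two_mul]
  refine h2.trans ?_
  gcongr
  have hGm : Measurable fun z : Eucl n × Eucl n =>
      ENNReal.ofReal (inner ℝ z.1 e ^ 2 * (homExt f z.1 - homExt f z.2) ^ 2) := by
    have := measurable_homExt hf
    have h1 : Measurable fun z : Eucl n × Eucl n => homExt f z.1 - homExt f z.2 :=
      (this.comp measurable_fst).sub (this.comp measurable_snd)
    have h2 : Measurable fun z : Eucl n × Eucl n => inner ℝ z.1 e ^ 2 := by fun_prop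
    exact ENNReal.measurable_ofReal.comp (h2.mul (h1.pow_const 2))
  have hG1 : Measurable fun a => ∫⁻ b in closedBall ((3 / 2 : ℝ) • e) (1 / 2),
      ENNReal.ofReal (inner ℝ a e ^ 2 * (homExt f a - homExt f b) ^ 2) := hGm.lintegral_prod_right'
  rw [← lintegral_indicator (measurableSet_halfAnn e),
    lintegral_polar' hn _ (hG1.indicator (measurableSet_halfAnn e))]
  refine lintegral_mono fun x => ?_
  by_cases hx : x ∈ P
  · have hx0 : (0 : ℝ) < inner ℝ (x : Eucl n) e := hx
    simp only [hAp, Set.indicator_of_mem hx]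
    have h3 : ballOsc e f x = ∫⁻ r in Set.Icc (1 : ℝ) 2, ballOsc e f x := by
      rw [setLIntegral_const, Real.volume_Icc]; norm_num
    rw [h3]
    refine le_trans ?_ (lintegral_mono_set (fun r hr => ?_ : Set.Icc (1 : ℝ) 2 ⊆ Set.Ioi 0))
    · refine setLIntegral_mono' measurableSet_Icc fun r hr => ?_
      have hr0 : 0 < r := by linarith [hr.1]
      have hmem : r • (x : Eucl n) ∈ halfAnn e := by
        refine ⟨?_, ?_, ?_⟩
        · rw [norm_smul, Sph.norm_eq, Real.norm_eq_abs, abs_of_pos hr0]; linarith [hr.1]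
        · rw [norm_smul, Sph.norm_eq, Real.norm_eq_abs, abs_of_pos hr0]; linarith [hr.2]
        · rw [inner_smul_left]; simp only [conj_trivial]; positivity
      rw [Set.indicator_of_mem hmem, ballOsc, ← lintegral_const_mul' _ _ ENNReal.ofReal_ne_top]
      refine lintegral_mono fun b => ?_
      dsimp only
      rw [homExt_smul f hr0, ← ENNReal.ofReal_mul (by positivity), inner_smul_left]
      apply ENNReal.ofReal_le_ofReal
      simp only [conj_trivial]
      have e1 : 1 ≤ r ^ (n - 1) := one_le_pow₀ hr.1
      have e2 : 1 ≤ r ^ 2 := one_le_pow₀ hr.1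
      set T := inner ℝ (x : Eucl n) e ^ 2 * (f x - homExt f b) ^ 2 with hT
      have hT0 : 0 ≤ T := by positivity
      have : r ^ (n - 1) * ((r * inner ℝ (x : Eucl n) e) ^ 2 * (f x - homExt f b) ^ 2)
        = (r ^ (n - 1) * r ^ 2) * T := by rw [hT]; ring
      rw [this]
      nlinarith [mul_le_mul e1 e2 zero_le_one (by linarith)]
    · exact lt_of_lt_of_le one_pos hr.1
  · simp [hAp, Set.indicator_of_notMem hx]

/-- The tent profile: as a function of the inner product `t = 1 - d²/2` it equals `(τ - d²)₊`. -/
noncomputable def tent (τ t : ℝ) : ℝ := max (τ - (2 - 2 * t)) 0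

lemma continuous_tent (τ : ℝ) : Continuous (tent τ) := by
  unfold tent; fun_prop

lemma tent_mono (τ : ℝ) : Monotone (tent τ) := fun a b h => by
  unfold tent
  exact max_le_max (by linarith) le_rfl

lemma inner_act_hypRefl {e : Eucl n} (he : ‖e‖ = 1) (x y : Sph n) :
    inner ℝ (x : Eucl n) (Sph.act (hypRefl e) y : Sph n) = inner ℝ (x : Eucl n) y -
      2 * (inner ℝ (x : Eucl n) e * inner ℝ (y : Eucl n) e) := by
  rw [Sph.coe_act, hypRefl_apply e he, inner_sub_right, inner_smul_right]
  ring

lemma oddKer_tent_mul_nonneg {e : Eucl n} (he : ‖e‖ = 1) (τ : ℝ) (x y : Sph n) :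
    0 ≤ oddKer (tent τ) e x y * inner ℝ (x : Eucl n) e * inner ℝ (y : Eucl n) e := by
  unfold oddKer zon
  rw [inner_act_hypRefl he, mul_assoc]
  set w := inner ℝ (x : Eucl n) e * inner ℝ (y : Eucl n) e
  set t := inner ℝ (x : Eucl n) (y : Eucl n)
  rcases le_total 0 w with hw | hw
  · have := tent_mono τ (by linarith : t - 2 * w ≤ t)
    exact mul_nonneg (by linarith) hw
  · have := tent_mono τ (by linarith : t ≤ t - 2 * w)
    exact mul_nonneg_of_nonpos_of_nonpos (by linarith) hw

lemma sphW_le {e : Eucl n} (he : ‖e‖ = 1) {M : ℕ} (hM : 1 ≤ M) {τ : ℝ} (hτ : 128 / (M : ℝ) ^ 2 ≤ τ)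
    (x y : Sph n) : sphW e M x y ≤ M ^ 2 / 4 *
      (oddKer (tent τ) e x y * inner ℝ (x : Eucl n) e * inner ℝ (y : Eucl n) e) := by
  have hM0 : (0 : ℝ) < M := by exact_mod_cast hM
  have hnn := oddKer_tent_mul_nonneg he τ x y
  unfold sphW
  split_ifs with h
  · obtain ⟨hd, hx, hy⟩ := h
    have hd2 : ‖(x : Eucl n) - y‖ ^ 2 ≤ (8 / M) ^ 2 := by gcongr
    rw [norm_sub_sq_sph] at hd2
    have e1 : (8 / (M : ℝ)) ^ 2 = 64 / (M : ℝ) ^ 2 := by ring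
    have e2 : 128 / (M : ℝ) ^ 2 = 64 / (M : ℝ) ^ 2 + 64 / (M : ℝ) ^ 2 := by ring
    rw [e1] at hd2
    rw [e2] at hτ
    have hw0 := mul_pos hx hy
    have hker : min (4 * (inner ℝ (x : Eucl n) e * inner ℝ (y : Eucl n) e)) (64 / (M : ℝ) ^ 2) ≤
        oddKer (tent τ) e x y := by
      unfold oddKer zon
      rw [inner_act_hypRefl he]
      set w := inner ℝ (x : Eucl n) e * inner ℝ (y : Eucl n) e
      set t := inner ℝ (x : Eucl n) (y : Eucl n)
      have h64 : 0 < 64 / (M : ℝ) ^ 2 := by positivity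
      have h1 : tent τ t = τ - (2 - 2 * t) := max_eq_left (by linarith)
      rw [h1]
      rcases le_total (τ - (2 - 2 * (t - 2 * w))) 0 with h2 | h2
      · have : tent τ (t - 2 * w) = 0 := max_eq_right h2
        rw [this]
        exact (min_le_right _ _).trans (by linarith)
      · have : tent τ (t - 2 * w) = τ - (2 - 2 * (t - 2 * w)) := max_eq_left h2
        rw [this]
        exact (min_le_left _ _).trans (by linarith)
    rw [mul_assoc (oddKer (tent τ) e x y)]
    set w := inner ℝ (x : Eucl n) e * inner ℝ (y : Eucl n) e
    have h3 : (M : ℝ) ^ 2 / 4 * (min (4 * w) (64 / (M : ℝ) ^ 2) * w) ≤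
        M ^ 2 / 4 * (oddKer (tent τ) e x y * w) := by gcongr
    refine le_trans ?_ h3
    rcases le_total (4 * w) (64 / (M : ℝ) ^ 2) with h4 | h4
    · rw [min_eq_left h4]
      exact (min_le_right _ _).trans (le_of_eq (by ring))
    · rw [min_eq_right h4]
      refine (min_le_left _ _).trans ?_
      have : (M : ℝ) ^ 2 / 4 * (64 / (M : ℝ) ^ 2 * w) = 16 * w := by field_simp; norm_num
      rw [this]; linarith
  · positivity

/-- Chain inequality for functions that are even with respect to a reflection. -/
lemma exists_chain_const (hn : 1 ≤ n) : ∃ C : ℝ, 0 < C ∧ ∀ (e : Eucl n) (f : Sph n → ℝ) (M : ℕ)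
    (τ : ℝ), ‖e‖ = 1 → Measurable f → (∀ x, f (Sph.act (hypRefl e) x) = f x) → 1 ≤ M →
    128 / (M : ℝ) ^ 2 ≤ τ →
    ∫⁻ x, ∫⁻ y, ENNReal.ofReal (inner ℝ (x : Eucl n) e ^ 2 * inner ℝ (y : Eucl n) e ^ 2 *
      (f x - f y) ^ 2) ∂(surf n) ∂(surf n) ≤ ENNReal.ofReal (C * M ^ (n + 3)) * ∫⁻ x, ∫⁻ y,
      ENNReal.ofReal (oddKer (tent τ) e x y * inner ℝ (x : Eucl n) e * inner ℝ (y : Eucl n) e *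
        (f x - f y) ^ 2) ∂(surf n) ∂(surf n) := by
  set V := volume (closedBall (0 : Eucl n) (1 / 2)) with hV
  have hV0 : V ≠ 0 := (measure_closedBall_pos _ _ (by norm_num)).ne'
  have hVt : V ≠ ∞ := measure_closedBall_lt_top.ne
  have hVr : 0 < V.toReal := ENNReal.toReal_pos hV0 hVt
  have hS := surf_univ_pos hn
  refine ⟨V.toReal⁻¹ * (8 * (surf n).real Set.univ) * (4 * (192 * 4 ^ (n - 1) / 4)), by positivity, ?_⟩
  intro e f M τ he hf hev hM hτ
  have hM0 : (0 : ℝ) < M := by exact_mod_cast hM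
  have h1 := volume_mul_osc_le he hf
  have h2 := lintegral_ballOsc_le hn hf hev
  have h3 := bulk_chain he (measurable_homExt hf) hM
  have h4 := bulk_to_sphere hn e hf hM
  have hVe : volume (closedBall ((3 / 2 : ℝ) • e) (1 / 2)) = V := Measure.addHaar_closedBall_center _ _ _
  have h5 : ∫⁻ x, ∫⁻ y, ENNReal.ofReal (sphW e M x y * (f x - f y) ^ 2) ∂(surf n) ∂(surf n) ≤
      ENNReal.ofReal (M ^ 2 / 4) * ∫⁻ x, ∫⁻ y,
      ENNReal.ofReal (oddKer (tent τ) e x y * inner ℝ (x : Eucl n) e * inner ℝ (y : Eucl n) e *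
        (f x - f y) ^ 2) ∂(surf n) ∂(surf n) := by
    rw [← lintegral_const_mul' _ _ ENNReal.ofReal_ne_top]
    refine lintegral_mono fun x => ?_
    rw [← lintegral_const_mul' _ _ ENNReal.ofReal_ne_top]
    refine lintegral_mono fun y => ?_
    rw [← ENNReal.ofReal_mul (by positivity)]
    apply ENNReal.ofReal_le_ofReal
    rw [← mul_assoc]
    exact mul_le_mul_of_nonneg_right (sphW_le he hM hτ x y) (sq_nonneg _)
  rw [hVe] at h1
  set L := ∫⁻ x, ∫⁻ y, ENNReal.ofReal (inner ℝ (x : Eucl n) e ^ 2 * inner ℝ (y : Eucl n) e ^ 2 *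
      (f x - f y) ^ 2) ∂(surf n) ∂(surf n)
  set R := ∫⁻ x, ∫⁻ y,
      ENNReal.ofReal (oddKer (tent τ) e x y * inner ℝ (x : Eucl n) e * inner ℝ (y : Eucl n) e *
        (f x - f y) ^ 2) ∂(surf n) ∂(surf n)
  obtain ⟨S, hS0, hSE, hSr⟩ : ∃ S : ℝ, 0 ≤ S ∧ surf n Set.univ = ENNReal.ofReal S ∧
      (surf n).real Set.univ = S :=
    ⟨_, hS.le, (ENNReal.ofReal_toReal (measure_ne_top _ _)).symm, rfl⟩
  rw [hSr]
  rw [hSE] at h1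
  have h6 : V * L ≤ ENNReal.ofReal ((8 * S) *
      (4 * M ^ (n + 2) * (192 * 4 ^ (n - 1) / M * (M ^ 2 / 4)))) * R := by
    calc V * L ≤ 4 * ENNReal.ofReal S * (2 * (ENNReal.ofReal (4 * M ^ (n + 2)) *
        (ENNReal.ofReal (192 * 4 ^ (n - 1) / M) * (ENNReal.ofReal (M ^ 2 / 4) * R)))) := by
          refine h1.trans ?_
          gcongr
          refine h2.trans ?_
          gcongr
          refine h3.trans ?_
          gcongr
          refine h4.trans ?_
          gcongr
      _ = _ := by
        have key : ∀ a b c : ℝ, 0 ≤ a → 0 ≤ b → ENNReal.ofReal (8 * S * (a * (b * c))) =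
            4 * ENNReal.ofReal S * (2 * (ENNReal.ofReal a *
              (ENNReal.ofReal b * ENNReal.ofReal c))) := by
          intro a b c ha hb
          rw [ENNReal.ofReal_mul (mul_nonneg (by norm_num) hS0), ENNReal.ofReal_mul (by norm_num),
            ENNReal.ofReal_mul ha, ENNReal.ofReal_mul hb]
          have : ENNReal.ofReal 8 = 4 * 2 := by norm_num
          rw [this]
          ring
        rw [key _ _ _ (by positivity) (by positivity)]
        ring
  have h7 : L = ENNReal.ofReal (V.toReal⁻¹) * (V * L) := by
    rw [ENNReal.ofReal_inv_of_pos hVr, ENNReal.ofReal_toReal hVt, ← mul_assoc,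
      ENNReal.inv_mul_cancel hV0 hVt, one_mul]
  rw [h7]
  calc _ ≤ ENNReal.ofReal (V.toReal⁻¹) * (ENNReal.ofReal ((8 * S) *
      (4 * M ^ (n + 2) * (192 * 4 ^ (n - 1) / M * (M ^ 2 / 4)))) * R) := by gcongr
    _ = _ := by
      rw [← mul_assoc, ← ENNReal.ofReal_mul (by positivity)]
      congr 2
      field_simp
      try ring

end Combine

section TentForm

variable {n : ℕ}

lemma linEig_eq_prod {k : ℝ → ℝ} (hk : Continuous k) : linEig n k =
    (∫ z : Sph n × Sph n, zon k z.1 z.2 * inner ℝ (z.1 : Eucl n) (z.2 : Eucl n)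
      ∂((surf n).prod (surf n))) / (surf n).real Set.univ := by
  have hi : Continuous fun z : Sph n × Sph n => inner ℝ (z.1 : Eucl n) (z.2 : Eucl n) := by fun_prop
  have ik := integrable_of_continuous_sph2 ((continuous_zon (n := n) hk).mul hi)
  unfold linEig
  rw [integral_integral (f := fun x y : Sph n => zon k x y * inner ℝ (x : Eucl n) (y : Eucl n)) ik]

lemma linEig_sub_mul {k l : ℝ → ℝ} (hk : Continuous k) (hl : Continuous l) (c : ℝ) :
    linEig n (fun t => k t - c * l t) = linEig n k - c * linEig n l := by
  have hi : Continuous fun z : Sph n × Sph n => inner ℝ (z.1 : Eucl n) (z.2 : Eucl n) := by fun_prop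
  have ik := integrable_of_continuous_sph2 ((continuous_zon (n := n) hk).mul hi)
  have il := integrable_of_continuous_sph2 ((continuous_zon (n := n) hl).mul hi)
  rw [linEig_eq_prod hk, linEig_eq_prod hl,
    linEig_eq_prod (k := fun t => k t - c * l t) (hk.sub (continuous_const.mul hl)), mul_div_assoc', ← sub_div,
    ← integral_const_mul]
  congr 1
  refine Eq.trans ?_ (integral_sub ik (il.const_mul c))
  congr 1
  funext z
  simp only [zon]
  ring

lemma defForm_sub_mul {k l : ℝ → ℝ} (hk : Continuous k) (hl : Continuous l) (c : ℝ)
    {u : Sph n → ℝ} (hu : Continuous u) :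
    defForm (fun t => k t - c * l t) u = defForm k u - c * defForm l u := by
  have hk' := continuous_zon (n := n) hk
  have hl' := continuous_zon (n := n) hl
  have ik := integrable_of_continuous_sph2
    ((hk'.mul (hu.comp continuous_fst)).mul (hu.comp continuous_snd))
  have il := integrable_of_continuous_sph2
    ((hl'.mul (hu.comp continuous_fst)).mul (hu.comp continuous_snd))
  have h : ∫ z : Sph n × Sph n, zon (fun t => k t - c * l t) z.1 z.2 * u z.1 * u z.2
        ∂((surf n).prod (surf n)) =
      ∫ z : Sph n × Sph n, zon k z.1 z.2 * u z.1 * u z.2 ∂((surf n).prod (surf n)) -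
      c * ∫ z : Sph n × Sph n, zon l z.1 z.2 * u z.1 * u z.2 ∂((surf n).prod (surf n)) := by
    rw [← integral_const_mul]
    refine Eq.trans ?_ (integral_sub ik (il.const_mul c))
    congr 1
    funext z
    simp only [zon]
    ring
  unfold defForm
  rw [h, linEig_sub_mul hk hl]
  ring

/-- A Lipschitz function which is odd with respect to a reflection is divisible by the
corresponding linear function. -/
lemma exists_quotient_of_odd {e : Eucl n} (he : ‖e‖ = 1) {w : Sph n → ℝ} {L : NNReal}
    (hw : LipschitzWith L w) (hodd : ∀ x, w (Sph.act (hypRefl e) x) = - w x) :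
    ∃ f : Sph n → ℝ, Measurable f ∧ (∀ x, |f x| ≤ L) ∧ (∀ x, f (Sph.act (hypRefl e) x) = f x) ∧
      ∀ x : Sph n, w x = f x * inner ℝ (x : Eucl n) e := by
  have hb : ∀ x : Sph n, |w x| ≤ L * |inner ℝ (x : Eucl n) e| := by
    intro x
    have h1 := hw.dist_le_mul x (Sph.act (hypRefl e) x)
    rw [hodd, Real.dist_eq, sub_neg_eq_add, Subtype.dist_eq, dist_eq_norm, Sph.coe_act,
      hypRefl_apply e he, sub_sub_cancel, norm_smul, he, mul_one, Real.norm_eq_abs, abs_mul,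
      ← two_mul, abs_mul, abs_two] at h1
    linarith
  refine ⟨fun x => w x / inner ℝ (x : Eucl n) e, ?_, ?_, ?_, ?_⟩
  · exact hw.continuous.measurable.div (by fun_prop)
  · intro x
    rw [abs_div]
    exact div_le_of_le_mul₀ (abs_nonneg _) L.2 (hb x)
  · intro x
    dsimp only
    rw [Sph.coe_act, inner_refl_self, hodd, neg_div_neg_eq]
  · intro x
    by_cases h0 : inner ℝ (x : Eucl n) e = 0
    · have := hb x
      rw [h0] at this ⊢
      simpa using this
    · field_simp

lemma lintegral_lintegral_eq_ofReal_integral_prod {F : Sph n × Sph n → ℝ} (hF : Measurable F)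
    {C : ℝ} (hC : ∀ z, |F z| ≤ C) (h0 : ∀ z, 0 ≤ F z) :
    ∫⁻ x, ∫⁻ y, ENNReal.ofReal (F (x, y)) ∂(surf n) ∂(surf n) =
      ENNReal.ofReal (∫ z, F z ∂((surf n).prod (surf n))) := by
  rw [ofReal_integral_eq_lintegral_ofReal (integrable_prod_of_bounded hF hC)
    (Filter.Eventually.of_forall h0), lintegral_prod _ hF.ennreal_ofReal.aemeasurable]

lemma defForm_tent_nonneg_of_odd (hn : 1 ≤ n) (τ : ℝ) {e : Eucl n} {w : Sph n → ℝ} {L : NNReal}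
    (he : ‖e‖ = 1) (hw : LipschitzWith L w) (hodd : ∀ x, w (Sph.act (hypRefl e) x) = - w x) :
    0 ≤ defForm (tent τ) w := by
  obtain ⟨f, hfm, hfb, -, hwf⟩ := exists_quotient_of_odd he hw hodd
  rw [defForm_odd hn (continuous_tent τ) e hw.continuous hodd hfm hfb hwf]
  refine mul_nonneg (by norm_num) (integral_nonneg fun z => ?_)
  exact mul_nonneg (oddKer_tent_mul_nonneg he τ z.1 z.2) (sq_nonneg _)

lemma exists_tent_const_of_odd (hn : 1 ≤ n) : ∃ c : ℝ, 0 < c ∧ ∀ (e : Eucl n) (w : Sph n → ℝ)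
    (L : NNReal) (ρ : ℝ), ‖e‖ = 1 → LipschitzWith L w →
    (∀ x, w (Sph.act (hypRefl e) x) = - w x) → 0 < ρ → ρ ≤ 1 →
    c * ρ ^ (n + 3) * defForm id w ≤ defForm (tent (ρ ^ 2)) w := by
  obtain ⟨C, hC0, hC⟩ := exists_chain_const (n := n) hn
  refine ⟨(2 * C * 13 ^ (n + 3))⁻¹, by positivity, ?_⟩
  intro e w L ρ he hw hodd hρ0 hρ1
  obtain ⟨f, hfm, hfb, hfe, hwf⟩ := exists_quotient_of_odd he hw hodd
  rw [defForm_odd hn (continuous_tent _) e hw.continuous hodd hfm hfb hwf,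
    defForm_odd hn continuous_id e hw.continuous hodd hfm hfb hwf]
  set M := ⌈12 / ρ⌉₊ with hMdef
  have hM1 : 12 / ρ ≤ M := Nat.le_ceil _
  have hM2 : (M : ℝ) ≤ 13 / ρ := by
    have h1 := (Nat.ceil_lt_add_one (by positivity : 0 ≤ 12 / ρ)).le
    have h2 : 1 ≤ 1 / ρ := by rw [le_div_iff₀ hρ0]; linarith
    have h3 : 13 / ρ = 12 / ρ + 1 / ρ := by ring
    rw [h3]; linarith
  have hMpos : (0 : ℝ) < M := lt_of_lt_of_le (by positivity) hM1
  have hM : 1 ≤ M := by exact_mod_cast hMpos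
  have hτ : 128 / (M : ℝ) ^ 2 ≤ ρ ^ 2 := by
    rw [div_le_iff₀ (by positivity)]
    have : 12 ≤ ρ * M := by rwa [div_le_iff₀ hρ0, mul_comm] at hM1
    nlinarith
  have hch := hC e f M _ he hfm hfe hM hτ
  set A : Sph n × Sph n → ℝ := fun z => inner ℝ (z.1 : Eucl n) e ^ 2 * inner ℝ (z.2 : Eucl n) e ^ 2 *
      (f z.1 - f z.2) ^ 2 with hA
  set T : Sph n × Sph n → ℝ := fun z => oddKer (tent (ρ ^ 2)) e z.1 z.2 *
      inner ℝ (z.1 : Eucl n) e * inner ℝ (z.2 : Eucl n) e * (f z.1 - f z.2) ^ 2 with hT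
  have hfd : Measurable fun z : Sph n × Sph n => (f z.1 - f z.2) ^ 2 :=
    ((hfm.comp measurable_fst).sub (hfm.comp measurable_snd)).pow_const 2
  have hfdb : ∀ z : Sph n × Sph n, (f z.1 - f z.2) ^ 2 ≤ (2 * L) ^ 2 := by
    intro z
    rw [← sq_abs]
    have := (abs_sub (f z.1) (f z.2)).trans (add_le_add (hfb z.1) (hfb z.2))
    gcongr
    linarith
  have hbdd : ∀ W : Sph n × Sph n → ℝ, Continuous W →
      ∃ D, ∀ z, |W z * (f z.1 - f z.2) ^ 2| ≤ D := by
    intro W hW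
    obtain ⟨D, hD⟩ := isCompact_univ.exists_bound_of_continuousOn hW.continuousOn
    refine ⟨D * (2 * L) ^ 2, fun z => ?_⟩
    rw [abs_mul, abs_of_nonneg (sq_nonneg (f z.1 - f z.2))]
    have := hD z (Set.mem_univ _)
    exact mul_le_mul this (hfdb z) (sq_nonneg _) ((abs_nonneg _).trans this)
  have hcA : Continuous fun z : Sph n × Sph n =>
      inner ℝ (z.1 : Eucl n) e ^ 2 * inner ℝ (z.2 : Eucl n) e ^ 2 := by fun_prop
  have hcT : Continuous fun z : Sph n × Sph n => oddKer (tent (ρ ^ 2)) e z.1 z.2 *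
      inner ℝ (z.1 : Eucl n) e * inner ℝ (z.2 : Eucl n) e := by
    apply ((continuous_oddKer (continuous_tent _) e).mul _).mul <;> fun_prop
  obtain ⟨DA, hDA⟩ := hbdd _ hcA
  obtain ⟨DT, hDT⟩ := hbdd _ hcT
  have hA0 : ∀ z, 0 ≤ A z := fun z => by positivity
  have hT0 : ∀ z, 0 ≤ T z := fun z =>
    mul_nonneg (oddKer_tent_mul_nonneg he _ z.1 z.2) (sq_nonneg _)
  have eA : _ = ENNReal.ofReal (∫ z, A z ∂((surf n).prod (surf n))) :=
    lintegral_lintegral_eq_ofReal_integral_prod (hcA.measurable.mul hfd) hDA hA0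
  have eT : _ = ENNReal.ofReal (∫ z, T z ∂((surf n).prod (surf n))) :=
    lintegral_lintegral_eq_ofReal_integral_prod (hcT.measurable.mul hfd) hDT hT0
  have hch2 : ENNReal.ofReal (∫ z, A z ∂((surf n).prod (surf n))) ≤
      ENNReal.ofReal (C * M ^ (n + 3)) *
        ENNReal.ofReal (∫ z, T z ∂((surf n).prod (surf n))) := by
    rw [← eA, ← eT]
    exact hch
  have hTI : 0 ≤ ∫ z, T z ∂((surf n).prod (surf n)) := integral_nonneg hT0
  rw [← ENNReal.ofReal_mul (by positivity), ENNReal.ofReal_le_ofReal_iff (by positivity)] at hch2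
  have hid : ∫ z : Sph n × Sph n, oddKer id e z.1 z.2 * inner ℝ (z.1 : Eucl n) e *
      inner ℝ (z.2 : Eucl n) e * (f z.1 - f z.2) ^ 2 ∂((surf n).prod (surf n)) =
      2 * ∫ z, A z ∂((surf n).prod (surf n)) := by
    rw [← integral_const_mul]
    congr 1
    funext z
    simp only [hA, oddKer, zon, id, inner_act_hypRefl he]
    ring
  rw [hid]
  have hMp : (M : ℝ) ^ (n + 3) ≤ 13 ^ (n + 3) / ρ ^ (n + 3) := by
    rw [← div_pow]; gcongr
  set IA := ∫ z, A z ∂((surf n).prod (surf n))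
  set IT := ∫ z, T z ∂((surf n).prod (surf n))
  have h5 : IA ≤ C * (13 ^ (n + 3) / ρ ^ (n + 3)) * IT := hch2.trans (by gcongr)
  calc (2 * C * 13 ^ (n + 3))⁻¹ * ρ ^ (n + 3) * (1 / 4 * (2 * IA))
      ≤ (2 * C * 13 ^ (n + 3))⁻¹ * ρ ^ (n + 3) *
        (1 / 4 * (2 * (C * (13 ^ (n + 3) / ρ ^ (n + 3)) * IT))) := by gcongr
    _ = 1 / 4 * IT := by field_simp

/-- Comparison of the quadratic forms of the tent kernels with that of the linear kernel. -/
lemma exists_tent_const (hn : 1 ≤ n) : ∃ c : ℝ, 0 < c ∧ ∀ (v : Sph n → ℝ)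
    (L : NNReal) (ρ : ℝ), LipschitzWith L v → ∫ x, v x ∂(surf n) = 0 → 0 < ρ → ρ ≤ 1 →
    c * ρ ^ (n + 3) * defForm id v ≤ defForm (tent (ρ ^ 2)) v := by
  obtain ⟨c, hc0, hc⟩ := exists_tent_const_of_odd (n := n) hn
  refine ⟨c, hc0, fun v L ρ hv hmean h0 h1 => ?_⟩
  have hcont : Continuous fun t => tent (ρ ^ 2) t - c * ρ ^ (n + 3) * id t :=
    (continuous_tent _).sub (continuous_const.mul continuous_id)
  have := defForm_nonneg_of_odd hcont (fun e w L' he hw hodd => by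
    rw [defForm_sub_mul (continuous_tent _) continuous_id _ hw.continuous]
    exact sub_nonneg.2 (hc e w L' ρ he hw hodd h0 h1)) hv hmean
  rw [defForm_sub_mul (continuous_tent _) continuous_id _ hv.continuous] at this
  linarith

lemma defForm_tent_nonneg (hn : 1 ≤ n) (τ : ℝ) {v : Sph n → ℝ} {L : NNReal}
    (hv : LipschitzWith L v) (hmean : ∫ x, v x ∂(surf n) = 0) : 0 ≤ defForm (tent τ) v :=
  defForm_nonneg_of_odd (continuous_tent τ)
    (fun _ _ _ he hw hodd => defForm_tent_nonneg_of_odd hn τ he hw hodd) hv hmean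

end TentForm

section Subordination

variable {n : ℕ}

lemma lintegral_rpow_mul_posPart {q d : ℝ} (hq : 0 < q) (hd : 0 < d) :
    ∫⁻ ρ in Set.Ioi (0 : ℝ), ENNReal.ofReal (ρ ^ (-q - 3) * max (ρ ^ 2 - d ^ 2) 0) =
      ENNReal.ofReal (2 / (q * (q + 2)) * d ^ (-q)) := by
  have h1 : ∫⁻ ρ in Set.Ioi (0 : ℝ), ENNReal.ofReal (ρ ^ (-q - 3) * max (ρ ^ 2 - d ^ 2) 0) =
      ∫⁻ ρ in Set.Ioi d, ENNReal.ofReal (ρ ^ (-q - 1) - d ^ 2 * ρ ^ (-q - 3)) := by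
    rw [← lintegral_indicator measurableSet_Ioi, ← lintegral_indicator measurableSet_Ioi]
    congr 1
    funext ρ
    by_cases h : d < ρ
    · have h0 : 0 < ρ := hd.trans h
      rw [Set.indicator_of_mem (show ρ ∈ Set.Ioi 0 from h0),
        Set.indicator_of_mem (show ρ ∈ Set.Ioi d from h), max_eq_left (by nlinarith)]
      congr 1
      have : ρ ^ (-q - 1) = ρ ^ (-q - 3) * ρ ^ 2 := by
        rw [← Real.rpow_natCast ρ 2, ← Real.rpow_add h0]; norm_num; ring_nf
      rw [this]; ring
    · rw [Set.indicator_of_notMem (show ρ ∉ Set.Ioi d from h)]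
      by_cases h0 : 0 < ρ
      · rw [Set.indicator_of_mem (show ρ ∈ Set.Ioi 0 from h0), max_eq_right]
        · simp
        · push Not at h; nlinarith
      · rw [Set.indicator_of_notMem (show ρ ∉ Set.Ioi 0 from h0)]
  have i1 : IntegrableOn (fun ρ : ℝ => ρ ^ (-q - 1)) (Set.Ioi d) :=
    integrableOn_Ioi_rpow_of_lt (by linarith) hd
  have i3 : IntegrableOn (fun ρ : ℝ => d ^ 2 * ρ ^ (-q - 3)) (Set.Ioi d) :=
    (integrableOn_Ioi_rpow_of_lt (by linarith) hd).const_mul _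
  have i13 : IntegrableOn (fun ρ : ℝ => ρ ^ (-q - 1) - d ^ 2 * ρ ^ (-q - 3)) (Set.Ioi d) := i1.sub i3
  rw [h1, ← ofReal_integral_eq_lintegral_ofReal i13]
  · congr 1
    rw [integral_sub i1 i3, integral_const_mul, integral_Ioi_rpow_of_lt (by linarith) hd,
      integral_Ioi_rpow_of_lt (by linarith) hd]
    have e1 : (-q - 1 + 1 : ℝ) = -q := by ring
    have e2 : (-q - 3 + 1 : ℝ) = -q - 2 := by ring
    have e3 : d ^ (-q) = d ^ 2 * d ^ (-q - 2) := by
      rw [← Real.rpow_natCast d 2, ← Real.rpow_add hd]; norm_num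
    rw [e1, e2, e3]
    have : -q - 2 ≠ 0 := by linarith
    have : q + 2 ≠ 0 := by linarith
    have : q ≠ 0 := hq.ne'
    have e4 : -q - 2 = -(q + 2) := by ring
    generalize d ^ (-q - 2) = D
    rw [e4]
    field_simp
    ring
  · refine (ae_restrict_iff' measurableSet_Ioi).2 (Filter.Eventually.of_forall fun ρ hρ => ?_)
    have h0 : 0 < ρ := hd.trans hρ
    have : ρ ^ (-q - 1) = ρ ^ (-q - 3) * ρ ^ 2 := by
      rw [← Real.rpow_natCast ρ 2, ← Real.rpow_add h0]; norm_num; ring_nf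
    have h3 : 0 ≤ ρ ^ (-q - 3) := by positivity
    have h4 : d ^ 2 ≤ ρ ^ 2 := by have : d < ρ := hρ; gcongr
    simp only [Pi.zero_apply, this]
    nlinarith

lemma measurable_tent_mul {G : Sph n × Sph n → ℝ} (hG : Measurable G) (q : ℝ) :
    Measurable fun w : (Sph n × Sph n) × ℝ => ENNReal.ofReal (w.2 ^ (-q - 3) *
      (tent (w.2 ^ 2) (inner ℝ (w.1.1 : Eucl n) (w.1.2 : Eucl n)) * G w.1)) := by
  have h1 : Measurable fun w : (Sph n × Sph n) × ℝ => w.2 ^ (-q - 3) :=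
    measurable_snd.pow_const _
  have h2 : Continuous fun w : (Sph n × Sph n) × ℝ =>
      tent (w.2 ^ 2) (inner ℝ (w.1.1 : Eucl n) (w.1.2 : Eucl n)) := by
    unfold tent; fun_prop
  exact (h1.mul (h2.measurable.mul (hG.comp measurable_fst))).ennreal_ofReal

/-- Riesz kernels are superpositions of tent kernels. -/
lemma lintegral_riesz_eq_tent {q : ℝ} (hq : 0 < q) {G : Sph n × Sph n → ℝ} (hG : Measurable G)
    (hG0 : ∀ z, 0 ≤ G z) (hGd : ∀ x, G (x, x) = 0) :
    ∫⁻ z, ENNReal.ofReal (G z * ‖(z.1 : Eucl n) - z.2‖ ^ (-q)) ∂((surf n).prod (surf n)) =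
      ENNReal.ofReal (q * (q + 2) / 2) * ∫⁻ ρ in Set.Ioi (0 : ℝ), ENNReal.ofReal (ρ ^ (-q - 3)) *
        ∫⁻ z, ENNReal.ofReal (tent (ρ ^ 2) (inner ℝ (z.1 : Eucl n) (z.2 : Eucl n)) * G z)
          ∂((surf n).prod (surf n)) := by
  have hm := measurable_tent_mul hG q
  have h1 : ∫⁻ ρ in Set.Ioi (0 : ℝ), ENNReal.ofReal (ρ ^ (-q - 3)) *
        ∫⁻ z, ENNReal.ofReal (tent (ρ ^ 2) (inner ℝ (z.1 : Eucl n) (z.2 : Eucl n)) * G z)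
          ∂((surf n).prod (surf n)) =
      ∫⁻ ρ in Set.Ioi (0 : ℝ), ∫⁻ z, ENNReal.ofReal (ρ ^ (-q - 3) *
        (tent (ρ ^ 2) (inner ℝ (z.1 : Eucl n) (z.2 : Eucl n)) * G z))
          ∂((surf n).prod (surf n)) := by
    refine setLIntegral_congr_fun measurableSet_Ioi fun ρ hρ => ?_
    have h0 : (0 : ℝ) < ρ := hρ
    rw [← lintegral_const_mul' _ _ ENNReal.ofReal_ne_top]
    refine lintegral_congr fun z => ?_
    rw [← ENNReal.ofReal_mul (by positivity)]
  rw [h1, lintegral_lintegral_swap (f := fun (ρ : ℝ) (z : Sph n × Sph n) =>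
    ENNReal.ofReal (ρ ^ (-q - 3) *
      (tent (ρ ^ 2) (inner ℝ (z.1 : Eucl n) (z.2 : Eucl n)) * G z)))
    (hm.comp measurable_swap).aemeasurable, ← lintegral_const_mul' _ _ ENNReal.ofReal_ne_top]
  refine lintegral_congr fun z => ?_
  by_cases hz : z.1 = z.2
  · have : G z = 0 := by rw [← hGd z.1]; congr 1; exact Prod.ext rfl hz.symm
    simp [this]
  · have hd : 0 < ‖(z.1 : Eucl n) - z.2‖ :=
      norm_pos_iff.2 (sub_ne_zero.2 fun h => hz (Subtype.ext h))
    have h2 : ∀ ρ : ℝ, ENNReal.ofReal (ρ ^ (-q - 3) *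
        (tent (ρ ^ 2) (inner ℝ (z.1 : Eucl n) (z.2 : Eucl n)) * G z)) = ENNReal.ofReal (G z) *
        ENNReal.ofReal (ρ ^ (-q - 3) * max (ρ ^ 2 - ‖(z.1 : Eucl n) - z.2‖ ^ 2) 0) := by
      intro ρ
      rw [← ENNReal.ofReal_mul (hG0 z), norm_sub_sq_sph, tent]
      congr 1; ring
    simp only [h2]
    rw [lintegral_const_mul' _ _ ENNReal.ofReal_ne_top, lintegral_rpow_mul_posPart hq hd,
      ← ENNReal.ofReal_mul (hG0 z), ← ENNReal.ofReal_mul (by positivity)]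
    congr 1
    field_simp

/-- The squared differences integrated against a zonal kernel. -/
lemma integral_zon_mul_sq_sub (hn : 1 ≤ n) {k : ℝ → ℝ} (hk : Continuous k) {v : Sph n → ℝ}
    (hv : Continuous v) :
    ∫ z : Sph n × Sph n, zon k z.1 z.2 * (v z.1 - v z.2) ^ 2 ∂((surf n).prod (surf n)) =
      (∫ x, v x ^ 2 ∂(surf n)) / (surf n).real Set.univ *
        (∫ z : Sph n × Sph n, zon k z.1 z.2 * ‖(z.1 : Eucl n) - z.2‖ ^ 2
          ∂((surf n).prod (surf n))) + 2 * defForm k v := by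
  have hS := (surf_univ_pos hn).ne'
  have hkc := continuous_zon (n := n) hk
  obtain ⟨x0⟩ : Nonempty (Sph n) := by
    have : Nonempty (Fin n) := ⟨⟨0, hn⟩⟩
    have : Nontrivial (Eucl n) := inferInstance
    exact (NormedSpace.sphere_nonempty.2 zero_le_one).to_subtype
  set κ := ∫ y, zon k x0 y ∂(surf n) with hκ
  have hκx : ∀ x, ∫ y, zon k x y ∂(surf n) = κ := by
    intro x
    obtain ⟨g, rfl⟩ := exists_isometry_map x0 x
    rw [← Sph.integral_act g]
    simp [hκ, zon_act]
  have hκy : ∀ y, ∫ x, zon k x y ∂(surf n) = κ := by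
    intro y
    rw [← hκx y]
    simp [zon, real_inner_comm]
  have hcv1 : Continuous fun z : Sph n × Sph n => zon k z.1 z.2 * v z.1 ^ 2 :=
    hkc.mul ((hv.comp continuous_fst).pow 2)
  have hcv2 : Continuous fun z : Sph n × Sph n => zon k z.1 z.2 * v z.2 ^ 2 :=
    hkc.mul ((hv.comp continuous_snd).pow 2)
  have hcv3 : Continuous fun z : Sph n × Sph n => zon k z.1 z.2 * v z.1 * v z.2 :=
    (hkc.mul (hv.comp continuous_fst)).mul (hv.comp continuous_snd)
  have hcd : Continuous fun z : Sph n × Sph n =>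
    zon k z.1 z.2 * inner ℝ (z.1 : Eucl n) (z.2 : Eucl n) := hkc.mul (by fun_prop)
  have e1 : ∫ z : Sph n × Sph n, zon k z.1 z.2 * v z.1 ^ 2 ∂((surf n).prod (surf n)) =
      κ * ∫ x, v x ^ 2 ∂(surf n) := by
    rw [integral_prod _ (integrable_of_continuous_sph2 hcv1)]
    simp only [integral_mul_const, hκx]
    rw [integral_const_mul]
  have e2 : ∫ z : Sph n × Sph n, zon k z.1 z.2 * v z.2 ^ 2 ∂((surf n).prod (surf n)) =
      κ * ∫ x, v x ^ 2 ∂(surf n) := by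
    rw [integral_prod_symm _ (integrable_of_continuous_sph2 hcv2)]
    simp only [integral_mul_const, hκy]
    rw [integral_const_mul]
  have e3 : ∫ z : Sph n × Sph n, zon k z.1 z.2 ∂((surf n).prod (surf n)) =
      κ * (surf n).real Set.univ := by
    rw [integral_prod _ (integrable_of_continuous_sph2 hkc)]
    simp only [hκx]
    simp [mul_comm]
  have e4 : ∫ z : Sph n × Sph n, zon k z.1 z.2 * ‖(z.1 : Eucl n) - z.2‖ ^ 2
      ∂((surf n).prod (surf n)) = 2 * (κ - linEig n k) * (surf n).real Set.univ := by
    have : ∀ z : Sph n × Sph n, zon k z.1 z.2 * ‖(z.1 : Eucl n) - z.2‖ ^ 2 =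
        2 * zon k z.1 z.2 - 2 * (zon k z.1 z.2 * inner ℝ (z.1 : Eucl n) (z.2 : Eucl n)) := by
      intro z
      rw [norm_sub_sq_sph]; ring
    simp only [this]
    rw [integral_sub ((integrable_of_continuous_sph2 hkc).const_mul 2)
      ((integrable_of_continuous_sph2 hcd).const_mul 2), integral_const_mul, integral_const_mul, e3,
      linEig_eq_prod hk]
    field_simp
  have e5 : ∀ z : Sph n × Sph n, zon k z.1 z.2 * (v z.1 - v z.2) ^ 2 =
      zon k z.1 z.2 * v z.1 ^ 2 + zon k z.1 z.2 * v z.2 ^ 2 - 2 * (zon k z.1 z.2 * v z.1 * v z.2) :=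
    fun z => by ring
  simp only [e5]
  have i12 : Integrable (fun z : Sph n × Sph n => zon k z.1 z.2 * v z.1 ^ 2 +
      zon k z.1 z.2 * v z.2 ^ 2) ((surf n).prod (surf n)) :=
    (integrable_of_continuous_sph2 hcv1).add (integrable_of_continuous_sph2 hcv2)
  rw [integral_sub i12 ((integrable_of_continuous_sph2 hcv3).const_mul 2),
    integral_add (integrable_of_continuous_sph2 hcv1) (integrable_of_continuous_sph2 hcv2),
    integral_const_mul, e1, e2, e4, defForm]
  field_simp
  ring

end Subordination

section RieszForm

variable {n : ℕ}

/-- The Gagliardo-type form `∬ (v(x) - v(y))² |x - y|^{-q}` on the sphere. -/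
noncomputable def rieszD (q : ℝ) (v : Sph n → ℝ) : ℝ≥0∞ :=
  ∫⁻ z : Sph n × Sph n, ENNReal.ofReal ((v z.1 - v z.2) ^ 2 * ‖(z.1 : Eucl n) - z.2‖ ^ (-q))
    ∂((surf n).prod (surf n))

/-- The Riesz energy `∬ |x - y|^{2-q}` of the sphere. -/
noncomputable def rieszL (n : ℕ) (q : ℝ) : ℝ≥0∞ :=
  ∫⁻ z : Sph n × Sph n, ENNReal.ofReal (‖(z.1 : Eucl n) - z.2‖ ^ 2 * ‖(z.1 : Eucl n) - z.2‖ ^ (-q))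
    ∂((surf n).prod (surf n))

lemma surf_closedBall_le (hn : 1 ≤ n) (x : Sph n) {ρ : ℝ} (h0 : 0 < ρ) :
    ENNReal.ofReal ρ * surf n (closedBall x ρ) ≤
      ENNReal.ofReal ((2 * ρ) ^ n) * volume (closedBall (0 : Eucl n) 1) := by
  have : Nonempty (Fin n) := ⟨⟨0, hn⟩⟩
  have hvol : volume (closedBall (x : Eucl n) (2 * ρ)) =
      ENNReal.ofReal ((2 * ρ) ^ n) * volume (closedBall (0 : Eucl n) 1) := by
    rw [Measure.addHaar_closedBall' _ _ (by positivity : 0 ≤ 2 * ρ), finrank_euclideanSpace_fin]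
  have hpol := lintegral_polar' hn ((closedBall (x : Eucl n) (2 * ρ)).indicator 1)
    (measurable_one.indicator measurableSet_closedBall)
  rw [lintegral_indicator_one measurableSet_closedBall] at hpol
  rw [← hvol, hpol, ← setLIntegral_const,
    ← lintegral_indicator measurableSet_closedBall]
  refine lintegral_mono fun y => ?_
  by_cases hy : y ∈ closedBall x ρ
  · rw [Set.indicator_of_mem hy]
    have h3 : ENNReal.ofReal ρ = ∫⁻ r in Set.Icc (1 : ℝ) (1 + ρ), 1 := by
      rw [setLIntegral_const, Real.volume_Icc]; simp
    rw [h3]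
    refine le_trans ?_ (lintegral_mono_set (fun r hr => lt_of_lt_of_le one_pos hr.1 :
      Set.Icc (1 : ℝ) (1 + ρ) ⊆ Set.Ioi 0))
    refine setLIntegral_mono' measurableSet_Icc fun r hr => ?_
    have hmem : r • (y : Eucl n) ∈ closedBall (x : Eucl n) (2 * ρ) := by
      rw [mem_closedBall, dist_eq_norm]
      have h4 : r • (y : Eucl n) - x = (r - 1) • (y : Eucl n) + (y - x) := by module
      have h5 : ‖(y : Eucl n) - x‖ ≤ ρ := by
        rw [← dist_eq_norm]; exact hy
      rw [h4]
      refine (norm_add_le _ _).trans ?_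
      rw [norm_smul, Sph.norm_eq, Real.norm_eq_abs, abs_of_nonneg (by linarith [hr.1])]
      linarith [hr.2]
    rw [Set.indicator_of_mem hmem]
    simp only [Pi.one_apply, mul_one]
    rw [ENNReal.one_le_ofReal]
    exact one_le_pow₀ hr.1
  · rw [Set.indicator_of_notMem hy]; exact zero_le

lemma continuous_tent_inner (τ : ℝ) : Continuous fun z : Sph n × Sph n =>
    tent τ (inner ℝ (z.1 : Eucl n) (z.2 : Eucl n)) :=
  (continuous_tent τ).comp (by fun_prop)

lemma tent_nonneg (τ t : ℝ) : 0 ≤ tent τ t := le_max_right _ _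

lemma tent_mul_sq_le {ρ : ℝ} (x y : Sph n) :
    tent (ρ ^ 2) (inner ℝ (x : Eucl n) (y : Eucl n)) * ‖(x : Eucl n) - y‖ ^ 2 ≤ 4 * ρ ^ 2 := by
  have h1 : ‖(x : Eucl n) - y‖ ≤ 2 := by
    refine (norm_sub_le _ _).trans ?_
    simp only [Sph.norm_eq]; norm_num
  have h2 : ‖(x : Eucl n) - y‖ ^ 2 ≤ 4 := by nlinarith [norm_nonneg ((x : Eucl n) - y)]
  have h3 : tent (ρ ^ 2) (inner ℝ (x : Eucl n) (y : Eucl n)) ≤ ρ ^ 2 := by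
    unfold tent
    rw [← norm_sub_sq_sph]
    exact max_le (by nlinarith [sq_nonneg ‖(x : Eucl n) - y‖]) (sq_nonneg _)
  nlinarith [tent_nonneg (ρ ^ 2) (inner ℝ (x : Eucl n) (y : Eucl n)), sq_nonneg ‖(x : Eucl n) - y‖,
    sq_nonneg ρ]

lemma tent_mul_sq_le_indicator {ρ : ℝ} (h0 : 0 < ρ) (x y : Sph n) :
    ENNReal.ofReal (tent (ρ ^ 2) (inner ℝ (x : Eucl n) (y : Eucl n)) * ‖(x : Eucl n) - y‖ ^ 2) ≤
      (closedBall x ρ).indicator (fun _ => ENNReal.ofReal (ρ ^ 4)) y := by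
  by_cases hy : y ∈ closedBall x ρ
  · rw [Set.indicator_of_mem hy]
    apply ENNReal.ofReal_le_ofReal
    have h2 : ‖(x : Eucl n) - y‖ ^ 2 ≤ ρ ^ 2 := by
      have : ‖(x : Eucl n) - y‖ ≤ ρ := by
        rw [← dist_eq_norm, dist_comm]; exact hy
      gcongr
    have h3 : tent (ρ ^ 2) (inner ℝ (x : Eucl n) (y : Eucl n)) ≤ ρ ^ 2 := by
      unfold tent
      rw [← norm_sub_sq_sph]
      exact max_le (by nlinarith [sq_nonneg ‖(x : Eucl n) - y‖]) (sq_nonneg _)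
    calc _ ≤ ρ ^ 2 * ρ ^ 2 := by gcongr
      _ = ρ ^ 4 := by ring
  · rw [Set.indicator_of_notMem hy]
    have h2 : ρ ^ 2 ≤ ‖(x : Eucl n) - y‖ ^ 2 := by
      have : ρ < ‖(x : Eucl n) - y‖ := by
        rw [← dist_eq_norm, dist_comm]; exact not_le.1 hy
      gcongr
    have h3 : tent (ρ ^ 2) (inner ℝ (x : Eucl n) (y : Eucl n)) = 0 := by
      unfold tent
      rw [← norm_sub_sq_sph]
      exact max_eq_right (by linarith)
    simp [h3]

lemma lintegral_Ioc_rpow_neg {s : ℝ} (hs1 : s < 1) :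
    ∫⁻ ρ in Set.Ioc (0 : ℝ) 1, ENNReal.ofReal (ρ ^ (-s)) = ENNReal.ofReal (1 / (1 - s)) := by
  have hi : IntervalIntegrable (fun ρ : ℝ => ρ ^ (-s)) volume 0 1 :=
    intervalIntegral.intervalIntegrable_rpow' (by linarith)
  rw [intervalIntegrable_iff_integrableOn_Ioc_of_le zero_le_one] at hi
  rw [← ofReal_integral_eq_lintegral_ofReal hi, ← intervalIntegral.integral_of_le zero_le_one,
    integral_rpow (Or.inl (by linarith))]
  · congr 1
    rw [Real.one_rpow, Real.zero_rpow (by linarith)]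
    ring
  · refine (ae_restrict_iff' measurableSet_Ioc).2 (Filter.Eventually.of_forall fun ρ hρ => ?_)
    exact Real.rpow_nonneg hρ.1.le _

lemma exists_rieszL_le (hn : 1 ≤ n) : ∃ C : ℝ, 0 < C ∧ ∀ s : ℝ, 0 < s → s < 1 →
    rieszL n (n + s) ≤ ENNReal.ofReal (C / (1 - s)) := by
  have hS := surf_univ_pos hn
  obtain ⟨S, hS0, hSE⟩ : ∃ S : ℝ, 0 < S ∧ surf n Set.univ = ENNReal.ofReal S :=
    ⟨_, hS, (ENNReal.ofReal_toReal (measure_ne_top _ _)).symm⟩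
  obtain ⟨V, hV0, hVE⟩ : ∃ V : ℝ, 0 < V ∧ volume (closedBall (0 : Eucl n) 1) = ENNReal.ofReal V :=
    ⟨_, ENNReal.toReal_pos (measure_closedBall_pos _ _ one_pos).ne' measure_closedBall_lt_top.ne,
      (ENNReal.ofReal_toReal measure_closedBall_lt_top.ne).symm⟩
  refine ⟨(n + 1) * (n + 3) / 2 * (S * (2 ^ n * V) + 4 * (S * S)), by positivity, ?_⟩
  intro s hs0 hs1
  have hq : 0 < (n : ℝ) + s := by positivity
  unfold rieszL
  rw [lintegral_riesz_eq_tent hq (G := fun z : Sph n × Sph n => ‖(z.1 : Eucl n) - z.2‖ ^ 2) (by fun_prop)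
    (fun z => sq_nonneg _) (by simp)]
  set B : ℝ → ℝ≥0∞ := fun ρ => ∫⁻ z : Sph n × Sph n, ENNReal.ofReal
    (tent (ρ ^ 2) (inner ℝ (z.1 : Eucl n) (z.2 : Eucl n)) * ‖(z.1 : Eucl n) - z.2‖ ^ 2)
      ∂((surf n).prod (surf n)) with hB
  have hB1 : ∀ ρ, 0 < ρ → B ρ ≤ ENNReal.ofReal (S * (2 ^ n * V) * ρ ^ (n + 3)) := by
    intro ρ h0
    have hm : Measurable fun z : Sph n × Sph n => ENNReal.ofReal
      (tent (ρ ^ 2) (inner ℝ (z.1 : Eucl n) (z.2 : Eucl n)) * ‖(z.1 : Eucl n) - z.2‖ ^ 2) :=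
      ((continuous_tent_inner _).mul (by fun_prop)).measurable.ennreal_ofReal
    simp only [hB]
    rw [lintegral_prod _ hm.aemeasurable]
    have h1 : ∀ x : Sph n, ∫⁻ y, ENNReal.ofReal (tent (ρ ^ 2)
        (inner ℝ (x : Eucl n) (y : Eucl n)) * ‖(x : Eucl n) - y‖ ^ 2) ∂(surf n) ≤
        ENNReal.ofReal (2 ^ n * V * ρ ^ (n + 3)) := by
      intro x
      calc _ ≤ ∫⁻ y, (closedBall x ρ).indicator (fun _ => ENNReal.ofReal (ρ ^ 4)) y ∂(surf n) :=
            lintegral_mono fun y => tent_mul_sq_le_indicator h0 x y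
        _ = ENNReal.ofReal (ρ ^ 3) * (ENNReal.ofReal ρ * surf n (closedBall x ρ)) := by
            rw [lintegral_indicator measurableSet_closedBall, setLIntegral_const, ← mul_assoc,
              ← ENNReal.ofReal_mul (by positivity)]
            congr 2
        _ ≤ ENNReal.ofReal (ρ ^ 3) * (ENNReal.ofReal ((2 * ρ) ^ n) * ENNReal.ofReal V) := by
            refine mul_le_mul_right ?_ _
            rw [← hVE]
            exact surf_closedBall_le hn x h0
        _ = _ := by
            rw [← ENNReal.ofReal_mul (by positivity), ← ENNReal.ofReal_mul (by positivity)]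
            congr 1
            ring
    calc _ ≤ ∫⁻ x : Sph n, ENNReal.ofReal (2 ^ n * V * ρ ^ (n + 3)) ∂(surf n) := lintegral_mono h1
      _ = _ := by
        rw [lintegral_const, hSE, ← ENNReal.ofReal_mul (by positivity)]
        congr 1; ring
  have hB2 : ∀ ρ, 0 < ρ → B ρ ≤ ENNReal.ofReal (4 * (S * S) * ρ ^ 2) := by
    intro ρ h0
    calc B ρ ≤ ∫⁻ z : Sph n × Sph n, ENNReal.ofReal (4 * ρ ^ 2) ∂((surf n).prod (surf n)) :=
          lintegral_mono fun z => ENNReal.ofReal_le_ofReal (tent_mul_sq_le z.1 z.2)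
      _ = _ := by
        rw [lintegral_const, ← Set.univ_prod_univ, Measure.prod_prod, hSE,
          ← ENNReal.ofReal_mul hS0.le, ← ENNReal.ofReal_mul (by positivity)]
        congr 1; ring
  have hI1 : ∫⁻ ρ in Set.Ioc (0 : ℝ) 1, ENNReal.ofReal (ρ ^ (-(n + s) - 3)) * B ρ ≤
      ENNReal.ofReal (S * (2 ^ n * V) * (1 / (1 - s))) := by
    calc _ ≤ ∫⁻ ρ in Set.Ioc (0 : ℝ) 1, ENNReal.ofReal (S * (2 ^ n * V)) *
          ENNReal.ofReal (ρ ^ (-s)) := by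
          refine setLIntegral_mono' measurableSet_Ioc fun ρ hρ => ?_
          have h0 := hρ.1
          refine (mul_le_mul_right (hB1 ρ h0) _).trans (le_of_eq ?_)
          rw [← ENNReal.ofReal_mul (by positivity), ← ENNReal.ofReal_mul (by positivity)]
          congr 1
          have : ρ ^ (-s) = ρ ^ (-(n + s) - 3) * ρ ^ (n + 3) := by
            rw [← Real.rpow_natCast ρ (n + 3), ← Real.rpow_add h0]
            congr 1; push_cast; ring
          rw [this]; ring
      _ = _ := by
        rw [lintegral_const_mul' _ _ ENNReal.ofReal_ne_top, lintegral_Ioc_rpow_neg hs1,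
          ← ENNReal.ofReal_mul (by positivity)]
  have hI2 : ∫⁻ ρ in Set.Ioi (1 : ℝ), ENNReal.ofReal (ρ ^ (-(n + s) - 3)) * B ρ ≤
      ENNReal.ofReal (4 * (S * S) * (1 / (1 - s))) := by
    have hn' : (1 : ℝ) ≤ n := by exact_mod_cast hn
    have i1 : IntegrableOn (fun ρ : ℝ => ρ ^ (-(n + s) - 1)) (Set.Ioi 1) :=
      integrableOn_Ioi_rpow_of_lt (by linarith) one_pos
    calc _ ≤ ∫⁻ ρ in Set.Ioi (1 : ℝ), ENNReal.ofReal (4 * (S * S)) *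
          ENNReal.ofReal (ρ ^ (-(n + s) - 1)) := by
          refine setLIntegral_mono' measurableSet_Ioi fun ρ hρ => ?_
          have h0 : 0 < ρ := one_pos.trans hρ
          refine (mul_le_mul_right (hB2 ρ h0) _).trans (le_of_eq ?_)
          rw [← ENNReal.ofReal_mul (by positivity), ← ENNReal.ofReal_mul (by positivity)]
          congr 1
          have : ρ ^ (-(n + s) - 1) = ρ ^ (-(n + s) - 3) * ρ ^ 2 := by
            rw [← Real.rpow_natCast ρ 2, ← Real.rpow_add h0]
            congr 1; push_cast; ring
          rw [this]; ring
      _ = ENNReal.ofReal (4 * (S * S)) * ENNReal.ofReal (1 / (n + s)) := by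
        rw [lintegral_const_mul' _ _ ENNReal.ofReal_ne_top, ← ofReal_integral_eq_lintegral_ofReal i1,
          integral_Ioi_rpow_of_lt (by linarith) one_pos, Real.one_rpow]
        · congr 2
          rw [show -(n + s) - 1 + 1 = -(n + s) by ring, neg_div_neg_eq]
        · refine (ae_restrict_iff' measurableSet_Ioi).2 (Filter.Eventually.of_forall fun ρ hρ => ?_)
          exact Real.rpow_nonneg (one_pos.trans hρ).le _
      _ ≤ _ := by
        rw [← ENNReal.ofReal_mul (by positivity)]
        apply ENNReal.ofReal_le_ofReal
        have : 0 < 1 - s := by linarith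
        gcongr
        linarith
  rw [← Set.Ioc_union_Ioi_eq_Ioi zero_le_one,
    lintegral_union measurableSet_Ioi Set.Ioc_disjoint_Ioi_same]
  have h1s : 0 < 1 - s := by linarith
  calc _ ≤ ENNReal.ofReal ((n + s) * (n + s + 2) / 2) *
        (ENNReal.ofReal (S * (2 ^ n * V) * (1 / (1 - s))) +
          ENNReal.ofReal (4 * (S * S) * (1 / (1 - s)))) := by gcongr
    _ = ENNReal.ofReal ((n + s) * (n + s + 2) / 2 *
        ((S * (2 ^ n * V) + 4 * (S * S)) * (1 / (1 - s)))) := by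
      rw [← ENNReal.ofReal_add (by positivity) (by positivity), ← ENNReal.ofReal_mul (by positivity)]
      congr 1; ring
    _ ≤ _ := by
      apply ENNReal.ofReal_le_ofReal
      have : (n + s) * (n + s + 2) ≤ ((n : ℝ) + 1) * (n + 3) := by
        apply mul_le_mul <;> linarith
      calc _ ≤ ((n : ℝ) + 1) * (n + 3) / 2 *
        ((S * (2 ^ n * V) + 4 * (S * S)) * (1 / (1 - s))) := by gcongr
        _ = _ := by ring

/-- Spectral lower bound for the Gagliardo-type form. -/
lemma exists_le_rieszD (hn : 1 ≤ n) : ∃ c : ℝ, 0 < c ∧ ∀ (s : ℝ) (v : Sph n → ℝ) (L : NNReal),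
    0 < s → s < 1 → LipschitzWith L v → ∫ x, v x ∂(surf n) = 0 →
    ENNReal.ofReal ((∫ x, v x ^ 2 ∂(surf n)) / (surf n).real Set.univ) * rieszL n (n + s) +
      ENNReal.ofReal (c / (1 - s) * defForm id v) ≤ rieszD (n + s) v := by
  obtain ⟨c, hc0, hc⟩ := exists_tent_const (n := n) hn
  refine ⟨c, hc0, fun s v L hs0 hs1 hv hmean => ?_⟩
  have hq : 0 < (n : ℝ) + s := by positivity
  have hn' : (1 : ℝ) ≤ n := by exact_mod_cast hn
  have hvc := hv.continuous
  unfold rieszL rieszD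
  rw [lintegral_riesz_eq_tent hq (G := fun z : Sph n × Sph n => ‖(z.1 : Eucl n) - z.2‖ ^ 2) (by fun_prop)
    (fun z => sq_nonneg _) (by simp),
    lintegral_riesz_eq_tent hq (G := fun z : Sph n × Sph n => (v z.1 - v z.2) ^ 2)
      (((hvc.comp continuous_fst).sub (hvc.comp continuous_snd)).pow 2).measurable
    (fun z => sq_nonneg _) (by simp)]
  set N := (∫ x, v x ^ 2 ∂(surf n)) / (surf n).real Set.univ with hN
  have hN0 : 0 ≤ N := div_nonneg (integral_nonneg fun _ => sq_nonneg _) measureReal_nonneg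
  set F := defForm id v
  set B : ℝ → ℝ≥0∞ := fun ρ => ∫⁻ z : Sph n × Sph n, ENNReal.ofReal
    (tent (ρ ^ 2) (inner ℝ (z.1 : Eucl n) (z.2 : Eucl n)) * ‖(z.1 : Eucl n) - z.2‖ ^ 2)
      ∂((surf n).prod (surf n)) with hB
  have hpt : ∀ ρ : ℝ, 0 < ρ → ENNReal.ofReal N * B ρ +
      (Set.Ioc (0 : ℝ) 1).indicator (fun r => ENNReal.ofReal (2 * (c * r ^ (n + 3) * F))) ρ ≤
      ∫⁻ z : Sph n × Sph n, ENNReal.ofReal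
        (tent (ρ ^ 2) (inner ℝ (z.1 : Eucl n) (z.2 : Eucl n)) * (v z.1 - v z.2) ^ 2)
        ∂((surf n).prod (surf n)) := by
    intro ρ h0
    have hct := continuous_tent_inner (n := n) (ρ ^ 2)
    have i1 := integrable_of_continuous_sph2 (f := fun z : Sph n × Sph n =>
      tent (ρ ^ 2) (inner ℝ (z.1 : Eucl n) (z.2 : Eucl n)) * ‖(z.1 : Eucl n) - z.2‖ ^ 2)
      (hct.mul (by fun_prop))
    have i2 := integrable_of_continuous_sph2 (f := fun z : Sph n × Sph n =>
      tent (ρ ^ 2) (inner ℝ (z.1 : Eucl n) (z.2 : Eucl n)) * (v z.1 - v z.2) ^ 2)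
      (hct.mul (((hvc.comp continuous_fst).sub (hvc.comp continuous_snd)).pow 2))
    have n1 : ∀ z : Sph n × Sph n, 0 ≤ tent (ρ ^ 2) (inner ℝ (z.1 : Eucl n) (z.2 : Eucl n)) *
      ‖(z.1 : Eucl n) - z.2‖ ^ 2 := fun z => mul_nonneg (tent_nonneg _ _) (sq_nonneg _)
    have n2 : ∀ z : Sph n × Sph n, 0 ≤ tent (ρ ^ 2) (inner ℝ (z.1 : Eucl n) (z.2 : Eucl n)) *
      (v z.1 - v z.2) ^ 2 := fun z => mul_nonneg (tent_nonneg _ _) (sq_nonneg _)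
    simp only [hB]
    rw [← ofReal_integral_eq_lintegral_ofReal i1 (Filter.Eventually.of_forall n1),
      ← ofReal_integral_eq_lintegral_ofReal i2 (Filter.Eventually.of_forall n2)]
    have key := integral_zon_mul_sq_sub hn (continuous_tent (ρ ^ 2)) hvc
    unfold zon at key
    rw [key, ← ENNReal.ofReal_mul hN0]
    have hd0 := defForm_tent_nonneg hn (ρ ^ 2) hv hmean
    rw [ENNReal.ofReal_add (mul_nonneg hN0 (integral_nonneg n1)) (by positivity)]
    gcongr
    by_cases h1 : ρ ≤ 1
    · rw [Set.indicator_of_mem (show ρ ∈ Set.Ioc (0 : ℝ) 1 from ⟨h0, h1⟩)]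
      apply ENNReal.ofReal_le_ofReal
      have := hc v L ρ hv hmean h0 h1
      linarith
    · rw [Set.indicator_of_notMem (fun h => h1 h.2)]
      exact zero_le
  have hind : Measurable fun ρ : ℝ => ENNReal.ofReal (ρ ^ (-(n + s) - 3)) *
      (Set.Ioc (0 : ℝ) 1).indicator (fun r => ENNReal.ofReal (2 * (c * r ^ (n + 3) * F))) ρ := by
    refine Measurable.mul (measurable_id.pow_const _).ennreal_ofReal ?_
    refine Measurable.indicator ?_ measurableSet_Ioc
    fun_prop
  have hIF : ENNReal.ofReal (2 * c / (1 - s) * F) = ∫⁻ ρ in Set.Ioi (0 : ℝ),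
      ENNReal.ofReal (ρ ^ (-(n + s) - 3)) *
      (Set.Ioc (0 : ℝ) 1).indicator (fun r => ENNReal.ofReal (2 * (c * r ^ (n + 3) * F))) ρ := by
    have h1 : ∀ ρ : ℝ, ENNReal.ofReal (ρ ^ (-(n + s) - 3)) *
        (Set.Ioc (0 : ℝ) 1).indicator (fun r => ENNReal.ofReal (2 * (c * r ^ (n + 3) * F))) ρ =
        (Set.Ioc (0 : ℝ) 1).indicator (fun r => ENNReal.ofReal (2 * c * F) *
          ENNReal.ofReal (r ^ (-s))) ρ := by
      intro ρ
      by_cases hρ : ρ ∈ Set.Ioc (0 : ℝ) 1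
      · have h0 := hρ.1
        rw [Set.indicator_of_mem hρ, Set.indicator_of_mem hρ, ← ENNReal.ofReal_mul (by positivity),
          mul_comm (ENNReal.ofReal (2 * c * F)), ← ENNReal.ofReal_mul (by positivity)]
        congr 1
        have : ρ ^ (-s) = ρ ^ (-(n + s) - 3) * ρ ^ (n + 3) := by
          rw [← Real.rpow_natCast ρ (n + 3), ← Real.rpow_add h0]
          congr 1; push_cast; ring
        rw [this]; ring
      · simp [Set.indicator_of_notMem hρ]
    simp only [h1]
    rw [lintegral_indicator measurableSet_Ioc, Measure.restrict_restrict measurableSet_Ioc,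
      Set.inter_eq_left.2 Set.Ioc_subset_Ioi_self, lintegral_const_mul' _ _ ENNReal.ofReal_ne_top,
      lintegral_Ioc_rpow_neg hs1, mul_comm (ENNReal.ofReal (2 * c * F)), ← ENNReal.ofReal_mul
        (one_div_nonneg.2 (by linarith))]
    congr 1; ring
  have hK : (1 : ℝ≥0∞) ≤ ENNReal.ofReal ((n + s) * (n + s + 2) / 2) := by
    rw [ENNReal.one_le_ofReal]
    nlinarith
  have hF1 : ENNReal.ofReal (c / (1 - s) * F) ≤ ENNReal.ofReal (2 * c / (1 - s) * F) := by
    rcases le_total 0 F with h | h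
    · apply ENNReal.ofReal_le_ofReal
      have : 0 < 1 - s := by linarith
      gcongr
      linarith
    · rw [ENNReal.ofReal_of_nonpos]
      · exact zero_le
      · have : 0 < 1 - s := by linarith
        exact mul_nonpos_of_nonneg_of_nonpos (by positivity) h
  calc _ = ENNReal.ofReal ((n + s) * (n + s + 2) / 2) * (ENNReal.ofReal N *
        ∫⁻ ρ in Set.Ioi (0 : ℝ), ENNReal.ofReal (ρ ^ (-(n + s) - 3)) * B ρ) +
        ENNReal.ofReal (c / (1 - s) * F) := by ring
    _ ≤ ENNReal.ofReal ((n + s) * (n + s + 2) / 2) * (ENNReal.ofReal N *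
        ∫⁻ ρ in Set.Ioi (0 : ℝ), ENNReal.ofReal (ρ ^ (-(n + s) - 3)) * B ρ) +
        ENNReal.ofReal ((n + s) * (n + s + 2) / 2) * ENNReal.ofReal (2 * c / (1 - s) * F) := by
      gcongr
      exact hF1.trans (le_mul_of_one_le_left zero_le hK)
    _ = ENNReal.ofReal ((n + s) * (n + s + 2) / 2) * ∫⁻ ρ in Set.Ioi (0 : ℝ),
        ENNReal.ofReal (ρ ^ (-(n + s) - 3)) * (ENNReal.ofReal N * B ρ +
        (Set.Ioc (0 : ℝ) 1).indicator (fun r => ENNReal.ofReal (2 * (c * r ^ (n + 3) * F))) ρ) := by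
      rw [← mul_add, hIF, ← lintegral_const_mul' _ _ ENNReal.ofReal_ne_top,
        ← lintegral_add_right _ hind]
      congr 2
      funext ρ
      ring
    _ ≤ _ := by
      refine mul_le_mul_right (setLIntegral_mono' measurableSet_Ioi fun ρ hρ => ?_) _
      exact mul_le_mul_right (hpt ρ hρ) _

end RieszForm

section PolarPerimeter

variable {n : ℕ}

/-- The (punctured) star-shaped set `{r x : 0 < r < R(x), x ∈ ∂B}`. -/
def polarSet (R : Sph n → ℝ) : Set (Eucl n) := {z | ‖z‖ < homExt R z}

lemma measurableSet_polarSet {R : Sph n → ℝ} (hR : Measurable R) : MeasurableSet (polarSet R) :=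
  measurableSet_lt measurable_norm (measurable_homExt hR)

lemma smul_mem_polarSet {R : Sph n → ℝ} {r : ℝ} (hr : 0 < r) (x : Sph n) :
    r • (x : Eucl n) ∈ polarSet R ↔ r < R x := by
  rw [polarSet, Set.mem_ofPred_eq, homExt_smul R hr, norm_smul, Sph.norm_eq, Real.norm_eq_abs,
    abs_of_pos hr, mul_one]

lemma setLIntegral_polarSet (hn : 1 ≤ n) {R : Sph n → ℝ} (hR : Measurable R)
    {f : Eucl n → ℝ≥0∞} (hf : Measurable f) :
    ∫⁻ z in polarSet R, f z = ∫⁻ x, ∫⁻ r in Set.Ioo 0 (R x),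
      ENNReal.ofReal (r ^ (n - 1)) * f (r • (x : Eucl n)) ∂volume ∂(surf n) := by
  have hE := measurableSet_polarSet hR
  rw [← lintegral_indicator hE, lintegral_polar' hn _ (hf.indicator hE)]
  refine lintegral_congr fun x => ?_
  have h1 : Set.Ioo 0 (R x) = Set.Iio (R x) ∩ Set.Ioi 0 := by
    ext r; simp [and_comm]
  rw [h1, ← Measure.restrict_restrict measurableSet_Iio, ← lintegral_indicator measurableSet_Iio]
  refine setLIntegral_congr_fun measurableSet_Ioi fun r hr => ?_
  by_cases h : r < R x
  · rw [Set.indicator_of_mem ((smul_mem_polarSet hr x).2 h), Set.indicator_of_mem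
      (show r ∈ Set.Iio (R x) from h)]
  · rw [Set.indicator_of_notMem (fun h' => h ((smul_mem_polarSet hr x).1 h')),
      Set.indicator_of_notMem (show r ∉ Set.Iio (R x) from h), mul_zero]

lemma setLIntegral_polarSet_compl (hn : 1 ≤ n) {R : Sph n → ℝ} (hR : Measurable R)
    (hpos : ∀ x, 0 < R x) {f : Eucl n → ℝ≥0∞} (hf : Measurable f) :
    ∫⁻ z in (polarSet R)ᶜ, f z = ∫⁻ x, ∫⁻ r in Set.Ici (R x),
      ENNReal.ofReal (r ^ (n - 1)) * f (r • (x : Eucl n)) ∂volume ∂(surf n) := by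
  have hE := (measurableSet_polarSet hR).compl
  rw [← lintegral_indicator hE, lintegral_polar' hn _ (hf.indicator hE)]
  refine lintegral_congr fun x => ?_
  have h1 : Set.Ici (R x) = Set.Ici (R x) ∩ Set.Ioi 0 := by
    ext r
    simp only [Set.mem_Ici, Set.mem_inter_iff, Set.mem_Ioi]
    exact ⟨fun h => ⟨h, (hpos x).trans_le h⟩, fun h => h.1⟩
  rw [h1, ← Measure.restrict_restrict measurableSet_Ici, ← lintegral_indicator measurableSet_Ici]
  refine setLIntegral_congr_fun measurableSet_Ioi fun r hr => ?_
  by_cases h : r < R x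
  · rw [Set.indicator_of_notMem (Set.notMem_compl_iff.2 ((smul_mem_polarSet hr x).2 h)),
      Set.indicator_of_notMem (show r ∉ Set.Ici (R x) from not_le.2 h), mul_zero]
  · rw [Set.indicator_of_mem (Set.mem_compl fun h' => h ((smul_mem_polarSet hr x).1 h')),
      Set.indicator_of_mem (show r ∈ Set.Ici (R x) from not_lt.1 h)]

/-- The kernel `|r x - ρ y|^{-q}` with polar Jacobians, as a function of `d = |x - y|`. -/
noncomputable def radKer (n : ℕ) (q d r ρ : ℝ) : ℝ≥0∞ :=
  ENNReal.ofReal (r ^ (n - 1)) * (ENNReal.ofReal (ρ ^ (n - 1)) *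
    ENNReal.ofReal (((r - ρ) ^ 2 + r * ρ * d ^ 2) ^ (-q / 2)))

/-- The interaction of the radial sets `A` and `B` along two rays with opening `d`. -/
noncomputable def radJ (n : ℕ) (q d : ℝ) (A B : Set ℝ) : ℝ≥0∞ :=
  ∫⁻ r in A, ∫⁻ ρ in B, radKer n q d r ρ

lemma measurable_radKer (q : ℝ) : Measurable fun p : ℝ × ℝ × ℝ => radKer n q p.1 p.2.1 p.2.2 := by
  unfold radKer
  fun_prop

lemma measurable_setLIntegral_family {α : Type*} [MeasurableSpace α] {A : α → Set ℝ}
    (hA : MeasurableSet {p : α × ℝ | p.2 ∈ A p.1}) {f : α → ℝ → ℝ≥0∞}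
    (hf : Measurable (Function.uncurry f)) : Measurable fun a => ∫⁻ ρ in A a, f a ρ := by
  have h1 : ∀ a, ∫⁻ ρ in A a, f a ρ =
      ∫⁻ ρ, ({p : α × ℝ | p.2 ∈ A p.1}.indicator (Function.uncurry f)) (a, ρ) := by
    intro a
    have hm : MeasurableSet (A a) := measurable_prodMk_left hA
    rw [← lintegral_indicator hm]
    rfl
  simp only [h1]
  exact Measurable.lintegral_prod_right' (hf.indicator hA)

lemma measurableSet_Ici_family {α : Type*} [MeasurableSpace α] {R : α → ℝ} (hR : Measurable R) :
    MeasurableSet {p : α × ℝ | p.2 ∈ Set.Ici (R p.1)} :=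
  measurableSet_le (hR.comp measurable_fst) measurable_snd

lemma measurableSet_Ioo_family {α : Type*} [MeasurableSpace α] {R : α → ℝ} (hR : Measurable R) :
    MeasurableSet {p : α × ℝ | p.2 ∈ Set.Ioo 0 (R p.1)} :=
  (measurableSet_lt measurable_const measurable_snd).inter
    (measurableSet_lt measurable_snd (hR.comp measurable_fst))

lemma measurable_radJ {α : Type*} [MeasurableSpace α] (q : ℝ) {d : α → ℝ} (hd : Measurable d)
    {A B : α → Set ℝ} (hA : MeasurableSet {p : α × ℝ | p.2 ∈ A p.1})
    (hB : MeasurableSet {p : α × ℝ | p.2 ∈ B p.1}) :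
    Measurable fun a => radJ n q (d a) (A a) (B a) := by
  unfold radJ
  refine measurable_setLIntegral_family hA ?_
  have hB' : MeasurableSet {p : (α × ℝ) × ℝ | p.2 ∈ B p.1.1} :=
    (((measurable_fst.comp measurable_fst).prodMk measurable_snd) hB :
      MeasurableSet ((fun p : (α × ℝ) × ℝ => (p.1.1, p.2)) ⁻¹' {p : α × ℝ | p.2 ∈ B p.1}))
  refine measurable_setLIntegral_family (A := fun p : α × ℝ => B p.1)
    (f := fun p ρ => radKer n q (d p.1) p.2 ρ) hB' ?_
  exact (measurable_radKer q).comp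
    ((hd.comp (measurable_fst.comp measurable_fst)).prodMk
      ((measurable_snd.comp measurable_fst).prodMk measurable_snd))

lemma norm_rpow_eq_radial (x y : Sph n) (r ρ q : ℝ) :
    ‖r • (x : Eucl n) - ρ • (y : Eucl n)‖ ^ (-q) =
      ((r - ρ) ^ 2 + r * ρ * ‖(x : Eucl n) - y‖ ^ 2) ^ (-q / 2) := by
  rw [← norm_smul_sub_smul_sq, ← Real.rpow_natCast, ← Real.rpow_mul (norm_nonneg _)]
  congr 1
  push_cast; ring

lemma fracPer_polarSet (hn : 1 ≤ n) (s : ℝ) {R : Sph n → ℝ} (hR : Measurable R)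
    (hpos : ∀ x, 0 < R x) :
    fracPer n s (polarSet R) = ∫⁻ z : Sph n × Sph n, radJ n (n + s) ‖(z.1 : Eucl n) - z.2‖
      (Set.Ioo 0 (R z.1)) (Set.Ici (R z.2)) ∂((surf n).prod (surf n)) := by
  have hmJ : Measurable fun z : Sph n × Sph n => radJ n (n + s) ‖(z.1 : Eucl n) - z.2‖
      (Set.Ioo 0 (R z.1)) (Set.Ici (R z.2)) :=
    measurable_radJ _ (by fun_prop) (measurableSet_Ioo_family (hR.comp measurable_fst))
      (measurableSet_Ici_family (hR.comp measurable_snd))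
  have hmK : Measurable fun p : Eucl n × Eucl n =>
      ENNReal.ofReal (‖p.1 - p.2‖ ^ (-((n : ℝ) + s))) := by fun_prop
  rw [lintegral_prod _ hmJ.aemeasurable, fracPer, setLIntegral_polarSet hn hR
    (Measurable.lintegral_prod_right' hmK)]
  refine lintegral_congr fun x => ?_
  have hm2 : Measurable (Function.uncurry fun (r : ℝ) (y : Sph n) => ∫⁻ ρ in Set.Ici (R y),
      radKer n (n + s) ‖(x : Eucl n) - y‖ r ρ) := by
    refine measurable_setLIntegral_family (A := fun p : ℝ × Sph n => Set.Ici (R p.2))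
      (f := fun p ρ => radKer n (n + s) ‖(x : Eucl n) - p.2‖ p.1 ρ)
      (measurableSet_Ici_family (hR.comp measurable_snd)) ?_
    refine (measurable_radKer (n := n) ((n : ℝ) + s)).comp (f := fun p : (ℝ × Sph n) × ℝ =>
      (‖(x : Eucl n) - p.1.2‖, p.1.1, p.2)) ?_
    fun_prop
  unfold radJ
  have hsw := lintegral_lintegral_swap (μ := volume.restrict (Set.Ioo 0 (R x))) (ν := surf n)
    hm2.aemeasurable
  refine Eq.trans ?_ hsw
  refine lintegral_congr fun r => ?_
  have hmr : Measurable fun y : Eucl n =>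
      ENNReal.ofReal (‖r • (x : Eucl n) - y‖ ^ (-((n : ℝ) + s))) := by fun_prop
  simp only
  rw [setLIntegral_polarSet_compl hn hR hpos hmr,
    ← lintegral_const_mul' _ _ ENNReal.ofReal_ne_top]
  refine lintegral_congr fun y => ?_
  rw [← lintegral_const_mul' _ _ ENNReal.ofReal_ne_top]
  refine lintegral_congr fun ρ => ?_
  simp only [norm_rpow_eq_radial, radKer]

lemma radJ_union_left (q d : ℝ) {A A' : Set ℝ} (B : Set ℝ) (hA' : MeasurableSet A')
    (h : Disjoint A A') : radJ n q d (A ∪ A') B = radJ n q d A B + radJ n q d A' B :=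
  lintegral_union hA' h

lemma radJ_union_right (q d : ℝ) (A : Set ℝ) {B B' : Set ℝ} (hB : MeasurableSet B)
    (hB' : MeasurableSet B')
    (h : Disjoint B B') : radJ n q d A (B ∪ B') = radJ n q d A B + radJ n q d A B' := by
  unfold radJ
  rw [← lintegral_add_left]
  · exact lintegral_congr fun r => lintegral_union hB' h
  · refine measurable_setLIntegral_family (A := fun _ : ℝ => B)
      (f := fun r ρ => radKer n q d r ρ) (measurable_snd hB) ?_
    exact (measurable_radKer (n := n) q).comp (f := fun p : ℝ × ℝ => (d, p.1, p.2)) (by fun_prop)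

lemma radJ_symmetrize (q d : ℝ) {a b : ℝ} (ha : 0 < a) (hb : 0 < b) :
    radJ n q d (Set.Ioo 0 a) (Set.Ici b) + radJ n q d (Set.Ioo 0 b) (Set.Ici a) =
      radJ n q d (Set.Ioo 0 a) (Set.Ici a) + radJ n q d (Set.Ioo 0 b) (Set.Ici b) +
        radJ n q d (Set.Ico (min a b) (max a b)) (Set.Ico (min a b) (max a b)) := by
  wlog h : a ≤ b generalizing a b
  · have := this hb ha (le_of_not_ge h)
    rw [min_comm, max_comm, add_comm, this]
    ring
  rw [min_eq_left h, max_eq_right h]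
  have e1 : Set.Ici a = Set.Ico a b ∪ Set.Ici b := (Set.Ico_union_Ici_eq_Ici h).symm
  have e2 : Set.Ioo 0 b = Set.Ioo 0 a ∪ Set.Ico a b := (Set.Ioo_union_Ico_eq_Ioo ha h).symm
  have d1 : Disjoint (Set.Ico a b) (Set.Ici b) :=
    Set.disjoint_left.2 fun x hx hx' => absurd hx.2 (not_lt.2 hx')
  have d2 : Disjoint (Set.Ioo 0 a) (Set.Ico a b) :=
    Set.disjoint_left.2 fun x hx hx' => absurd hx.2 (not_lt.2 hx'.1)
  rw [e1, e2]
  simp only [radJ_union_left _ _ _ measurableSet_Ico d2,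
    radJ_union_right _ _ _ measurableSet_Ico measurableSet_Ici d1]
  ring

lemma setLIntegral_scale {a : ℝ} (ha : 0 < a) {A : Set ℝ} (hA : MeasurableSet A)
    (f : ℝ → ℝ≥0∞) :
    ∫⁻ r in (fun t => a * t) '' A, f r = ENNReal.ofReal a * ∫⁻ r in A, f (a * r) := by
  rw [lintegral_image_eq_lintegral_abs_deriv_mul hA
    (fun x _ => ((hasDerivAt_id' x).const_mul a).hasDerivWithinAt)
    (fun x _ y _ h => mul_left_cancel₀ ha.ne' h)]
  simp only [mul_one, abs_of_pos ha]
  exact lintegral_const_mul' _ _ ENNReal.ofReal_ne_top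

lemma radKer_scale (hn : 1 ≤ n) (s d : ℝ) {a r ρ : ℝ} (ha : 0 < a) (hr : 0 ≤ r) (hρ : 0 ≤ ρ) :
    radKer n (n + s) d (a * r) (a * ρ) =
      ENNReal.ofReal (a ^ ((n : ℝ) - s - 2)) * radKer n (n + s) d r ρ := by
  unfold radKer
  rw [← ENNReal.ofReal_mul (by positivity), ← ENNReal.ofReal_mul (by positivity),
    ← ENNReal.ofReal_mul (by positivity), ← ENNReal.ofReal_mul (by positivity),
    ← ENNReal.ofReal_mul (by positivity)]
  congr 1
  have h1 : (a * r - a * ρ) ^ 2 + a * r * (a * ρ) * d ^ 2 =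
      a ^ 2 * ((r - ρ) ^ 2 + r * ρ * d ^ 2) := by ring
  rw [h1, Real.mul_rpow (by positivity) (by positivity), mul_pow, mul_pow]
  have h2 : a ^ ((n : ℝ) - s - 2) = a ^ (n - 1) * a ^ (n - 1) * (a ^ 2) ^ (-(n + s) / 2) := by
    rw [← Real.rpow_natCast a 2, ← Real.rpow_mul ha.le, ← Real.rpow_natCast a (n - 1),
      ← Real.rpow_add ha, ← Real.rpow_add ha]
    congr 1
    rw [Nat.cast_sub hn]
    push_cast; ring
  rw [h2]; ring

lemma radJ_Ioo_Ici_scale (hn : 1 ≤ n) (s d : ℝ) {a : ℝ} (ha : 0 < a) :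
    radJ n (n + s) d (Set.Ioo 0 a) (Set.Ici a) =
      ENNReal.ofReal (a ^ ((n : ℝ) - s)) * radJ n (n + s) d (Set.Ioo 0 1) (Set.Ici 1) := by
  have e1 : Set.Ioo 0 a = (fun t => a * t) '' Set.Ioo 0 1 := by
    rw [Set.image_mul_left_Ioo ha]; simp
  have e2 : Set.Ici a = (fun t => a * t) '' Set.Ici 1 := by
    ext t
    simp only [Set.mem_Ici, Set.mem_image]
    refine ⟨fun h => ⟨t / a, by rwa [one_le_div ha], by field_simp⟩, ?_⟩
    rintro ⟨x, hx, rfl⟩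
    nlinarith
  unfold radJ
  rw [e1, setLIntegral_scale ha measurableSet_Ioo]
  have h1 : ∀ r ∈ Set.Ioo (0 : ℝ) 1, ∫⁻ ρ in Set.Ici a, radKer n (n + s) d (a * r) ρ =
      ENNReal.ofReal (a * a ^ ((n : ℝ) - s - 2)) * ∫⁻ ρ in Set.Ici 1, radKer n (n + s) d r ρ := by
    intro r hr
    rw [e2, setLIntegral_scale ha measurableSet_Ici, ENNReal.ofReal_mul ha.le, mul_assoc,
      ← lintegral_const_mul' (ENNReal.ofReal (a ^ ((n : ℝ) - s - 2))) _ ENNReal.ofReal_ne_top]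
    congr 1
    refine setLIntegral_congr_fun (measurableSet_Ici (a := (1 : ℝ))) fun ρ hρ => ?_
    exact radKer_scale hn s d ha hr.1.le (zero_le_one.trans hρ)
  rw [setLIntegral_congr_fun measurableSet_Ioo h1, lintegral_const_mul' _ _ ENNReal.ofReal_ne_top,
    ← mul_assoc, ← ENNReal.ofReal_mul ha.le]
  congr 2
  have : a ^ ((n : ℝ) - s) = a ^ ((n : ℝ) - s - 2) * a ^ (2 : ℝ) := by
    rw [← Real.rpow_add ha]; congr 1; ring
  rw [this, Real.rpow_two]; ring

lemma exists_fracPer_formula (hn : 1 ≤ n) (s : ℝ) : ∃ g : ℝ≥0∞,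
    ∀ R : Sph n → ℝ, Measurable R → (∀ x, 0 < R x) →
    2 * fracPer n s (polarSet R) =
      2 * (∫⁻ x, ENNReal.ofReal (R x ^ ((n : ℝ) - s)) ∂(surf n)) * g +
      ∫⁻ z : Sph n × Sph n, radJ n (n + s) ‖(z.1 : Eucl n) - z.2‖
        (Set.Ico (min (R z.1) (R z.2)) (max (R z.1) (R z.2)))
        (Set.Ico (min (R z.1) (R z.2)) (max (R z.1) (R z.2))) ∂((surf n).prod (surf n)) := by
  have hS : Nonempty (Sph n) := by
    have : Nonempty (Fin n) := ⟨⟨0, hn⟩⟩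
    have := (NormedSpace.sphere_nonempty (E := Eucl n) (x := 0) (r := 1)).2 zero_le_one
    exact this.to_subtype
  obtain ⟨x₀⟩ := hS
  set G : ℝ → ℝ≥0∞ := fun d => radJ n (n + s) d (Set.Ioo 0 1) (Set.Ici 1) with hG
  have hGm : Measurable G := measurable_radJ (A := fun _ : ℝ => Set.Ioo 0 1)
    (B := fun _ : ℝ => Set.Ici 1) _ measurable_id
    (measurable_snd (measurableSet_Ioo (a := (0 : ℝ)) (b := 1)))
    (measurable_snd (measurableSet_Ici (a := (1 : ℝ))))
  have hg : ∀ x : Sph n, ∫⁻ y : Sph n, G ‖(x : Eucl n) - y‖ ∂(surf n) =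
      ∫⁻ y : Sph n, G ‖(x₀ : Eucl n) - y‖ ∂(surf n) := by
    intro x
    obtain ⟨g, hgx⟩ := exists_isometry_map x x₀
    rw [← Sph.lintegral_act g (fun y : Sph n => G ‖(x₀ : Eucl n) - y‖)]
    refine lintegral_congr fun y => ?_
    rw [← hgx, Sph.coe_act, Sph.coe_act, ← map_sub, LinearIsometryEquiv.norm_map]
  refine ⟨∫⁻ y : Sph n, G ‖(x₀ : Eucl n) - y‖ ∂(surf n), fun R hR hpos => ?_⟩
  have hm1 : Measurable fun z : Sph n × Sph n => radJ n (n + s) ‖(z.1 : Eucl n) - z.2‖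
      (Set.Ioo 0 (R z.1)) (Set.Ici (R z.2)) :=
    measurable_radJ _ (by fun_prop) (measurableSet_Ioo_family (hR.comp measurable_fst))
      (measurableSet_Ici_family (hR.comp measurable_snd))
  have hmG : Measurable fun z : Sph n × Sph n => ENNReal.ofReal (R z.1 ^ ((n : ℝ) - s)) *
      G ‖(z.1 : Eucl n) - z.2‖ :=
    ((hR.comp measurable_fst).pow_const _).ennreal_ofReal.mul (hGm.comp (by fun_prop))
  have hsw : ∀ F : Sph n × Sph n → ℝ≥0∞, Measurable F →
      ∫⁻ z, F z.swap ∂((surf n).prod (surf n)) = ∫⁻ z, F z ∂((surf n).prod (surf n)) :=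
    fun F hF => lintegral_prod_swap F
  have hGI : ∫⁻ z : Sph n × Sph n, ENNReal.ofReal (R z.1 ^ ((n : ℝ) - s)) *
      G ‖(z.1 : Eucl n) - z.2‖ ∂((surf n).prod (surf n)) =
      (∫⁻ x, ENNReal.ofReal (R x ^ ((n : ℝ) - s)) ∂(surf n)) *
        ∫⁻ y : Sph n, G ‖(x₀ : Eucl n) - y‖ ∂(surf n) := by
    rw [lintegral_prod _ hmG.aemeasurable, ← lintegral_mul_const _ (hR.pow_const _).ennreal_ofReal]
    refine lintegral_congr fun x => ?_
    rw [← hg x, ← lintegral_const_mul' _ _ ENNReal.ofReal_ne_top]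
  rw [two_mul (fracPer _ _ _), fracPer_polarSet hn s hR hpos]
  nth_rewrite 2 [← hsw _ hm1]
  rw [← lintegral_add_left hm1]
  have h2 : ∀ z : Sph n × Sph n, radJ n (n + s) ‖(z.1 : Eucl n) - z.2‖
      (Set.Ioo 0 (R z.1)) (Set.Ici (R z.2)) + radJ n (n + s) ‖(z.swap.1 : Eucl n) - z.swap.2‖
      (Set.Ioo 0 (R z.swap.1)) (Set.Ici (R z.swap.2)) =
      (ENNReal.ofReal (R z.1 ^ ((n : ℝ) - s)) * G ‖(z.1 : Eucl n) - z.2‖ +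
        ENNReal.ofReal (R z.swap.1 ^ ((n : ℝ) - s)) * G ‖(z.swap.1 : Eucl n) - z.swap.2‖) +
      radJ n (n + s) ‖(z.1 : Eucl n) - z.2‖
        (Set.Ico (min (R z.1) (R z.2)) (max (R z.1) (R z.2)))
        (Set.Ico (min (R z.1) (R z.2)) (max (R z.1) (R z.2))) := by
    intro z
    have e : ‖(z.swap.1 : Eucl n) - z.swap.2‖ = ‖(z.1 : Eucl n) - z.2‖ := by
      simp [norm_sub_rev]
    rw [e]
    simp only [Prod.fst_swap, Prod.snd_swap, hG]
    rw [radJ_symmetrize _ _ (hpos _) (hpos _), radJ_Ioo_Ici_scale hn s _ (hpos z.1),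
      radJ_Ioo_Ici_scale hn s _ (hpos z.2)]
  simp only [h2]
  have hm3 : Measurable fun z : Sph n × Sph n =>
      ENNReal.ofReal (R z.1 ^ ((n : ℝ) - s)) * G ‖(z.1 : Eucl n) - z.2‖ +
        ENNReal.ofReal (R z.swap.1 ^ ((n : ℝ) - s)) * G ‖(z.swap.1 : Eucl n) - z.swap.2‖ :=
    hmG.add (hmG.comp measurable_swap)
  rw [lintegral_add_left hm3, lintegral_add_left hmG, hsw _ hmG, hGI]
  ring

end PolarPerimeter

section RadialBounds

variable {n : ℕ}

/-- Upper distortion factor of the radial kernel for radii in `[1 - ε, 1 + ε]`. -/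
noncomputable def kapU (n : ℕ) (ε : ℝ) : ℝ := ((1 + ε) ^ (n - 1)) ^ 2 * ((1 - ε) ^ (n + 1))⁻¹

/-- Lower distortion factor of the radial kernel for radii in `[1 - ε, 1 + ε]`. -/
noncomputable def kapL (n : ℕ) (ε : ℝ) : ℝ := ((1 - ε) ^ (n - 1)) ^ 2 * ((1 + 2 * ε) ^ (n + 1))⁻¹

lemma rpow_sq_mul_sq {c d : ℝ} (q : ℝ) (hc : 0 < c) (hd : 0 < d) :
    (c ^ 2 * d ^ 2) ^ (-q / 2) = c ^ (-q) * d ^ (-q) := by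
  rw [← mul_pow, ← Real.rpow_natCast, ← Real.rpow_mul (by positivity),
    Real.mul_rpow hc.le hd.le]
  congr 2 <;> (push_cast; ring)

lemma radKer_le {q ε d r ρ : ℝ} (hq0 : 0 ≤ q) (hq : q ≤ n + 1) (hε0 : 0 ≤ ε) (hε : ε < 1)
    (hd : 0 < d) (hr : |r - 1| ≤ ε) (hρ : |ρ - 1| ≤ ε) :
    radKer n q d r ρ ≤ ENNReal.ofReal (kapU n ε * d ^ (-q)) := by
  rw [abs_le] at hr hρ
  have hr0 : 0 ≤ r := by linarith
  have hρ0 : 0 ≤ ρ := by linarith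
  have h1 : 0 < 1 - ε := by linarith
  unfold radKer kapU
  rw [← ENNReal.ofReal_mul (by positivity), ← ENNReal.ofReal_mul (by positivity)]
  apply ENNReal.ofReal_le_ofReal
  have h2 : ((r - ρ) ^ 2 + r * ρ * d ^ 2) ^ (-q / 2) ≤ ((1 - ε) ^ (n + 1))⁻¹ * d ^ (-q) := by
    calc _ ≤ ((1 - ε) ^ 2 * d ^ 2) ^ (-q / 2) := by
          apply Real.rpow_le_rpow_of_nonpos (by positivity)
          · have : (1 - ε) ^ 2 ≤ r * ρ := by
              rw [sq]; apply mul_le_mul <;> linarith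
            nlinarith [sq_nonneg (r - ρ), sq_nonneg d]
          · linarith
      _ = (1 - ε) ^ (-q) * d ^ (-q) := rpow_sq_mul_sq q h1 hd
      _ ≤ (1 - ε) ^ (-((n + 1 : ℕ) : ℝ)) * d ^ (-q) := by
          gcongr ?_ * _
          apply Real.rpow_le_rpow_of_exponent_ge h1 (by linarith)
          push_cast; linarith
      _ = _ := by rw [Real.rpow_neg h1.le, Real.rpow_natCast]
  calc r ^ (n - 1) * (ρ ^ (n - 1) * ((r - ρ) ^ 2 + r * ρ * d ^ 2) ^ (-q / 2)) ≤
      (1 + ε) ^ (n - 1) * ((1 + ε) ^ (n - 1) * (((1 - ε) ^ (n + 1))⁻¹ * d ^ (-q))) := by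
        gcongr
        · linarith
        · linarith
    _ = _ := by ring

lemma le_radKer {q ε d r ρ : ℝ} (hq0 : 0 ≤ q) (hq : q ≤ n + 1) (hε0 : 0 ≤ ε) (hε : ε < 1)
    (hd : 0 < d) (hr : |r - 1| ≤ ε) (hρ : |ρ - 1| ≤ ε) (hrρ : |r - ρ| ≤ ε * d) :
    ENNReal.ofReal (kapL n ε * d ^ (-q)) ≤ radKer n q d r ρ := by
  rw [abs_le] at hr hρ
  have hr0 : 0 < r := by linarith
  have hρ0 : 0 < ρ := by linarith
  have h1 : 0 < 1 - ε := by linarith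
  unfold radKer kapL
  rw [← ENNReal.ofReal_mul (by positivity), ← ENNReal.ofReal_mul (by positivity)]
  apply ENNReal.ofReal_le_ofReal
  have h2 : ((1 + 2 * ε) ^ (n + 1))⁻¹ * d ^ (-q) ≤ ((r - ρ) ^ 2 + r * ρ * d ^ 2) ^ (-q / 2) := by
    calc ((1 + 2 * ε) ^ (n + 1))⁻¹ * d ^ (-q) = (1 + 2 * ε) ^ (-((n + 1 : ℕ) : ℝ)) * d ^ (-q) := by
          rw [Real.rpow_neg (by positivity : 0 ≤ 1 + 2 * ε), Real.rpow_natCast]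
      _ ≤ (1 + 2 * ε) ^ (-q) * d ^ (-q) := by
          gcongr ?_ * _
          apply Real.rpow_le_rpow_of_exponent_le (by linarith)
          push_cast; linarith
      _ = ((1 + 2 * ε) ^ 2 * d ^ 2) ^ (-q / 2) := (rpow_sq_mul_sq q (by positivity) hd).symm
      _ ≤ _ := by
          apply Real.rpow_le_rpow_of_nonpos (by positivity)
          · have h3 : (r - ρ) ^ 2 ≤ (ε * d) ^ 2 := sq_le_sq' (abs_le.1 hrρ).1 (abs_le.1 hrρ).2
            have h4 : r * ρ ≤ (1 + ε) ^ 2 := by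
              rw [sq]; apply mul_le_mul <;> linarith
            have h5 : r * ρ * d ^ 2 ≤ (1 + ε) ^ 2 * d ^ 2 := by gcongr
            nlinarith [sq_nonneg d, mul_nonneg hε0 (sq_nonneg d), mul_nonneg (sq_nonneg ε) (sq_nonneg d)]
          · linarith
  calc ((1 - ε) ^ (n - 1)) ^ 2 * ((1 + 2 * ε) ^ (n + 1))⁻¹ * d ^ (-q) =
      (1 - ε) ^ (n - 1) * ((1 - ε) ^ (n - 1) * (((1 + 2 * ε) ^ (n + 1))⁻¹ * d ^ (-q))) := by ring
    _ ≤ _ := by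
        gcongr
        · linarith
        · linarith

lemma mem_Ico_min_max {a b r : ℝ} (h : r ∈ Set.Ico (min a b) (max a b)) {ε : ℝ}
    (ha : |a - 1| ≤ ε) (hb : |b - 1| ≤ ε) : |r - 1| ≤ ε := by
  rw [abs_le] at ha hb ⊢
  have h1 := h.1
  have h2 := h.2
  rw [min_le_iff] at h1
  rw [lt_max_iff] at h2
  constructor
  · rcases h1 with h1 | h1 <;> linarith
  · rcases h2 with h2 | h2 <;> linarith

lemma abs_sub_le_of_mem_Ico_min_max {a b r ρ : ℝ} (h : r ∈ Set.Ico (min a b) (max a b))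
    (h' : ρ ∈ Set.Ico (min a b) (max a b)) : |r - ρ| ≤ |a - b| := by
  rw [← max_sub_min_eq_abs' a b, abs_le]
  constructor <;> linarith [h.1, h.2, h'.1, h'.2]

lemma lintegral_Ico_min_max_const (a b : ℝ) {c : ℝ} (hc : 0 ≤ c) :
    ∫⁻ _ in Set.Ico (min a b) (max a b), ∫⁻ _ in Set.Ico (min a b) (max a b), ENNReal.ofReal c =
      ENNReal.ofReal (c * (a - b) ^ 2) := by
  simp only [lintegral_const, Measure.restrict_apply_univ, Real.volume_Ico, max_sub_min_eq_abs']
  rw [← ENNReal.ofReal_mul hc, ← ENNReal.ofReal_mul (by positivity), mul_assoc, abs_mul_abs_self]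
  congr 1; ring

lemma radJ_le {q ε d a b : ℝ} (hq0 : 0 ≤ q) (hq : q ≤ n + 1) (hε0 : 0 ≤ ε) (hε : ε < 1)
    (hd : 0 < d) (ha : |a - 1| ≤ ε) (hb : |b - 1| ≤ ε) :
    radJ n q d (Set.Ico (min a b) (max a b)) (Set.Ico (min a b) (max a b)) ≤
      ENNReal.ofReal (kapU n ε) * ENNReal.ofReal ((a - b) ^ 2 * d ^ (-q)) := by
  have hk : 0 ≤ kapU n ε := by
    have : 0 < 1 - ε := by linarith
    unfold kapU; positivity
  have hk' : 0 ≤ kapU n ε * d ^ (-q) := mul_nonneg hk (by positivity)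
  unfold radJ
  calc _ ≤ ∫⁻ _ in Set.Ico (min a b) (max a b), ∫⁻ _ in Set.Ico (min a b) (max a b),
        ENNReal.ofReal (kapU n ε * d ^ (-q)) := by
        refine setLIntegral_mono' measurableSet_Ico fun r hr => ?_
        refine setLIntegral_mono' measurableSet_Ico fun ρ hρ => ?_
        exact radKer_le hq0 hq hε0 hε hd (mem_Ico_min_max hr ha hb) (mem_Ico_min_max hρ ha hb)
    _ = _ := by
      rw [lintegral_Ico_min_max_const _ _ hk', ← ENNReal.ofReal_mul hk]
      congr 1; ring

lemma le_radJ {q ε d a b : ℝ} (hq0 : 0 ≤ q) (hq : q ≤ n + 1) (hε0 : 0 ≤ ε) (hε : ε < 1)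
    (hd : 0 < d) (ha : |a - 1| ≤ ε) (hb : |b - 1| ≤ ε) (hab : |a - b| ≤ ε * d) :
    ENNReal.ofReal (kapL n ε) * ENNReal.ofReal ((a - b) ^ 2 * d ^ (-q)) ≤
      radJ n q d (Set.Ico (min a b) (max a b)) (Set.Ico (min a b) (max a b)) := by
  have hk : 0 ≤ kapL n ε := by
    have : 0 < 1 - ε := by linarith
    unfold kapL; positivity
  have hk' : 0 ≤ kapL n ε * d ^ (-q) := mul_nonneg hk (by positivity)
  unfold radJ
  calc _ = ∫⁻ _ in Set.Ico (min a b) (max a b), ∫⁻ _ in Set.Ico (min a b) (max a b),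
        ENNReal.ofReal (kapL n ε * d ^ (-q)) := by
        rw [lintegral_Ico_min_max_const _ _ hk', ← ENNReal.ofReal_mul hk]
        congr 1; ring
    _ ≤ _ := by
        refine setLIntegral_mono' measurableSet_Ico fun r hr => ?_
        refine setLIntegral_mono' measurableSet_Ico fun ρ hρ => ?_
        exact le_radKer hq0 hq hε0 hε hd (mem_Ico_min_max hr ha hb) (mem_Ico_min_max hρ ha hb)
          ((abs_sub_le_of_mem_Ico_min_max hr hρ).trans hab)

/-- The quadratic remainder in the polar formula of the perimeter. -/
noncomputable def radQ (q : ℝ) (R : Sph n → ℝ) : ℝ≥0∞ :=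
  ∫⁻ z : Sph n × Sph n, radJ n q ‖(z.1 : Eucl n) - z.2‖
    (Set.Ico (min (R z.1) (R z.2)) (max (R z.1) (R z.2)))
    (Set.Ico (min (R z.1) (R z.2)) (max (R z.1) (R z.2))) ∂((surf n).prod (surf n))

lemma radQ_le {q ε : ℝ} (hq0 : 0 ≤ q) (hq : q ≤ n + 1) (hε0 : 0 ≤ ε) (hε : ε < 1)
    {u : Sph n → ℝ} (hu : ∀ x, |u x| ≤ ε) :
    radQ q (fun x => 1 + u x) ≤ ENNReal.ofReal (kapU n ε) * rieszD q u := by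
  unfold radQ rieszD
  rw [← lintegral_const_mul' _ _ ENNReal.ofReal_ne_top]
  refine lintegral_mono fun z => ?_
  by_cases h : z.1 = z.2
  · simp [h, radJ]
  · have hd : 0 < ‖(z.1 : Eucl n) - z.2‖ :=
      norm_pos_iff.2 (sub_ne_zero.2 fun h' => h (Subtype.ext h'))
    refine (radJ_le hq0 hq hε0 hε hd (by simpa using hu z.1) (by simpa using hu z.2)).trans ?_
    rw [add_sub_add_left_eq_sub]

lemma le_radQ {q ε : ℝ} (hq0 : 0 ≤ q) (hq : q ≤ n + 1) (hε0 : 0 ≤ ε) (hε : ε < 1)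
    {u : Sph n → ℝ} (hu : ∀ x, |u x| ≤ ε)
    (hL : ∀ x y : Sph n, |u x - u y| ≤ ε * ‖(x : Eucl n) - y‖) :
    ENNReal.ofReal (kapL n ε) * rieszD q u ≤ radQ q (fun x => 1 + u x) := by
  unfold radQ rieszD
  rw [← lintegral_const_mul' _ _ ENNReal.ofReal_ne_top]
  refine lintegral_mono fun z => ?_
  by_cases h : z.1 = z.2
  · simp [h, radJ]
  · have hd : 0 < ‖(z.1 : Eucl n) - z.2‖ :=
      norm_pos_iff.2 (sub_ne_zero.2 fun h' => h (Subtype.ext h'))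
    refine le_trans (le_of_eq ?_) (le_radJ hq0 hq hε0 hε hd (by simpa using hu z.1)
      (by simpa using hu z.2) (by simpa using hL z.1 z.2))
    rw [add_sub_add_left_eq_sub]

lemma rieszD_le_rieszL (q : ℝ) {L : ℝ} {v : Sph n → ℝ}
    (hL : ∀ x y : Sph n, |v x - v y| ≤ L * ‖(x : Eucl n) - y‖) :
    rieszD q v ≤ ENNReal.ofReal (L ^ 2) * rieszL n q := by
  unfold rieszD rieszL
  rw [← lintegral_const_mul' _ _ ENNReal.ofReal_ne_top]
  refine lintegral_mono fun z => ?_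
  rw [← ENNReal.ofReal_mul (by positivity), ← mul_assoc, ← mul_pow]
  apply ENNReal.ofReal_le_ofReal
  gcongr ?_ * _
  have := hL z.1 z.2
  exact sq_le_sq' (abs_le.1 this).1 (abs_le.1 this).2

lemma rieszD_le_of_abs_le (q : ℝ) {L : ℝ} {v w : Sph n → ℝ}
    (hL : ∀ x y : Sph n, |v x - v y| ≤ L * |w x - w y|) :
    rieszD q v ≤ ENNReal.ofReal (L ^ 2) * rieszD q w := by
  unfold rieszD
  rw [← lintegral_const_mul' _ _ ENNReal.ofReal_ne_top]
  refine lintegral_mono fun z => ?_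
  rw [← ENNReal.ofReal_mul (by positivity), ← mul_assoc]
  apply ENNReal.ofReal_le_ofReal
  gcongr ?_ * _
  rw [← sq_abs (w z.1 - w z.2), ← mul_pow]
  have := hL z.1 z.2
  exact sq_le_sq' (abs_le.1 this).1 (abs_le.1 this).2

end RadialBounds

section BallPerimeter

variable {n : ℕ}

lemma fracPer_congr_ae (s : ℝ) {A B : Set (Eucl n)} (h : A =ᵐ[volume] B) :
    fracPer n s A = fracPer n s B := by
  unfold fracPer
  rw [setLIntegral_congr h]
  exact lintegral_congr fun x => setLIntegral_congr h.compl

lemma lintegral_rpow_compl_ball (hn : 1 ≤ n) {s ρ : ℝ} (hs : 0 < s) (hρ : 0 < ρ) :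
    ∫⁻ w in (ball (0 : Eucl n) ρ)ᶜ, ENNReal.ofReal (‖w‖ ^ (-((n : ℝ) + s))) =
      surf n Set.univ * ENNReal.ofReal (ρ ^ (-s) / s) := by
  have hm : Measurable fun w : Eucl n => ENNReal.ofReal (‖w‖ ^ (-((n : ℝ) + s))) := by fun_prop
  rw [← lintegral_indicator measurableSet_ball.compl, lintegral_polar' hn _
    (hm.indicator measurableSet_ball.compl), mul_comm, ← lintegral_const]
  refine lintegral_congr fun x => ?_
  have h1 : Set.Ici ρ = Set.Ici ρ ∩ Set.Ioi 0 := by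
    ext r
    simp only [Set.mem_Ici, Set.mem_inter_iff, Set.mem_Ioi]
    exact ⟨fun h => ⟨h, hρ.trans_le h⟩, fun h => h.1⟩
  have h2 : ∫⁻ r in Set.Ioi (0 : ℝ), ENNReal.ofReal (r ^ (n - 1)) *
      (ball (0 : Eucl n) ρ)ᶜ.indicator (fun w => ENNReal.ofReal (‖w‖ ^ (-((n : ℝ) + s))))
        (r • (x : Eucl n)) = ∫⁻ r in Set.Ici ρ, ENNReal.ofReal (r ^ (-s - 1)) := by
    rw [h1, ← Measure.restrict_restrict measurableSet_Ici, ← lintegral_indicator measurableSet_Ici]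
    refine setLIntegral_congr_fun measurableSet_Ioi fun r hr => ?_
    have hr : 0 < r := hr
    have e : ‖r • (x : Eucl n)‖ = r := by
      rw [norm_smul, Sph.norm_eq, mul_one, Real.norm_of_nonneg hr.le]
    by_cases h : ρ ≤ r
    · rw [Set.indicator_of_mem (show r ∈ Set.Ici ρ from h), Set.indicator_of_mem
        (by rw [Set.mem_compl_iff, mem_ball_zero_iff, e]; exact not_lt.2 h), e,
        ← ENNReal.ofReal_mul (by positivity)]
      congr 1
      rw [← Real.rpow_natCast, ← Real.rpow_add hr, Nat.cast_sub hn]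
      congr 1; push_cast; ring
    · rw [Set.indicator_of_notMem (show r ∉ Set.Ici ρ from h), Set.indicator_of_notMem
        (by rw [Set.mem_compl_iff, mem_ball_zero_iff, e]; simpa using h), mul_zero]
  rw [h2, setLIntegral_congr Ioi_ae_eq_Ici.symm,
    ← ofReal_integral_eq_lintegral_ofReal (integrableOn_Ioi_rpow_of_lt (by linarith) hρ),
    integral_Ioi_rpow_of_lt (by linarith) hρ]
  · congr 1
    rw [show -s - 1 + 1 = -s by ring, neg_div_neg_eq]
  · refine (ae_restrict_iff' measurableSet_Ioi).2 (Filter.Eventually.of_forall fun r hr => ?_)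
    exact Real.rpow_nonneg (hρ.trans hr).le _

lemma lintegral_Ioo_one_sub_rpow {s : ℝ} (hs1 : s < 1) :
    ∫⁻ r in Set.Ioo (0 : ℝ) 1, ENNReal.ofReal ((1 - r) ^ (-s)) = ENNReal.ofReal (1 / (1 - s)) := by
  have h := (Measure.measurePreserving_sub_left (volume : Measure ℝ) 1).setLIntegral_comp_emb
    (MeasurableEquiv.subLeft (1 : ℝ)).measurableEmbedding
    (fun r => ENNReal.ofReal (r ^ (-s))) (Set.Ioo 0 1)
  rw [Set.image_const_sub_Ioo] at h
  simp only [sub_self, sub_zero] at h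
  rw [← lintegral_Ioc_rpow_neg hs1, ← setLIntegral_congr Ioo_ae_eq_Ioc, h]

lemma fracPer_ball_le (hn : 1 ≤ n) {s : ℝ} (hs0 : 0 < s) (hs1 : s < 1) :
    fracPer n s (ball 0 1) ≤
      ENNReal.ofReal ((surf n).real Set.univ ^ 2 / (s * (1 - s))) := by
  have h1s : 0 < 1 - s := by linarith
  obtain ⟨S, hS0, hSE⟩ : ∃ S : ℝ, (surf n).real Set.univ = S ∧ surf n Set.univ = ENNReal.ofReal S :=
    ⟨_, rfl, (ENNReal.ofReal_toReal (measure_ne_top _ _)).symm⟩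
  have hSn : 0 ≤ S := hS0 ▸ measureReal_nonneg
  rw [hS0]
  have hin : ∀ x ∈ ball (0 : Eucl n) 1, ∫⁻ y in (ball (0 : Eucl n) 1)ᶜ,
      ENNReal.ofReal (‖x - y‖ ^ (-((n : ℝ) + s))) ≤
      ENNReal.ofReal (S / s) * ENNReal.ofReal ((1 - ‖x‖) ^ (-s)) := by
    intro x hx
    rw [mem_ball_zero_iff] at hx
    have hx' : 0 < 1 - ‖x‖ := by linarith
    have h := (Measure.measurePreserving_sub_left (volume : Measure (Eucl n)) x).setLIntegral_comp_preimage_emb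
      (MeasurableEquiv.subLeft x).measurableEmbedding
      (fun w : Eucl n => ENNReal.ofReal (‖w‖ ^ (-((n : ℝ) + s)))) (ball (0 : Eucl n) (1 - ‖x‖))ᶜ
    rw [lintegral_rpow_compl_ball hn hs0 hx', hSE] at h
    calc _ ≤ ∫⁻ y in (fun y => x - y) ⁻¹' (ball (0 : Eucl n) (1 - ‖x‖))ᶜ,
          ENNReal.ofReal (‖x - y‖ ^ (-((n : ℝ) + s))) := by
          refine lintegral_mono_set fun y hy => ?_
          simp only [Set.mem_compl_iff, mem_ball_zero_iff, not_lt, Set.mem_preimage] at hy ⊢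
          have := norm_sub_norm_le y x
          rw [norm_sub_rev] at this
          linarith
      _ = _ := by
          rw [h, ← ENNReal.ofReal_mul hSn, ← ENNReal.ofReal_mul (by positivity)]
          congr 1; ring
  have hm : Measurable fun x : Eucl n => ENNReal.ofReal (S / s) * ENNReal.ofReal ((1 - ‖x‖) ^ (-s)) := by
    fun_prop
  unfold fracPer
  refine (setLIntegral_mono' measurableSet_ball hin).trans ?_
  rw [← lintegral_indicator measurableSet_ball, lintegral_polar' hn _
    (hm.indicator measurableSet_ball)]
  have hray : ∀ x : Sph n, ∫⁻ r in Set.Ioi (0 : ℝ), ENNReal.ofReal (r ^ (n - 1)) *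
      (ball (0 : Eucl n) 1).indicator
        (fun x => ENNReal.ofReal (S / s) * ENNReal.ofReal ((1 - ‖x‖) ^ (-s))) (r • (x : Eucl n)) ≤
      ENNReal.ofReal (S / s * (1 / (1 - s))) := by
    intro x
    rw [ENNReal.ofReal_mul (by positivity), ← lintegral_Ioo_one_sub_rpow hs1,
      ← lintegral_const_mul' _ _ ENNReal.ofReal_ne_top]
    have h1 : Set.Ioo (0 : ℝ) 1 = Set.Iio 1 ∩ Set.Ioi 0 := by
      ext r; simp [and_comm]
    rw [h1, ← Measure.restrict_restrict measurableSet_Iio, ← lintegral_indicator measurableSet_Iio]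
    refine setLIntegral_mono' measurableSet_Ioi fun r hr => ?_
    have hr : 0 < r := hr
    have e : ‖r • (x : Eucl n)‖ = r := by
      rw [norm_smul, Sph.norm_eq, mul_one, Real.norm_of_nonneg hr.le]
    by_cases h : r < 1
    · rw [Set.indicator_of_mem (show r ∈ Set.Iio (1 : ℝ) from h), Set.indicator_of_mem
        (by rw [mem_ball_zero_iff, e]; exact h), e]
      refine mul_le_of_le_one_left zero_le ?_
      rw [ENNReal.ofReal_le_one]
      exact pow_le_one₀ hr.le h.le
    · rw [Set.indicator_of_notMem (show r • (x : Eucl n) ∉ ball (0 : Eucl n) 1 by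
        rw [mem_ball_zero_iff, e]; exact h), mul_zero]
      exact zero_le
  refine (lintegral_mono hray).trans (le_of_eq ?_)
  rw [lintegral_const, hSE, ← ENNReal.ofReal_mul (by positivity)]
  congr 1
  field_simp

end BallPerimeter

section PowerBounds

lemma nonneg_of_second_deriv_nonneg {f f' f'' : ℝ → ℝ} {δ : ℝ} (hδ : 0 ≤ δ)
    (h1 : ∀ w ∈ Set.Icc (-δ) δ, HasDerivAt f (f' w) w)
    (h2 : ∀ w ∈ Set.Icc (-δ) δ, HasDerivAt f' (f'' w) w)
    (h3 : ∀ w ∈ Set.Icc (-δ) δ, 0 ≤ f'' w) (hf : f 0 = 0) (hf' : f' 0 = 0) :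
    ∀ w ∈ Set.Icc (-δ) δ, 0 ≤ f w := by
  have h0 : (0 : ℝ) ∈ Set.Icc (-δ) δ := ⟨by linarith, hδ⟩
  have hmono : MonotoneOn f' (Set.Icc (-δ) δ) := by
    refine monotoneOn_of_deriv_nonneg (convex_Icc _ _)
      (fun w hw => (h2 w hw).continuousAt.continuousWithinAt)
      (fun w hw => (h2 w (interior_subset hw)).differentiableAt.differentiableWithinAt)
      (fun w hw => ?_)
    rw [(h2 w (interior_subset hw)).deriv]
    exact h3 w (interior_subset hw)
  intro w hw
  rcases le_total 0 w with h | h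
  · have hs : Set.Icc 0 δ ⊆ Set.Icc (-δ) δ := Set.Icc_subset_Icc_left (by linarith)
    have : MonotoneOn f (Set.Icc 0 δ) := by
      refine monotoneOn_of_deriv_nonneg (convex_Icc _ _)
        (fun w hw => (h1 w (hs hw)).continuousAt.continuousWithinAt)
        (fun w hw => (h1 w (hs (interior_subset hw))).differentiableAt.differentiableWithinAt)
        (fun w hw => ?_)
      have hw' := interior_subset hw
      rw [(h1 w (hs hw')).deriv, ← hf']
      exact hmono h0 (hs hw') hw'.1
    rw [← hf]
    exact this ⟨le_rfl, hδ⟩ ⟨h, hw.2⟩ h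
  · have hs : Set.Icc (-δ) 0 ⊆ Set.Icc (-δ) δ := Set.Icc_subset_Icc_right hδ
    have : AntitoneOn f (Set.Icc (-δ) 0) := by
      refine antitoneOn_of_deriv_nonpos (convex_Icc _ _)
        (fun w hw => (h1 w (hs hw)).continuousAt.continuousWithinAt)
        (fun w hw => (h1 w (hs (interior_subset hw))).differentiableAt.differentiableWithinAt)
        (fun w hw => ?_)
      have hw' := interior_subset hw
      rw [(h1 w (hs hw')).deriv, ← hf']
      exact hmono (hs hw') h0 hw'.2
    rw [← hf]
    exact this ⟨hw.1, h⟩ ⟨by linarith, le_rfl⟩ h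

lemma one_add_rpow_bounds {α δ w : ℝ} (hα0 : 0 ≤ α) (hα1 : α ≤ 1) (hδ0 : 0 ≤ δ) (hδ1 : δ < 1)
    (hw : |w| ≤ δ) :
    1 + α * w - α * (1 - α) / 2 * ((1 - δ) ^ 2)⁻¹ * w ^ 2 ≤ (1 + w) ^ α ∧
      (1 + w) ^ α ≤ 1 + α * w - α * (1 - α) / 2 * ((1 + δ) ^ 2)⁻¹ * w ^ 2 := by
  have hb : ∀ t ∈ Set.Icc (-δ) δ, ((1 + δ) ^ 2)⁻¹ ≤ (1 + t) ^ (α - 2) ∧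
      (1 + t) ^ (α - 2) ≤ ((1 - δ) ^ 2)⁻¹ := by
    intro t ht
    have h1 : 0 < 1 - δ := by linarith
    have ht1 : 1 - δ ≤ 1 + t := by linarith [ht.1]
    have ht2 : 1 + t ≤ 1 + δ := by linarith [ht.2]
    have ht0 : 0 < 1 + t := h1.trans_le ht1
    have e : ∀ c : ℝ, 0 < c → (c ^ 2)⁻¹ = c ^ (-2 : ℝ) := fun c hc => by
      rw [Real.rpow_neg hc.le, Real.rpow_two]
    constructor
    · rw [e _ (by linarith)]
      exact (Real.rpow_le_rpow_of_exponent_le (by linarith) (by linarith)).trans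
        (Real.rpow_le_rpow_of_nonpos ht0 ht2 (by linarith))
    · rw [e _ h1]
      exact (Real.rpow_le_rpow_of_nonpos h1 ht1 (by linarith)).trans
        (Real.rpow_le_rpow_of_exponent_ge h1 (by linarith) (by linarith))
  have hd1 : ∀ k : ℝ, ∀ t ∈ Set.Icc (-δ) δ, HasDerivAt
      (fun t => (1 + t) ^ α - 1 - α * t + k * t ^ 2)
      (α * (1 + t) ^ (α - 1) - α + 2 * k * t) t := by
    intro k t ht
    have ht0 : 0 < 1 + t := by linarith [ht.1]
    have := ((((hasDerivAt_id' t).const_add 1).rpow_const (p := α) (Or.inl ht0.ne')).sub_const 1).sub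
      ((hasDerivAt_id' t).const_mul α)
    have := this.add (((hasDerivAt_id' t).pow 2).const_mul k)
    exact this.congr_deriv (by simp; ring)
  have hd2 : ∀ k : ℝ, ∀ t ∈ Set.Icc (-δ) δ, HasDerivAt
      (fun t => α * (1 + t) ^ (α - 1) - α + 2 * k * t)
      (α * ((α - 1) * (1 + t) ^ (α - 2)) + 2 * k) t := by
    intro k t ht
    have ht0 : 0 < 1 + t := by linarith [ht.1]
    have := (((((hasDerivAt_id' t).const_add 1).rpow_const (p := α - 1)
      (Or.inl ht0.ne')).const_mul α).sub_const α).add ((hasDerivAt_id' t).const_mul (2 * k))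
    exact this.congr_deriv (by rw [show α - 1 - 1 = α - 2 by ring]; ring)
  have hα : 0 ≤ α * (1 - α) := mul_nonneg hα0 (by linarith)
  have hw' : w ∈ Set.Icc (-δ) δ := abs_le.1 hw
  constructor
  · have := nonneg_of_second_deriv_nonneg hδ0 (hd1 (α * (1 - α) / 2 * ((1 - δ) ^ 2)⁻¹))
      (hd2 _) (fun t ht => ?_) (by simp) (by simp) w hw'
    · linarith
    · have := mul_le_mul_of_nonneg_left (hb t ht).2 hα
      linarith
  · have := nonneg_of_second_deriv_nonneg hδ0
      (fun t ht => (hd1 (α * (1 - α) / 2 * ((1 + δ) ^ 2)⁻¹) t ht).neg)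
      (fun t ht => (hd2 (α * (1 - α) / 2 * ((1 + δ) ^ 2)⁻¹) t ht).neg)
      (fun t ht => ?_) (by simp) (by simp) w hw'
    · simp only [Pi.neg_apply] at this
      linarith
    · have := mul_le_mul_of_nonneg_left (hb t ht).1 hα
      linarith

lemma abs_one_add_pow_sub_le (k : ℕ) {u : ℝ} (hu : |u| ≤ 1) :
    |(1 + u) ^ k - 1 - k * u| ≤ 4 ^ k * u ^ 2 := by
  induction k with
  | zero => simp; positivity
  | succ k ih =>
    have e : (1 + u) ^ (k + 1) - 1 - ((k + 1 : ℕ) : ℝ) * u =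
        (1 + u) * ((1 + u) ^ k - 1 - k * u) + k * u ^ 2 := by push_cast; ring
    have h1 : |1 + u| ≤ 2 := by
      rw [abs_le] at hu ⊢; constructor <;> linarith
    have h2 : (k : ℝ) ≤ 4 ^ k := by
      exact_mod_cast (Nat.lt_pow_self (by norm_num : 1 < 4)).le
    rw [e]
    calc _ ≤ |1 + u| * |(1 + u) ^ k - 1 - k * u| + |k * u ^ 2| := by
          rw [← abs_mul]; exact abs_add_le _ _
      _ ≤ 2 * (4 ^ k * u ^ 2) + 4 ^ k * u ^ 2 := by
          rw [abs_of_nonneg (by positivity : 0 ≤ (k : ℝ) * u ^ 2)]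
          gcongr
      _ ≤ _ := by
          rw [pow_succ (4 : ℝ) k]
          linarith [mul_nonneg (pow_pos (by norm_num : (0 : ℝ) < 4) k).le (sq_nonneg u)]

end PowerBounds

section PolarVolume

variable {n : ℕ}

lemma ae_eq_polarSet (hn : 1 ≤ n) {A : Set (Eucl n)} {R : Sph n → ℝ}
    (h : ∀ (x : Sph n) (r : ℝ), 0 < r → (r • (x : Eucl n) ∈ A ↔ r < R x)) :
    A =ᵐ[volume] polarSet R := by
  have : Nonempty (Fin n) := ⟨⟨0, hn⟩⟩
  have h0 : ∀ᵐ z : Eucl n, z ≠ 0 := by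
    rw [ae_iff]
    simp
  filter_upwards [h0] with z hz
  have hz' : 0 < ‖z‖ := norm_pos_iff.2 hz
  have e : z = ‖z‖ • (((⟨‖z‖⁻¹ • z, by simp [norm_smul, hz]⟩ : Sph n)) : Eucl n) := by
    simp [smul_smul, hz]
  apply propext
  change z ∈ A ↔ z ∈ polarSet R
  rw [e, h _ _ hz', smul_mem_polarSet hz']

lemma ball_ae_eq_polarSet (hn : 1 ≤ n) :
    ball (0 : Eucl n) 1 =ᵐ[volume] polarSet (fun _ : Sph n => 1 + 0) := by
  refine ae_eq_polarSet hn fun x r hr => ?_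
  rw [mem_ball_zero_iff, norm_smul, Sph.norm_eq, mul_one, Real.norm_of_nonneg hr.le, add_zero]

lemma lintegral_Ioo_pow (k : ℕ) {a : ℝ} (ha : 0 ≤ a) :
    ∫⁻ r in Set.Ioo 0 a, ENNReal.ofReal (r ^ k) = ENNReal.ofReal (a ^ (k + 1) / (k + 1)) := by
  rw [setLIntegral_congr Ioo_ae_eq_Ioc, ← ofReal_integral_eq_lintegral_ofReal,
    ← intervalIntegral.integral_of_le ha, integral_pow]
  · simp
  · exact (continuous_pow k).integrableOn_Ioc
  · refine (ae_restrict_iff' measurableSet_Ioc).2 (Filter.Eventually.of_forall fun r hr => ?_)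
    exact pow_nonneg hr.1.le _

lemma volume_polarSet (hn : 1 ≤ n) {R : Sph n → ℝ} (hR : Continuous R) (hpos : ∀ x, 0 < R x) :
    volume (polarSet R) = ENNReal.ofReal ((∫ x, R x ^ n ∂(surf n)) / n) := by
  rw [← setLIntegral_one, setLIntegral_polarSet hn hR.measurable measurable_const,
    ← integral_div, ofReal_integral_eq_lintegral_ofReal]
  · refine lintegral_congr fun x => ?_
    simp only [mul_one]
    rw [lintegral_Ioo_pow _ (hpos x).le, Nat.sub_add_cancel hn, Nat.cast_sub hn]
    simp
  · exact integrable_of_continuous_sph ((hR.pow n).div_const _)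
  · exact Filter.Eventually.of_forall fun x => div_nonneg (pow_nonneg (hpos x).le _) (by positivity)

lemma integral_pow_of_volume_eq (hn : 1 ≤ n) {A : Set (Eucl n)} {R : Sph n → ℝ}
    (hR : Continuous R) (hpos : ∀ x, 0 < R x) (hA : A =ᵐ[volume] polarSet R)
    (hvol : volume A = volume (ball (0 : Eucl n) 1)) :
    ∫ x, R x ^ n ∂(surf n) = (surf n).real Set.univ := by
  have hn' : (0 : ℝ) < n := by exact_mod_cast hn
  rw [measure_congr hA, measure_congr (ball_ae_eq_polarSet hn), volume_polarSet hn hR hpos,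
    volume_polarSet hn continuous_const (by simp)] at hvol
  rw [ENNReal.ofReal_eq_ofReal_iff] at hvol
  · rw [div_left_inj' hn'.ne'] at hvol
    rw [hvol]; simp
  · exact div_nonneg (integral_nonneg fun x => pow_nonneg (hpos x).le _) hn'.le
  · exact div_nonneg (integral_nonneg fun x => by simp) hn'.le

/-- Polar formula for the perimeter in terms of the radial perturbation. -/
lemma exists_fracPer_formula_real (hn : 1 ≤ n) {s : ℝ} (hs0 : 0 < s) (hs1 : s < 1) :
    ∃ g : ℝ, 0 ≤ g ∧ (fracPer n s (ball 0 1)).toReal = g * (surf n).real Set.univ ∧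
      ∀ u : Sph n → ℝ, Continuous u → (∀ x, |u x| < 1) →
        radQ (n + s) (fun x => 1 + u x) ≠ ⊤ →
        (fracPer n s (polarSet fun x => 1 + u x)).toReal =
          g * ∫ x, (1 + u x) ^ ((n : ℝ) - s) ∂(surf n) +
            (radQ (n + s) (fun x => 1 + u x)).toReal / 2 := by
  obtain ⟨g, hg⟩ := exists_fracPer_formula hn s
  have hS := surf_univ_pos hn
  have hSE : surf n Set.univ = ENNReal.ofReal ((surf n).real Set.univ) :=
    (ENNReal.ofReal_toReal (measure_ne_top _ _)).symm
  have hB := hg (fun _ => 1 + 0) measurable_const (by simp)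
  rw [← fracPer_congr_ae s (ball_ae_eq_polarSet hn)] at hB
  simp only [add_zero, Real.one_rpow, min_self, max_self, Set.Ico_self, radJ,
    Measure.restrict_empty, lintegral_zero_measure, lintegral_zero, ENNReal.ofReal_one,
    lintegral_one] at hB
  have hfin : fracPer n s (ball 0 1) ≠ ⊤ :=
    ne_top_of_le_ne_top ENNReal.ofReal_ne_top (fracPer_ball_le hn hs0 hs1)
  have hB' : fracPer n s (ball 0 1) = surf n Set.univ * g := by
    rw [mul_assoc] at hB
    exact (ENNReal.mul_right_inj (by simp) (by simp)).1 hB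
  have hgt : g ≠ ⊤ := by
    intro h
    rw [h, ENNReal.mul_top] at hB'
    · exact hfin hB'
    · rw [hSE]; exact (ENNReal.ofReal_pos.2 hS).ne'
  refine ⟨g.toReal, ENNReal.toReal_nonneg, ?_, fun u hu hu1 hQ => ?_⟩
  · rw [hB', ENNReal.toReal_mul, mul_comm]; rfl
  · have hpos : ∀ x, 0 < 1 + u x := fun x => by linarith [(abs_lt.1 (hu1 x)).1]
    have h := hg (fun x => 1 + u x) (continuous_const.add hu).measurable hpos
    have hI : ∫⁻ x, ENNReal.ofReal ((1 + u x) ^ ((n : ℝ) - s)) ∂(surf n) =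
        ENNReal.ofReal (∫ x, (1 + u x) ^ ((n : ℝ) - s) ∂(surf n)) := by
      rw [ofReal_integral_eq_lintegral_ofReal]
      · exact integrable_of_continuous_sph
          ((continuous_const.add hu).rpow_const fun x => Or.inl (hpos x).ne')
      · exact Filter.Eventually.of_forall fun x => Real.rpow_nonneg (hpos x).le _
    have hI0 : 0 ≤ ∫ x, (1 + u x) ^ ((n : ℝ) - s) ∂(surf n) :=
      integral_nonneg fun x => Real.rpow_nonneg (hpos x).le _
    change _ = _ + radQ (n + s) (fun x => 1 + u x) at h
    rw [hI] at h
    have h' := congrArg ENNReal.toReal h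
    rw [ENNReal.toReal_add (by finiteness) hQ, ENNReal.toReal_mul, ENNReal.toReal_mul,
      ENNReal.toReal_mul, ENNReal.toReal_ofReal hI0] at h'
    simp only [ENNReal.toReal_ofNat] at h'
    linarith

lemma integral_rpow_bounds (hn : 1 ≤ n) {s δ : ℝ} (hs0 : 0 < s) (hs1 : s < 1) {u : Sph n → ℝ}
    (hu : Continuous u) (hu1 : ∀ x, |u x| < 1) (hδ0 : 0 ≤ δ) (hδ1 : δ < 1)
    (hw : ∀ x, |(1 + u x) ^ n - 1| ≤ δ)
    (hvol : ∫ x, (1 + u x) ^ n ∂(surf n) = (surf n).real Set.univ) :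
    (surf n).real Set.univ - s * (n - s) / (2 * n ^ 2) * ((1 - δ) ^ 2)⁻¹ *
        ∫ x, ((1 + u x) ^ n - 1) ^ 2 ∂(surf n) ≤ ∫ x, (1 + u x) ^ ((n : ℝ) - s) ∂(surf n) ∧
    ∫ x, (1 + u x) ^ ((n : ℝ) - s) ∂(surf n) ≤
      (surf n).real Set.univ - s * (n - s) / (2 * n ^ 2) * ((1 + δ) ^ 2)⁻¹ *
        ∫ x, ((1 + u x) ^ n - 1) ^ 2 ∂(surf n) := by
  have hn1 : (1 : ℝ) ≤ n := by exact_mod_cast hn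
  have hn0 : (0 : ℝ) < n := by linarith
  set α : ℝ := 1 - s / n with hα
  have hsn : s / n ≤ 1 := by rw [div_le_one hn0]; linarith
  have hsn0 : 0 ≤ s / n := by positivity
  have hαα : α * (1 - α) / 2 = s * (n - s) / (2 * n ^ 2) := by
    rw [hα]; field_simp; ring
  have hpos : ∀ x, 0 < 1 + u x := fun x => by linarith [(abs_lt.1 (hu1 x)).1]
  have hpt : ∀ x, (1 + u x) ^ ((n : ℝ) - s) = (1 + ((1 + u x) ^ n - 1)) ^ α := by
    intro x
    rw [add_sub_cancel, ← Real.rpow_natCast, ← Real.rpow_mul (hpos x).le]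
    congr 1
    rw [hα]; field_simp
  have hb := fun x => one_add_rpow_bounds (α := α) (by linarith) (by linarith) hδ0 hδ1 (hw x)
  have i0 : Integrable (fun x => (1 + u x) ^ ((n : ℝ) - s)) (surf n) :=
    integrable_of_continuous_sph
      ((continuous_const.add hu).rpow_const fun x => Or.inl (hpos x).ne')
  have i1 : Integrable (fun x => (1 + u x) ^ n) (surf n) :=
    integrable_of_continuous_sph ((continuous_const.add hu).pow n)
  have i2 : Integrable (fun x => ((1 + u x) ^ n - 1) ^ 2) (surf n) :=
    integrable_of_continuous_sph ((((continuous_const.add hu).pow n).sub continuous_const).pow 2)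
  have hw0 : ∫ x, ((1 + u x) ^ n - 1) ∂(surf n) = 0 := by
    rw [integral_sub i1 (integrable_const _), hvol]; simp
  have i3 : Integrable (fun x => α * ((1 + u x) ^ n - 1)) (surf n) :=
    (i1.sub (integrable_const _)).const_mul α
  have i1' : Integrable (fun x => 1 + α * ((1 + u x) ^ n - 1)) (surf n) :=
    (integrable_const _).add i3
  have hcomp : ∀ c : ℝ, ∫ x, (1 + α * ((1 + u x) ^ n - 1) - c * ((1 + u x) ^ n - 1) ^ 2) ∂(surf n) =
      (surf n).real Set.univ - c * ∫ x, ((1 + u x) ^ n - 1) ^ 2 ∂(surf n) := by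
    intro c
    rw [integral_sub i1' (i2.const_mul c), integral_add (integrable_const _) i3, integral_const_mul, integral_const_mul, hw0]
    simp
  rw [← hαα, ← hcomp, ← hcomp]
  constructor
  · refine integral_mono (i1'.sub (i2.const_mul _)) i0 fun x => ?_
    simp only
    rw [hpt]
    exact (hb x).1
  · refine integral_mono i0 (i1'.sub (i2.const_mul _)) fun x => ?_
    simp only
    rw [hpt]
    exact (hb x).2

end PolarVolume

section Translate

open RealInnerProductSpace Filter Topology

variable {n : ℕ}

lemma fracPer_preimage (s : ℝ) {E : Set (Eucl n)} (hE : MeasurableSet E) (a : Eucl n) :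
    fracPer n s ((fun x => x - a) ⁻¹' E) = fracPer n s E := by
  have hm := measurePreserving_sub_right (volume : Measure (Eucl n)) a
  have he : MeasurableEmbedding (fun x : Eucl n => x - a) :=
    (MeasurableEquiv.subRight a).measurableEmbedding
  unfold fracPer
  rw [← hm.setLIntegral_comp_preimage_emb he _ E]
  refine setLIntegral_congr_fun (hm.measurable hE) fun x hx => ?_
  rw [← hm.setLIntegral_comp_preimage_emb he _ Eᶜ]
  simp

/-- Radial perturbation of the unit sphere describing the unit ball centred at `t • e`. -/
noncomputable def shiftRad (t h : ℝ) : ℝ := t * h + √(1 - t ^ 2 + t ^ 2 * h ^ 2) - 1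

lemma ball_shift_ae_eq (hn : 1 ≤ n) {t : ℝ} (ht : |t| < 1) (e : Sph n) :
    ball (t • (e : Eucl n)) 1 =ᵐ[volume]
      polarSet (fun x : Sph n => 1 + shiftRad t ⟪(x : Eucl n), e⟫) := by
  refine ae_eq_polarSet hn fun x r hr => ?_
  set h : ℝ := ⟪(x : Eucl n), e⟫ with hh
  have ht2 : t ^ 2 < 1 := by rw [← sq_abs]; nlinarith [abs_nonneg t]
  have e1 : ‖r • (x : Eucl n) - t • (e : Eucl n)‖ ^ 2 = (r - t * h) ^ 2 + t ^ 2 - t ^ 2 * h ^ 2 := by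
    rw [norm_sub_sq_real, norm_smul, norm_smul, Sph.norm_eq, Sph.norm_eq, inner_smul_left,
      inner_smul_right, ← hh, mul_one, mul_one, Real.norm_eq_abs, Real.norm_eq_abs, sq_abs, sq_abs]
    simp; ring
  set D : ℝ := 1 - t ^ 2 + t ^ 2 * h ^ 2 with hD
  have hD0 : 0 ≤ D := by nlinarith [mul_nonneg (sq_nonneg t) (sq_nonneg h)]
  have hthD : |t * h| < √D := by
    rw [← Real.sqrt_sq_eq_abs]
    exact Real.sqrt_lt_sqrt (sq_nonneg _) (by nlinarith)
  rw [mem_ball_iff_norm, ← sq_lt_one_iff₀ (norm_nonneg _), e1, shiftRad, ← hD]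
  have : (r - t * h) ^ 2 + t ^ 2 - t ^ 2 * h ^ 2 < 1 ↔ |r - t * h| < √D := by
    rw [Real.lt_sqrt (abs_nonneg _), sq_abs]
    constructor <;> intro h <;> linarith
  rw [this, abs_lt]
  have := abs_lt.1 hthD
  constructor
  · rintro ⟨h1, h2⟩; linarith
  · intro h1; constructor <;> linarith

lemma abs_shiftRad_sub_le {t h : ℝ} (h1 : |h| ≤ 1) (ht : |t| ≤ 1) :
    |shiftRad t h - t * h| ≤ t ^ 2 := by
  have ht2 : t ^ 2 ≤ 1 := by rw [← sq_abs]; nlinarith [abs_nonneg t]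
  have hh2 : h ^ 2 ≤ 1 := by rw [← sq_abs]; nlinarith [abs_nonneg h]
  have hp := mul_nonneg (sq_nonneg t) (sq_nonneg h)
  have hq : t ^ 2 * h ^ 2 ≤ t ^ 2 := by nlinarith [sq_nonneg t]
  have e : shiftRad t h - t * h = √(1 - t ^ 2 + t ^ 2 * h ^ 2) - 1 := by unfold shiftRad; ring
  rw [e, abs_le]
  constructor
  · have : 1 - t ^ 2 ≤ √(1 - t ^ 2 + t ^ 2 * h ^ 2) := by
      apply Real.le_sqrt_of_sq_le; nlinarith [sq_nonneg t]
    linarith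
  · have : √(1 - t ^ 2 + t ^ 2 * h ^ 2) ≤ 1 := by
      rw [Real.sqrt_le_one]; linarith
    nlinarith [sq_nonneg t]

lemma abs_shiftRad_sub_shiftRad_le {t h k : ℝ} (h1 : |h| ≤ 1) (k1 : |k| ≤ 1) (ht0 : 0 ≤ t)
    (ht : t ≤ 1 / 4) : |shiftRad t h - shiftRad t k| ≤ t * (1 + 2 * t) * |h - k| := by
  set A := √(1 - t ^ 2 + t ^ 2 * h ^ 2) with hA
  set B := √(1 - t ^ 2 + t ^ 2 * k ^ 2) with hB
  have ht2 : t ^ 2 ≤ 1 / 16 := by nlinarith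
  have hp := mul_nonneg (sq_nonneg t) (sq_nonneg h)
  have hq := mul_nonneg (sq_nonneg t) (sq_nonneg k)
  have hA2 : 1 / 2 ≤ A := Real.le_sqrt_of_sq_le (by linarith)
  have hB2 : 1 / 2 ≤ B := Real.le_sqrt_of_sq_le (by linarith)
  have hAs : A ^ 2 = 1 - t ^ 2 + t ^ 2 * h ^ 2 := Real.sq_sqrt (by linarith)
  have hBs : B ^ 2 = 1 - t ^ 2 + t ^ 2 * k ^ 2 := Real.sq_sqrt (by linarith)
  have key : |A - B| ≤ 2 * t ^ 2 * |h - k| := by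
    have e : (A - B) * (A + B) = t ^ 2 * ((h - k) * (h + k)) := by nlinarith
    have e' : |A - B| * (A + B) = t ^ 2 * (|h - k| * |h + k|) := by
      rw [← abs_of_pos (by linarith : 0 < A + B), ← abs_mul, e, abs_mul, abs_mul,
        abs_of_nonneg (sq_nonneg t)]
    have h2 : |h + k| ≤ 2 := (abs_add_le _ _).trans (by linarith)
    calc |A - B| ≤ |A - B| * (A + B) := le_mul_of_one_le_right (abs_nonneg _) (by linarith)
      _ = t ^ 2 * (|h - k| * |h + k|) := e'
      _ ≤ t ^ 2 * (|h - k| * 2) := by gcongr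
      _ = _ := by ring
  have e : shiftRad t h - shiftRad t k = t * (h - k) + (A - B) := by unfold shiftRad; ring
  rw [e]
  calc _ ≤ |t * (h - k)| + |A - B| := abs_add_le _ _
    _ ≤ t * |h - k| + 2 * t ^ 2 * |h - k| := by
        rw [abs_mul, abs_of_nonneg ht0]; linarith
    _ = _ := by ring

lemma continuous_shiftRad (t : ℝ) : Continuous (shiftRad t) := by
  unfold shiftRad; fun_prop

lemma abs_shiftRad_pow_sub_le (k : ℕ) {t h : ℝ} (h1 : |h| ≤ 1) (ht0 : 0 ≤ t)
    (ht : t ≤ 1 / 4) : |(1 + shiftRad t h) ^ k - 1 - k * (t * h)| ≤ (k + 4 ^ (k + 1)) * t ^ 2 := by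
  have a1 := abs_shiftRad_sub_le h1 (by rw [abs_of_nonneg ht0]; linarith : |t| ≤ 1)
  have a2 : |shiftRad t h| ≤ 2 * t := by
    have : |t * h| ≤ t := by
      rw [abs_mul, abs_of_nonneg ht0]; nlinarith [abs_nonneg h]
    have h3 := abs_add_le (shiftRad t h - t * h) (t * h)
    rw [sub_add_cancel] at h3
    nlinarith
  have a3 := abs_one_add_pow_sub_le k (u := shiftRad t h) (by linarith)
  have a4 : shiftRad t h ^ 2 ≤ 4 * t ^ 2 := by
    rw [← sq_abs]; nlinarith [abs_nonneg (shiftRad t h)]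
  calc _ = |((1 + shiftRad t h) ^ k - 1 - k * shiftRad t h) + k * (shiftRad t h - t * h)| := by
        congr 1; ring
    _ ≤ 4 ^ k * shiftRad t h ^ 2 + k * t ^ 2 := by
        refine (abs_add_le _ _).trans (add_le_add a3 ?_)
        rw [abs_mul, Nat.abs_cast]
        gcongr
    _ ≤ 4 ^ k * (4 * t ^ 2) + k * t ^ 2 := by gcongr
    _ = _ := by ring

lemma shift_inequality (hn : 1 ≤ n) {s : ℝ} (hs0 : 0 < s) (hs1 : s < 1) (e : Sph n) {t : ℝ}
    (ht0 : 0 < t) (ht : t ≤ 1 / 4) (hδ : n * t + (n + 4 ^ (n + 1)) * t ^ 2 < 1)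
    (hfin : rieszD (n + s) (fun x : Sph n => ⟪(x : Eucl n), e⟫) ≠ ⊤) :
    s * (n - s) / n ^ 2 * ((1 + (n * t + (n + 4 ^ (n + 1)) * t ^ 2)) ^ 2)⁻¹ *
      (n * (1 - 2 * (n + 4 ^ (n + 1)) * t)) * (fracPer n s (ball 0 1)).toReal ≤
    kapU n (2 * t) * (1 + 2 * t) ^ 2 *
      (rieszD (n + s) (fun x : Sph n => ⟪(x : Eucl n), e⟫)).toReal := by
  have hn1 : (1 : ℝ) ≤ n := by exact_mod_cast hn
  have hn0 : (0 : ℝ) < n := by linarith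
  have hS := surf_univ_pos hn
  obtain ⟨g, hg0, hgB, hg⟩ := exists_fracPer_formula_real hn hs0 hs1
  set h : Sph n → ℝ := fun x => ⟪(x : Eucl n), e⟫ with hh
  have hhc : Continuous h := by rw [hh]; fun_prop
  have hh1 : ∀ x, |h x| ≤ 1 := fun x => abs_inner_sph_le x e
  set K : ℝ := n + 4 ^ (n + 1) with hK
  have hK0 : 0 ≤ K := by positivity
  set δ : ℝ := n * t + K * t ^ 2 with hδe
  have hδ0 : 0 ≤ δ := by positivity
  set u : Sph n → ℝ := fun x => shiftRad t (h x) with hu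
  have huc : Continuous u := (continuous_shiftRad t).comp hhc
  have htabs : |t| = t := abs_of_pos ht0
  have hu2 : ∀ x, |u x| ≤ 2 * t := fun x => by
    have a1 := abs_shiftRad_sub_le (hh1 x) (by rw [htabs]; linarith : |t| ≤ 1)
    have : |t * h x| ≤ t := by
      rw [abs_mul, htabs]; nlinarith [abs_nonneg (h x), hh1 x]
    have h3 := abs_add_le (shiftRad t (h x) - t * h x) (t * h x)
    rw [sub_add_cancel] at h3
    change |shiftRad t (h x)| ≤ _
    nlinarith
  have hu1 : ∀ x, |u x| < 1 := fun x => (hu2 x).trans_lt (by linarith)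
  have hw : ∀ x, |(1 + u x) ^ n - 1 - n * (t * h x)| ≤ K * t ^ 2 := fun x =>
    abs_shiftRad_pow_sub_le n (hh1 x) ht0.le ht
  have hnth : ∀ x, |n * (t * h x)| ≤ n * t := fun x => by
    rw [abs_mul, abs_mul, htabs, Nat.abs_cast]
    nlinarith [mul_nonneg hn0.le ht0.le, hh1 x, abs_nonneg (h x)]
  have hwδ : ∀ x, |(1 + u x) ^ n - 1| ≤ δ := fun x => by
    have := abs_add_le ((1 + u x) ^ n - 1 - n * (t * h x)) (n * (t * h x))
    rw [sub_add_cancel] at this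
    linarith [hw x, hnth x]
  have hae := ball_shift_ae_eq hn (by rw [htabs]; linarith : |t| < 1) e
  have hball : ball (t • (e : Eucl n)) 1 = (fun x => x - t • (e : Eucl n)) ⁻¹' ball 0 1 := by
    ext z; rw [Set.mem_preimage, mem_ball_iff_norm, mem_ball_zero_iff]
  have hvol := integral_pow_of_volume_eq hn (R := fun x => 1 + u x) (continuous_const.add huc)
    (fun x => by linarith [(abs_lt.1 (hu1 x)).1]) hae (Measure.addHaar_ball_center _ _ _)
  have hP : fracPer n s (polarSet fun x => 1 + u x) = fracPer n s (ball 0 1) := by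
    rw [← fracPer_congr_ae s hae, hball, fracPer_preimage s measurableSet_ball]
  have hQ : radQ (n + s) (fun x => 1 + u x) ≤ ENNReal.ofReal (kapU n (2 * t)) *
      (ENNReal.ofReal ((t * (1 + 2 * t)) ^ 2) * rieszD (n + s) h) :=
    (radQ_le (by positivity) (by linarith) (by positivity) (by linarith) hu2).trans <| by
      gcongr
      exact rieszD_le_of_abs_le _ fun x y =>
        abs_shiftRad_sub_shiftRad_le (hh1 x) (hh1 y) ht0.le ht
  have hrt : ENNReal.ofReal (kapU n (2 * t)) *
      (ENNReal.ofReal ((t * (1 + 2 * t)) ^ 2) * rieszD (n + s) h) ≠ ⊤ := by finiteness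
  have hkap : 0 ≤ kapU n (2 * t) := by
    unfold kapU
    have : 0 ≤ 1 - 2 * t := by linarith
    positivity
  have hQr := ENNReal.toReal_mono hrt hQ
  rw [ENNReal.toReal_mul, ENNReal.toReal_mul, ENNReal.toReal_ofReal hkap,
    ENNReal.toReal_ofReal (by positivity)] at hQr
  have hform := hg u huc hu1 (ne_top_of_le_ne_top hrt hQ)
  rw [hP, hgB] at hform
  have hI := (integral_rpow_bounds hn hs0 hs1 huc hu1 hδ0 hδ hwδ hvol).2
  have hW : t ^ 2 * (n * (1 - 2 * K * t)) * (surf n).real Set.univ ≤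
      ∫ x, ((1 + u x) ^ n - 1) ^ 2 ∂(surf n) := by
    have e1 : ∫ x, (n ^ 2 * t ^ 2 * h x ^ 2 - 2 * n * K * t ^ 3) ∂(surf n) =
        t ^ 2 * (n * (1 - 2 * K * t)) * (surf n).real Set.univ := by
      have := integral_sq_inner hn e
      have i1 : Integrable (fun x => (n : ℝ) ^ 2 * t ^ 2 * h x ^ 2) (surf n) :=
        integrable_of_continuous_sph ((hhc.pow 2).const_mul _)
      rw [integral_sub i1 (integrable_const _), integral_const_mul]
      have e2 : ∫ x, h x ^ 2 ∂(surf n) = (surf n).real Set.univ / n := by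
        rw [← this]; congr 1; ext x; rw [hh]; simp only; rw [real_inner_comm]
      rw [e2, integral_const, smul_eq_mul]
      field_simp
    rw [← e1]
    refine integral_mono (integrable_of_continuous_sph (((hhc.pow 2).const_mul _).sub
      continuous_const)) (integrable_of_continuous_sph ?_) fun x => ?_
    · exact (((continuous_const.add huc).pow n).sub continuous_const).pow 2
    · simp only
      have h1 := hw x
      have h2 := hnth x
      set a := (1 + u x) ^ n - 1
      set b := (n : ℝ) * (t * h x)
      have h3 : |b * (a - b)| ≤ n * t * (K * t ^ 2) := by
        rw [abs_mul]; gcongr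
      have h4 := (abs_le.1 h3).1
      have h5 : (n : ℝ) ^ 2 * t ^ 2 * h x ^ 2 = b ^ 2 := by ring
      rw [h5]
      nlinarith [sq_nonneg (a - b)]
  set W := ∫ x, ((1 + u x) ^ n - 1) ^ 2 ∂(surf n)
  set S := (surf n).real Set.univ
  set I := ∫ x, (1 + u x) ^ ((n : ℝ) - s) ∂(surf n)
  set c : ℝ := s * (n - s) / n ^ 2 * ((1 + δ) ^ 2)⁻¹ with hc
  have hc0 : 0 ≤ c := by
    have : 0 ≤ (n : ℝ) - s := by linarith
    positivity
  have hI' : I ≤ S - c / 2 * W := by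
    refine hI.trans_eq ?_
    rw [hc]; field_simp
  have h6 : g * (c * W) ≤ kapU n (2 * t) * ((t * (1 + 2 * t)) ^ 2 * (rieszD (n + s) h).toReal) := by
    have := mul_le_mul_of_nonneg_left hI' hg0
    nlinarith
  have h7 : g * (c * (t ^ 2 * (n * (1 - 2 * K * t)) * S)) ≤ g * (c * W) := by gcongr
  rw [hgB]
  refine le_of_mul_le_mul_left ?_ (pow_pos ht0 2)
  calc _ = g * (c * (t ^ 2 * (n * (1 - 2 * K * t)) * S)) := by ring
    _ ≤ _ := h7.trans h6
    _ = _ := by ring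

lemma fracPer_ball_le_rieszD (hn : 1 ≤ n) {s : ℝ} (hs0 : 0 < s) (hs1 : s < 1) (e : Sph n)
    (hfin : rieszD (n + s) (fun x : Sph n => ⟪(x : Eucl n), e⟫) ≠ ⊤) :
    s * (n - s) / n * (fracPer n s (ball 0 1)).toReal ≤
      (rieszD (n + s) (fun x : Sph n => ⟪(x : Eucl n), e⟫)).toReal := by
  have hn0 : (0 : ℝ) < n := by exact_mod_cast hn
  set P := (fracPer n s (ball 0 1)).toReal
  set D := (rieszD (n + s) (fun x : Sph n => ⟪(x : Eucl n), e⟫)).toReal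
  have c1 : ContinuousAt (fun t : ℝ =>
      s * (n - s) / n ^ 2 * ((1 + (n * t + (n + 4 ^ (n + 1)) * t ^ 2)) ^ 2)⁻¹ *
      (n * (1 - 2 * (n + 4 ^ (n + 1)) * t)) * P) 0 := by
    fun_prop (disch := simp)
  have c2 : ContinuousAt (fun t : ℝ => kapU n (2 * t) * (1 + 2 * t) ^ 2 * D) 0 := by
    unfold kapU
    fun_prop (disch := simp)
  have c3 : ContinuousAt (fun t : ℝ => n * t + (n + 4 ^ (n + 1)) * t ^ 2) 0 := by fun_prop
  have l1 := c1.tendsto.mono_left (nhdsWithin_le_nhds (s := Set.Ioi 0))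
  have l2 := c2.tendsto.mono_left (nhdsWithin_le_nhds (s := Set.Ioi 0))
  have ev : ∀ᶠ t : ℝ in 𝓝[>] 0, n * t + (n + 4 ^ (n + 1)) * t ^ 2 < 1 :=
    (c3.tendsto.eventually_lt_const (by simp)).filter_mono nhdsWithin_le_nhds
  have ev2 : ∀ᶠ t : ℝ in 𝓝[>] 0, t ∈ Set.Ioo (0 : ℝ) (1 / 4) :=
    Ioo_mem_nhdsGT (by norm_num)
  have := le_of_tendsto_of_tendsto l1 l2 (by
    filter_upwards [ev, ev2] with t h1 h2
    exact shift_inequality hn hs0 hs1 e h2.1 h2.2.le h1 hfin)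
  simp only [kapU] at this
  norm_num at this
  refine le_trans (le_of_eq ?_) this
  field_simp

lemma rieszL_eq_sum (q : ℝ) : rieszL n q =
    ∑ i : Fin n, rieszD q (fun x : Sph n => (x : Eucl n) i) := by
  unfold rieszL rieszD
  rw [← lintegral_finsetSum]
  · refine lintegral_congr fun z => ?_
    rw [← ENNReal.ofReal_sum_of_nonneg fun i _ =>
      mul_nonneg (sq_nonneg _) (Real.rpow_nonneg (norm_nonneg _) _), ← Finset.sum_mul,
      EuclideanSpace.norm_sq_eq]
    simp
  · intro i _
    apply Measurable.ennreal_ofReal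
    fun_prop

/-- Stability of the ball under translations bounds its perimeter by the Riesz energy. -/
lemma fracPer_ball_le_rieszL (hn : 1 ≤ n) {s : ℝ} (hs0 : 0 < s) (hs1 : s < 1) :
    s * (n - s) * (fracPer n s (ball 0 1)).toReal ≤ (rieszL n (n + s)).toReal := by
  have hn0 : (0 : ℝ) < n := by exact_mod_cast hn
  obtain ⟨C, hC, hL⟩ := exists_rieszL_le hn
  have hLt : rieszL n (n + s) ≠ ⊤ := ne_top_of_le_ne_top ENNReal.ofReal_ne_top (hL s hs0 hs1)
  have hi : ∀ i : Fin n, rieszD (n + s) (fun x : Sph n => (x : Eucl n) i) ≠ ⊤ := by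
    rw [rieszL_eq_sum] at hLt
    exact fun i => (ENNReal.sum_lt_top.1 hLt.lt_top i (Finset.mem_univ i)).ne
  rw [rieszL_eq_sum, ENNReal.toReal_sum fun i _ => hi i]
  have : ∀ i : Fin n, s * (n - s) / n * (fracPer n s (ball 0 1)).toReal ≤
      (rieszD (n + s) (fun x : Sph n => (x : Eucl n) i)).toReal := by
    intro i
    have e : (fun x : Sph n => ⟪(x : Eucl n), (⟨EuclideanSpace.single i 1, by simp⟩ : Sph n)⟫) =
        fun x : Sph n => (x : Eucl n) i := by
      ext x; simp [EuclideanSpace.inner_single_right]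
    have := fracPer_ball_le_rieszD hn hs0 hs1 ⟨EuclideanSpace.single i 1, by simp⟩
      (by rw [e]; exact hi i)
    rwa [e] at this
  refine le_trans (le_of_eq ?_) (Finset.sum_le_sum fun i _ => this i)
  rw [Finset.sum_const, Finset.card_univ, Fintype.card_fin, nsmul_eq_mul]
  field_simp

end Translate

section MainInequality

open RealInnerProductSpace Filter Topology

variable {n : ℕ}

lemma sq_integral_sph_le (hn : 1 ≤ n) {f : Sph n → ℝ} (hf : Continuous f) :
    (∫ x, f x ∂(surf n)) ^ 2 ≤ (surf n).real Set.univ * ∫ x, f x ^ 2 ∂(surf n) := by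
  have hS := surf_univ_pos hn
  set S := (surf n).real Set.univ
  set F := ∫ x, f x ∂(surf n) with hF
  have i1 : Integrable f (surf n) := integrable_of_continuous_sph hf
  have i2 : Integrable (fun x => f x ^ 2) (surf n) := integrable_of_continuous_sph (hf.pow 2)
  have i3 : Integrable (fun x => 2 * (F / S) * f x) (surf n) := i1.const_mul _
  have i4 : Integrable (fun x => f x ^ 2 - 2 * (F / S) * f x) (surf n) := i2.sub i3
  have h : 0 ≤ ∫ x, (f x ^ 2 - 2 * (F / S) * f x + (F / S) ^ 2) ∂(surf n) :=
    integral_nonneg fun x => by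
      have := sq_nonneg (f x - F / S)
      simp only [Pi.zero_apply]; nlinarith
  rw [integral_add i4 (integrable_const _), integral_sub i2 i3, integral_const_mul, ← hF,
    integral_const, smul_eq_mul] at h
  have := mul_nonneg hS.le h
  have e : S * (∫ x, f x ^ 2 ∂(surf n) - 2 * (F / S) * F + S * (F / S) ^ 2) =
      S * ∫ x, f x ^ 2 ∂(surf n) - F ^ 2 := by field_simp; ring
  change 0 ≤ S * (∫ x, f x ^ 2 ∂(surf n) - 2 * (F / S) * F + S * (F / S) ^ 2) at this
  rw [e] at this
  linarith

lemma linEig_id (hn : 1 ≤ n) : linEig n id = (surf n).real Set.univ / n := by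
  have x : Sph n := ⟨EuclideanSpace.single ⟨0, hn⟩ 1, by simp⟩
  rw [← integral_zon_inner_self hn id x, ← integral_sq_inner hn x]
  simp [zon, sq]

lemma integral_coord (i : Fin n) : ∫ x : Sph n, (x : Eucl n) i ∂(surf n) = 0 := by
  have := Sph.integral_act (LinearIsometryEquiv.neg ℝ) (fun x : Sph n => (x : Eucl n) i)
  simp only [Sph.coe_act, LinearIsometryEquiv.coe_neg, PiLp.neg_apply, integral_neg] at this
  linarith

lemma integral_zon_id_mul {v : Sph n → ℝ} (hv : Continuous v) :
    ∫ z : Sph n × Sph n, zon id z.1 z.2 * v z.1 * v z.2 ∂((surf n).prod (surf n)) =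
      ∑ i : Fin n, (∫ x : Sph n, (x : Eucl n) i * v x ∂(surf n)) ^ 2 := by
  have e : ∀ z : Sph n × Sph n, zon id z.1 z.2 * v z.1 * v z.2 =
      ∑ i : Fin n, ((z.1 : Eucl n) i * v z.1) * ((z.2 : Eucl n) i * v z.2) := by
    intro z
    rw [zon, id, PiLp.inner_apply, Finset.sum_mul, Finset.sum_mul]
    refine Finset.sum_congr rfl fun i _ => ?_
    simp; ring
  simp_rw [e]
  rw [integral_finsetSum]
  · refine Finset.sum_congr rfl fun i _ => ?_
    rw [sq]
    exact integral_prod_mul (fun x : Sph n => (x : Eucl n) i * v x)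
      (fun x : Sph n => (x : Eucl n) i * v x)
  · intro i _
    apply integrable_of_continuous_sph2
    fun_prop

/-- Moment estimates for the volume-normalised perturbation. -/
lemma abs_integral_coord_mul_le {u : Sph n → ℝ} (hn : 1 ≤ n) (hu : Continuous u)
    (hu1 : ∀ x, |u x| ≤ 1) (i : Fin n)
    (hbar : ∫ x : Sph n, (x : Eucl n) i * (1 + u x) ^ (n + 1) ∂(surf n) = 0) :
    |∫ x : Sph n, (x : Eucl n) i * (((1 + u x) ^ n - 1) / n) ∂(surf n)| ≤
      2 * 4 ^ (n + 1) * ∫ x, u x ^ 2 ∂(surf n) := by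
  have hn1 : (1 : ℝ) ≤ n := by exact_mod_cast hn
  have hn0 : (0 : ℝ) < n := by linarith
  have hxi : ∀ x : Sph n, |(x : Eucl n) i| ≤ 1 := fun x => by
    have := PiLp.norm_apply_le (x : Eucl n) i
    rwa [Sph.norm_eq, Real.norm_eq_abs] at this
  have hc : Continuous fun x : Sph n => (x : Eucl n) i := by fun_prop
  have i0 : Integrable (fun x => u x ^ 2) (surf n) := integrable_of_continuous_sph (hu.pow 2)
  have hrem : ∀ k : ℕ, |∫ x : Sph n, (x : Eucl n) i * ((1 + u x) ^ k - 1 - k * u x) ∂(surf n)| ≤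
      4 ^ k * ∫ x, u x ^ 2 ∂(surf n) := by
    intro k
    rw [← integral_const_mul, ← Real.norm_eq_abs]
    refine norm_integral_le_of_norm_le (i0.const_mul _) (Eventually.of_forall fun x => ?_)
    rw [Real.norm_eq_abs, abs_mul]
    calc _ ≤ 1 * |(1 + u x) ^ k - 1 - k * u x| := by gcongr; exact hxi x
      _ ≤ _ := by rw [one_mul]; exact abs_one_add_pow_sub_le k (hu1 x)
  have hsplit : ∀ k : ℕ, ∫ x : Sph n, (x : Eucl n) i * ((1 + u x) ^ k - 1 - k * u x) ∂(surf n) =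
      ∫ x : Sph n, (x : Eucl n) i * (1 + u x) ^ k ∂(surf n) -
        k * ∫ x : Sph n, (x : Eucl n) i * u x ∂(surf n) := by
    intro k
    have j1 : Integrable (fun x : Sph n => (x : Eucl n) i * (1 + u x) ^ k) (surf n) :=
      integrable_of_continuous_sph (hc.mul ((continuous_const.add hu).pow k))
    have j2 : Integrable (fun x : Sph n => (x : Eucl n) i) (surf n) :=
      integrable_of_continuous_sph hc
    have j3 : Integrable (fun x : Sph n => k * ((x : Eucl n) i * u x)) (surf n) :=
      integrable_of_continuous_sph ((hc.mul hu).const_mul _)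
    have j4 : Integrable (fun x : Sph n => (x : Eucl n) i * (1 + u x) ^ k - (x : Eucl n) i)
      (surf n) := j1.sub j2
    have e : ∀ x : Sph n, (x : Eucl n) i * ((1 + u x) ^ k - 1 - k * u x) =
        (x : Eucl n) i * (1 + u x) ^ k - (x : Eucl n) i - k * ((x : Eucl n) i * u x) :=
      fun x => by ring
    simp_rw [e]
    rw [integral_sub j4 j3, integral_sub j1 j2, integral_coord, integral_const_mul, sub_zero]
  have h1 := hrem (n + 1)
  rw [hsplit, hbar] at h1
  have h2 := hrem n
  rw [hsplit] at h2
  have hv : ∫ x : Sph n, (x : Eucl n) i * (((1 + u x) ^ n - 1) / n) ∂(surf n) =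
      (∫ x : Sph n, (x : Eucl n) i * (1 + u x) ^ n ∂(surf n)) / n := by
    have j1 : Integrable (fun x : Sph n => (x : Eucl n) i * (1 + u x) ^ n) (surf n) :=
      integrable_of_continuous_sph (hc.mul ((continuous_const.add hu).pow n))
    have j2 : Integrable (fun x : Sph n => (x : Eucl n) i) (surf n) :=
      integrable_of_continuous_sph hc
    have e : ∀ x : Sph n, (x : Eucl n) i * (((1 + u x) ^ n - 1) / n) =
        ((x : Eucl n) i * (1 + u x) ^ n - (x : Eucl n) i) / n := fun x => by ring
    simp_rw [e]
    rw [integral_div, integral_sub j1 j2, integral_coord, sub_zero]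
  rw [hv]
  set a := ∫ x : Sph n, (x : Eucl n) i * (1 + u x) ^ n ∂(surf n)
  set b := ∫ x : Sph n, (x : Eucl n) i * u x ∂(surf n)
  set U := ∫ x, u x ^ 2 ∂(surf n)
  have hU : 0 ≤ U := integral_nonneg fun x => sq_nonneg _
  have h4 : (4 : ℝ) ^ n * U ≤ 4 ^ (n + 1) * U := by
    gcongr <;> norm_num
  have hb : n * |b| ≤ 4 ^ (n + 1) * U := by
    rw [zero_sub, abs_neg, abs_mul, Nat.abs_cast] at h1
    refine le_trans ?_ h1
    push_cast
    nlinarith [abs_nonneg b]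
  have ha : |a| ≤ 2 * 4 ^ (n + 1) * U := by
    have := abs_add_le (a - n * b) (n * b)
    rw [sub_add_cancel, abs_mul, Nat.abs_cast] at this
    linarith
  rw [abs_div, Nat.abs_cast]
  exact (div_le_self (abs_nonneg _) hn1).trans ha

lemma abs_le_abs_one_add_pow_sub_one (hn : 1 ≤ n) {a : ℝ} (ha : |a| ≤ 1) :
    |a| ≤ |(1 + a) ^ n - 1| := by
  have hn1 : (1 : ℝ) ≤ n := by exact_mod_cast hn
  have ha' := abs_le.1 ha
  rcases le_total 0 a with h | h
  · have := one_add_mul_le_pow (by linarith : -2 ≤ a) n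
    rw [abs_of_nonneg h]
    refine le_trans ?_ (le_abs_self _)
    nlinarith
  · have : (1 + a) ^ n ≤ 1 + a := pow_le_of_le_one (by linarith) (by linarith) (by omega)
    rw [abs_of_nonpos h]
    refine le_trans ?_ (neg_le_abs _)
    linarith

/-- Coercivity of the defect form for nearly spherical sets with the right volume and barycenter. -/
lemma le_defForm_id (hn : 1 ≤ n) {ε : ℝ} {u : Sph n → ℝ} (hu : Continuous u)
    (huε : ∀ x, |u x| ≤ ε) (hε1 : ε ≤ 1) (hε : 8 * 16 ^ (n + 1) * n ^ 4 * ε ^ 2 ≤ 1)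
    (hbar : ∀ i, ∫ x : Sph n, (x : Eucl n) i * (1 + u x) ^ (n + 1) ∂(surf n) = 0) :
    (surf n).real Set.univ / (2 * n) * ∫ x, (((1 + u x) ^ n - 1) / n) ^ 2 ∂(surf n) ≤
      defForm id (fun x => ((1 + u x) ^ n - 1) / n) := by
  have hn1 : (1 : ℝ) ≤ n := by exact_mod_cast hn
  have hn0 : (0 : ℝ) < n := by linarith
  have hS := surf_univ_pos hn
  set S := (surf n).real Set.univ
  have hvc : Continuous fun x => ((1 + u x) ^ n - 1) / n := by fun_prop
  have hu1 : ∀ x, |u x| ≤ 1 := fun x => (huε x).trans hε1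
  rw [defForm, linEig_id hn, integral_zon_id_mul hvc]
  set V := ∫ x, (((1 + u x) ^ n - 1) / n) ^ 2 ∂(surf n) with hV
  set U := ∫ x, u x ^ 2 ∂(surf n) with hU
  have hU0 : 0 ≤ U := integral_nonneg fun x => sq_nonneg _
  have hUV : U ≤ n ^ 2 * V := by
    rw [hU, hV, ← integral_const_mul]
    refine integral_mono (integrable_of_continuous_sph (hu.pow 2))
      (integrable_of_continuous_sph ((hvc.pow 2).const_mul _)) fun x => ?_
    simp only
    rw [← mul_pow, mul_div_cancel₀ _ hn0.ne', ← sq_abs, ← sq_abs ((1 + u x) ^ n - 1)]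
    have := abs_le_abs_one_add_pow_sub_one hn (hu1 x)
    gcongr
  have hUS : U ≤ ε ^ 2 * S := by
    have : ∫ _ : Sph n, ε ^ 2 ∂(surf n) = ε ^ 2 * S := by
      rw [integral_const, smul_eq_mul, mul_comm]
    rw [← this]
    refine integral_mono (integrable_of_continuous_sph (hu.pow 2)) (integrable_const _) fun x => ?_
    simp only
    rw [← sq_abs]
    have := huε x
    gcongr
  have hsum : ∑ i : Fin n, (∫ x : Sph n, (x : Eucl n) i * (((1 + u x) ^ n - 1) / n) ∂(surf n)) ^ 2 ≤
      n * (2 * 4 ^ (n + 1) * U) ^ 2 := by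
    calc _ ≤ ∑ i : Fin n, (2 * 4 ^ (n + 1) * U) ^ 2 := by
          refine Finset.sum_le_sum fun i _ => ?_
          rw [← sq_abs]
          have := abs_integral_coord_mul_le hn hu hu1 i (hbar i)
          gcongr
      _ = _ := by simp
  have e16 : ((4 : ℝ) ^ (n + 1)) ^ 2 = 16 ^ (n + 1) := by
    rw [← pow_mul, mul_comm, pow_mul]; norm_num
  have hV0 : 0 ≤ V := integral_nonneg fun x => sq_nonneg _
  have hlast : n * (2 * 4 ^ (n + 1) * U) ^ 2 ≤ S / (2 * n) * V := by
    have h1 : U ^ 2 ≤ (ε ^ 2 * S) * (n ^ 2 * V) := by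
      rw [sq]; exact mul_le_mul hUS hUV hU0 (by positivity)
    calc _ = n * 4 * 16 ^ (n + 1) * U ^ 2 := by rw [← e16]; ring
      _ ≤ n * 4 * 16 ^ (n + 1) * ((ε ^ 2 * S) * (n ^ 2 * V)) := by gcongr
      _ = (8 * 16 ^ (n + 1) * n ^ 4 * ε ^ 2) * (S / (2 * n) * V) := by field_simp; ring
      _ ≤ 1 * (S / (2 * n) * V) := by gcongr
      _ = _ := one_mul _
  have e2 : S / n * V = S / (2 * n) * V + S / (2 * n) * V := by field_simp; ring
  linarith

end MainInequality

section Deficit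

open RealInnerProductSpace Filter Topology

variable {n : ℕ}

lemma exists_small_radius (n : ℕ) {a b : ℝ} (ha : 0 < a) :
    ∃ ε : ℝ, 0 < ε ∧ ε < 1 / 2 ∧ 8 * 16 ^ (n + 1) * n ^ 4 * ε ^ 2 ≤ 1 ∧
      n * ε + 4 ^ n * ε ^ 2 < 1 ∧
      a / 2 ≤ kapL n ε / ((1 + ε) ^ (n - 1)) ^ 2 * a -
        b * (((1 - (n * ε + 4 ^ n * ε ^ 2)) ^ 2)⁻¹ - kapL n ε / ((1 + ε) ^ (n - 1)) ^ 2) := by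
  have c1 : ContinuousAt (fun ε : ℝ => 8 * 16 ^ (n + 1) * (n : ℝ) ^ 4 * ε ^ 2) 0 := by fun_prop
  have c2 : ContinuousAt (fun ε : ℝ => n * ε + 4 ^ n * ε ^ 2) 0 := by fun_prop
  have c3 : ContinuousAt (fun ε : ℝ => kapL n ε / ((1 + ε) ^ (n - 1)) ^ 2 * a -
        b * (((1 - (n * ε + 4 ^ n * ε ^ 2)) ^ 2)⁻¹ - kapL n ε / ((1 + ε) ^ (n - 1)) ^ 2)) 0 := by
    unfold kapL
    fun_prop (disch := simp)
  have e0 : ∀ᶠ ε : ℝ in 𝓝[>] 0, ε ∈ Set.Ioo (0 : ℝ) (1 / 2) := Ioo_mem_nhdsGT (by norm_num)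
  have e1 := (c1.tendsto.eventually_lt_const (u := 1) (by simp)).filter_mono
    (nhdsWithin_le_nhds (s := Set.Ioi 0))
  have e2 := (c2.tendsto.eventually_lt_const (u := 1) (by simp)).filter_mono
    (nhdsWithin_le_nhds (s := Set.Ioi 0))
  have e3 := (c3.tendsto.eventually_const_lt (u := a / 2) (by simp [kapL]; linarith)).filter_mono
    (nhdsWithin_le_nhds (s := Set.Ioi 0))
  obtain ⟨ε, h0, h1, h2, h3⟩ := (e0.and (e1.and (e2.and e3))).exists
  exact ⟨ε, h0.1, h0.2, h1.le, h2, h3.le⟩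

/-- Quantitative perimeter deficit for radial graphs over the unit sphere. -/
lemma exists_deficit_polarSet (hn : 1 ≤ n) : ∃ ε : ℝ, 0 < ε ∧ ε < 1 / 2 ∧ ∃ c : ℝ, 0 < c ∧
    ∀ u : Sph n → ℝ, (∀ x, |u x| ≤ ε) →
      (∀ x y : Sph n, |u x - u y| ≤ ε * ‖(x : Eucl n) - y‖) →
      ∫ x, (1 + u x) ^ n ∂(surf n) = (surf n).real Set.univ →
      (∀ i, ∫ x : Sph n, (x : Eucl n) i * (1 + u x) ^ (n + 1) ∂(surf n) = 0) →
      ∀ s : ℝ, 0 < s → s < 1 →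
        c * s * (fracPer n s (ball 0 1)).toReal * (∫ x, |u x| ∂(surf n)) ^ 2 ≤
          (fracPer n s (polarSet fun x => 1 + u x)).toReal - (fracPer n s (ball 0 1)).toReal := by
  have hn1 : (1 : ℝ) ≤ n := by exact_mod_cast hn
  have hn0 : (0 : ℝ) < n := by linarith
  have hS := surf_univ_pos hn
  set S := (surf n).real Set.univ with hSdef
  obtain ⟨c₃, hc₃, hD⟩ := exists_le_rieszD hn
  obtain ⟨C, hC, hLC⟩ := exists_rieszL_le hn
  set a : ℝ := c₃ * (S / (2 * n)) with ha
  have ha0 : 0 < a := by positivity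
  obtain ⟨ε, hε0, hε1, hε2, hε3, hε4⟩ := exists_small_radius n (b := n * S) ha0
  refine ⟨ε, hε0, hε1, a / (4 * S ^ 3 * n ^ 2), by positivity, ?_⟩
  intro u hu hL hvol hbar s hs0 hs1
  have huc : Continuous u := by
    have : LipschitzWith (Real.toNNReal ε) u := LipschitzWith.of_dist_le_mul fun x y => by
      rw [Real.dist_eq, Subtype.dist_eq, dist_eq_norm, Real.coe_toNNReal _ hε0.le]
      exact hL x y
    exact this.continuous
  have hu1 : ∀ x, |u x| < 1 := fun x => (hu x).trans_lt (by linarith)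
  have h1s : 0 < 1 - s := by linarith
  set q : ℝ := n + s with hq
  set δ : ℝ := n * ε + 4 ^ n * ε ^ 2 with hδ
  set ρ : ℝ := (1 + ε) ^ (n - 1) with hρ
  have hρ1 : 1 ≤ ρ := one_le_pow₀ (by linarith)
  have hδ0 : 0 ≤ δ := by positivity
  set v : Sph n → ℝ := fun x => ((1 + u x) ^ n - 1) / n with hv
  have hvc : Continuous v := by rw [hv]; fun_prop
  have hvu : ∀ x y, |v x - v y| ≤ ρ * |u x - u y| := fun x y => by
    have h := abs_pow_sub_pow_le (1 + u x) (1 + u y) n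
    have hx := abs_le.1 (hu x)
    have hy := abs_le.1 (hu y)
    have hm : max |1 + u x| |1 + u y| ≤ 1 + ε := by
      apply max_le <;> rw [abs_le] <;> constructor <;> linarith
    have e : v x - v y = ((1 + u x) ^ n - (1 + u y) ^ n) / n := by rw [hv]; ring
    rw [e, abs_div, Nat.abs_cast, div_le_iff₀ hn0]
    calc _ ≤ _ := h
      _ ≤ |1 + u x - (1 + u y)| * n * (1 + ε) ^ (n - 1) := by gcongr
      _ = _ := by rw [add_sub_add_left_eq_sub]; ring
  have hvL : LipschitzWith (Real.toNNReal (ρ * ε)) v := LipschitzWith.of_dist_le_mul fun x y => by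
    rw [Real.dist_eq, Subtype.dist_eq, dist_eq_norm, Real.coe_toNNReal _ (by positivity)]
    calc _ ≤ _ := hvu x y
      _ ≤ ρ * (ε * ‖(x : Eucl n) - y‖) := by gcongr; exact hL x y
      _ = _ := by ring
  have hv0 : ∫ x, v x ∂(surf n) = 0 := by
    have i1 : Integrable (fun x => (1 + u x) ^ n) (surf n) :=
      integrable_of_continuous_sph (by fun_prop)
    rw [hv, integral_div, integral_sub i1 (integrable_const _), hvol]
    simp [hSdef]
  set V := ∫ x, v x ^ 2 ∂(surf n) with hV
  have hV0 : 0 ≤ V := integral_nonneg fun x => sq_nonneg _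
  have hW : ∫ x, ((1 + u x) ^ n - 1) ^ 2 ∂(surf n) = n ^ 2 * V := by
    rw [hV, ← integral_const_mul]
    congr 1; ext x
    rw [hv]; simp only
    rw [← mul_pow, mul_div_cancel₀ _ hn0.ne']
  have hLt : rieszL n q ≠ ⊤ := ne_top_of_le_ne_top ENNReal.ofReal_ne_top (hLC s hs0 hs1)
  have hDut : rieszD q u ≠ ⊤ :=
    ne_top_of_le_ne_top (ENNReal.mul_ne_top ENNReal.ofReal_ne_top hLt) (rieszD_le_rieszL q hL)
  have hDv := rieszD_le_of_abs_le q hvu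
  have hDvt : rieszD q v ≠ ⊤ :=
    ne_top_of_le_ne_top (ENNReal.mul_ne_top ENNReal.ofReal_ne_top hDut) hDv
  have hQle := radQ_le (q := q) (by positivity) (by rw [hq]; linarith) hε0.le (by linarith) hu
  have hQt : radQ q (fun x => 1 + u x) ≠ ⊤ :=
    ne_top_of_le_ne_top (ENNReal.mul_ne_top ENNReal.ofReal_ne_top hDut) hQle
  have hQge := le_radQ (q := q) (by positivity) (by rw [hq]; linarith) hε0.le (by linarith) hu hL
  have hkap0 : 0 ≤ kapL n ε := by
    unfold kapL
    have : 0 ≤ 1 - ε := by linarith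
    positivity
  have hkap1 : kapL n ε ≤ 1 := by
    unfold kapL
    have h1 : ((1 - ε) ^ (n - 1)) ^ 2 ≤ 1 := by
      have : 0 ≤ 1 - ε := by linarith
      exact pow_le_one₀ (by positivity) (pow_le_one₀ this (by linarith))
    have h2 : ((1 + 2 * ε) ^ (n + 1))⁻¹ ≤ 1 := inv_le_one_of_one_le₀ (one_le_pow₀ (by linarith))
    exact mul_le_one₀ h1 (by positivity) h2
  set Du := (rieszD q u).toReal
  set Dv := (rieszD q v).toReal
  set Q := (radQ q (fun x => 1 + u x)).toReal
  have rDv : Dv ≤ ρ ^ 2 * Du := by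
    have := ENNReal.toReal_mono (ENNReal.mul_ne_top ENNReal.ofReal_ne_top hDut) hDv
    rwa [ENNReal.toReal_mul, ENNReal.toReal_ofReal (by positivity)] at this
  have rQ : kapL n ε * Du ≤ Q := by
    have := ENNReal.toReal_mono hQt hQge
    rwa [ENNReal.toReal_mul, ENNReal.toReal_ofReal hkap0] at this
  obtain ⟨g, hg0, hgB, hg⟩ := exists_fracPer_formula_real hn hs0 hs1
  have hPE := hg u huc hu1 hQt
  set PE := (fracPer n s (polarSet fun x => 1 + u x)).toReal
  set PB := (fracPer n s (ball 0 1)).toReal with hPB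
  have hPB0 : 0 ≤ PB := ENNReal.toReal_nonneg
  set A : ℝ := g * (s * (n - s)) with hA
  have hns : 0 ≤ (n : ℝ) - s := by linarith
  have hA0 : 0 ≤ A := by positivity
  have hdef := le_defForm_id hn huc hu (by linarith) hε2 hbar
  change S / (2 * n) * V ≤ defForm id v at hdef
  have rD : A * V + a / (1 - s) * V ≤ Dv := by
    have h := ENNReal.toReal_mono hDvt (hD s v _ hs0 hs1 hvL hv0)
    have hdef0 : 0 ≤ defForm id v := le_trans (by positivity) hdef
    rw [ENNReal.toReal_add (ENNReal.mul_ne_top ENNReal.ofReal_ne_top hLt) ENNReal.ofReal_ne_top,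
      ENNReal.toReal_mul, ENNReal.toReal_ofReal (by positivity),
      ENNReal.toReal_ofReal (by positivity)] at h
    refine le_trans (add_le_add ?_ ?_) h
    · have h2 := fracPer_ball_le_rieszL hn hs0 hs1
      rw [← hPB, hgB] at h2
      have h3 : A * S ≤ (rieszL n q).toReal := by rw [hA]; linarith
      calc A * V = V / S * (A * S) := by field_simp
        _ ≤ _ := by gcongr
    · calc a / (1 - s) * V = c₃ / (1 - s) * (S / (2 * n) * V) := by rw [ha]; ring
        _ ≤ _ := by gcongr
  have hPBle : s * PB ≤ S ^ 2 / (1 - s) := by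
    have h := ENNReal.toReal_mono ENNReal.ofReal_ne_top (fracPer_ball_le hn hs0 hs1)
    rw [ENNReal.toReal_ofReal (by positivity)] at h
    calc s * PB ≤ s * (S ^ 2 / (s * (1 - s))) := by gcongr
      _ = _ := by field_simp
  have hAle : A ≤ n * S / (1 - s) := by
    have h1 : A * S ≤ n * S / (1 - s) * S := by
      calc A * S = (n - s) * (s * PB) := by rw [hA, hgB]; ring
        _ ≤ n * (S ^ 2 / (1 - s)) := by
            apply mul_le_mul (by linarith) hPBle (by positivity) hn0.le
        _ = _ := by ring
    exact le_of_mul_le_mul_right h1 hS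
  have hwδ : ∀ x, |(1 + u x) ^ n - 1| ≤ δ := fun x => by
    have h1 := abs_one_add_pow_sub_le n (hu1 x).le
    have h2 := abs_add_le ((1 + u x) ^ n - 1 - n * u x) (n * u x)
    rw [sub_add_cancel, abs_mul, Nat.abs_cast] at h2
    have h3 : u x ^ 2 ≤ ε ^ 2 := by rw [← sq_abs]; have := hu x; gcongr
    calc _ ≤ 4 ^ n * u x ^ 2 + n * |u x| := h2.trans (by linarith)
      _ ≤ 4 ^ n * ε ^ 2 + n * ε := by gcongr; exact hu x
      _ = _ := by rw [hδ]; ring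
  have hI := (integral_rpow_bounds hn hs0 hs1 huc hu1 hδ0 hε3 hwδ hvol).1
  rw [hW] at hI
  set I := ∫ x, (1 + u x) ^ ((n : ℝ) - s) ∂(surf n)
  set k : ℝ := ((1 - δ) ^ 2)⁻¹ with hk
  have hk1 : 1 ≤ k := by
    rw [hk]
    refine (one_le_inv₀ ?_).2 ?_
    · have : 0 < 1 - δ := by linarith
      positivity
    · exact pow_le_one₀ (by linarith) (by linarith)
  have hI' : g * S - A * k * V / 2 ≤ g * I := by
    have := mul_le_mul_of_nonneg_left hI hg0
    refine le_trans (le_of_eq ?_) this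
    rw [hA, hSdef]; field_simp
  set m : ℝ := kapL n ε / ρ ^ 2 with hm
  have hm0 : 0 ≤ m := by positivity
  have hm1 : m ≤ 1 := by
    rw [hm, div_le_one (by positivity)]
    exact hkap1.trans (one_le_pow₀ hρ1)
  have hmQ : m * (A * V + a / (1 - s) * V) ≤ Q := by
    calc _ ≤ m * (ρ ^ 2 * Du) := by gcongr; exact rD.trans rDv
      _ = kapL n ε * Du := by rw [hm]; field_simp
      _ ≤ Q := rQ
  have hkey : (a / 2) * (V / (1 - s)) / 2 ≤ PE - PB := by
    have h1 : A * (k - m) * V ≤ n * S / (1 - s) * (k - m) * V := by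
      have : 0 ≤ k - m := by linarith
      gcongr
    have h2 : (a / 2) * (V / (1 - s)) ≤ (m * a - n * S * (k - m)) * (V / (1 - s)) := by
      gcongr
    have h3 : (m * a - n * S * (k - m)) * (V / (1 - s)) =
        m * (a / (1 - s) * V) - n * S / (1 - s) * (k - m) * V := by ring
    rw [hPE, hgB]
    linarith
  have hU : (∫ x, |u x| ∂(surf n)) ^ 2 ≤ S * (n ^ 2 * V) := by
    refine (sq_integral_sph_le hn huc.abs).trans ?_
    gcongr
    rw [← hW]
    refine integral_mono (integrable_of_continuous_sph (huc.abs.pow 2))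
      (integrable_of_continuous_sph (by fun_prop)) fun x => ?_
    simp only
    rw [← sq_abs ((1 + u x) ^ n - 1)]
    have := abs_le_abs_one_add_pow_sub_one hn (hu1 x).le
    gcongr
  calc _ = a / (4 * S ^ 3 * n ^ 2) * (s * PB) * (∫ x, |u x| ∂(surf n)) ^ 2 := by ring
    _ ≤ a / (4 * S ^ 3 * n ^ 2) * (S ^ 2 / (1 - s)) * (S * (n ^ 2 * V)) := by gcongr
    _ = (a / 2) * (V / (1 - s)) / 2 := by field_simp; ring
    _ ≤ _ := hkey

end Deficit

section HausdorffComparison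

open Filter Topology

/-- A measure with a lower `d`-dimensional growth bound dominates the Hausdorff measure. -/
lemma hausdorffMeasure_le_of_growth {X : Type*} [MetricSpace X] [MeasurableSpace X] [BorelSpace X]
    [SecondCountableTopology X] (ν : Measure X) [IsFiniteMeasure ν] {d r₀ : ℝ} {K : ℝ≥0∞}
    (hd : 0 ≤ d) (hr₀ : 0 < r₀) (hK : K ≠ ⊤)
    (h : ∀ (x : X) (r : ℝ), 0 < r → r < r₀ → ENNReal.ofReal r ^ d ≤ K * ν (closedBall x r))
    (A : Set X) :
    Measure.hausdorffMeasure d A ≤ ENNReal.ofReal 10 ^ d * K * ν A := by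
  have hC : ENNReal.ofReal 10 ^ d * K ≠ ⊤ :=
    ENNReal.mul_ne_top (ENNReal.rpow_ne_top_of_nonneg hd ENNReal.ofReal_ne_top) hK
  have hediam : ∀ (x : X) (r : ℝ), 0 ≤ r →
      ediam (closedBall x (5 * r)) ≤ ENNReal.ofReal (10 * r) := by
    intro x r hr
    refine Metric.ediam_le fun y hy z hz => ?_
    rw [edist_dist]
    apply ENNReal.ofReal_le_ofReal
    have := dist_triangle_right y z x
    rw [mem_closedBall] at hy hz
    linarith
  have open_bound : ∀ U : Set X, IsOpen U → A ⊆ U →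
      Measure.hausdorffMeasure d A ≤ ENNReal.ofReal 10 ^ d * K * ν U := by
    intro U hU hAU
    have cover : ∀ k : ℕ, ∃ (u : Set X) (r : X → ℝ), u.Countable ∧
        (∀ x ∈ u, 0 < r x ∧ r x < r₀ ∧ r x ≤ 1 / ((k : ℝ) + 1) ∧ closedBall x (r x) ⊆ U) ∧
        u.PairwiseDisjoint (fun x => closedBall x (r x)) ∧
        A ⊆ ⋃ x : u, closedBall (x : X) (5 * r x) := by
      intro k
      have hex : ∀ x : X, ∃ r : ℝ, x ∈ A →
          (0 < r ∧ r < r₀ ∧ r ≤ 1 / ((k : ℝ) + 1) ∧ closedBall x r ⊆ U) := by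
        intro x
        by_cases hx : x ∈ A
        · obtain ⟨ρ, hρ, hρU⟩ := Metric.nhds_basis_closedBall.mem_iff.1 (hU.mem_nhds (hAU hx))
          have hk : (0 : ℝ) < 1 / ((k : ℝ) + 1) := by positivity
          refine ⟨min ρ (min (r₀ / 2) (1 / ((k : ℝ) + 1))), fun _ => ⟨by positivity, ?_, ?_, ?_⟩⟩
          · exact ((min_le_right _ _).trans (min_le_left _ _)).trans_lt (by linarith)
          · exact (min_le_right _ _).trans (min_le_right _ _)
          · exact (closedBall_subset_closedBall (min_le_left _ _)).trans hρU
        · exact ⟨0, fun h => absurd h hx⟩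
      choose r hr using hex
      obtain ⟨u, huA, hdisj, hcov⟩ :=
        Vitali.exists_disjoint_subfamily_covering_enlargement_closedBall A (fun x => x) r r₀
          (fun x hx => (hr x hx).2.1.le) 5 (by norm_num)
      refine ⟨u, r, ?_, fun x hx => hr x (huA hx), hdisj, fun x hx => ?_⟩
      · refine hdisj.countable_of_nonempty_interior fun x hx => ?_
        exact ⟨x, ball_subset_interior_closedBall (mem_ball_self (hr x (huA hx)).1)⟩
      · obtain ⟨b, hb, hsub⟩ := hcov x hx
        exact Set.mem_iUnion.2 ⟨⟨b, hb⟩, hsub (mem_closedBall_self (hr x hx).1.le)⟩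
    choose u r huc hur hdisj hcov using cover
    have hcount : ∀ k, Countable (u k) := fun k => (huc k).to_subtype
    have hlim : Tendsto (fun k : ℕ => ENNReal.ofReal (10 * (1 / ((k : ℝ) + 1)))) atTop (𝓝 0) := by
      rw [← ENNReal.ofReal_zero]
      refine ENNReal.tendsto_ofReal ?_
      simpa using tendsto_one_div_add_atTop_nhds_zero_nat.const_mul (10 : ℝ)
    have key := Measure.hausdorffMeasure_le_liminf_tsum d A _ hlim
      (fun k (x : u k) => closedBall (x : X) (5 * r k x))
      (Eventually.of_forall fun k x => (hediam _ _ (hur k x x.2).1.le).trans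
        (ENNReal.ofReal_le_ofReal (by linarith [(hur k x x.2).2.2.1])))
      (Eventually.of_forall hcov)
    refine key.trans ((liminf_le_liminf (Eventually.of_forall fun k => ?_)).trans_eq
      (liminf_const _))
    calc ∑' x : u k, ediam (closedBall (x : X) (5 * r k x)) ^ d
        ≤ ∑' x : u k, ENNReal.ofReal 10 ^ d * K * ν (closedBall (x : X) (r k x)) := by
          refine ENNReal.tsum_le_tsum fun x => ?_
          obtain ⟨h1, h2, -, -⟩ := hur k x x.2
          calc _ ≤ ENNReal.ofReal (10 * r k x) ^ d :=
                ENNReal.rpow_le_rpow (hediam _ _ h1.le) hd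
            _ = ENNReal.ofReal 10 ^ d * ENNReal.ofReal (r k x) ^ d := by
                rw [ENNReal.ofReal_mul (by norm_num), ENNReal.mul_rpow_of_nonneg _ _ hd]
            _ ≤ ENNReal.ofReal 10 ^ d * (K * ν (closedBall (x : X) (r k x))) := by
                gcongr
                exact h x _ h1 h2
            _ = _ := by rw [mul_assoc]
      _ = ENNReal.ofReal 10 ^ d * K * ν (⋃ x ∈ u k, closedBall x (r k x)) := by
          rw [ENNReal.tsum_mul_left, measure_biUnion (huc k) (hdisj k)
            fun x _ => measurableSet_closedBall]
      _ ≤ _ := by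
          gcongr
          exact Set.iUnion₂_subset fun x hx => (hur k x hx).2.2.2
  refine ENNReal.le_of_forall_pos_le_add fun ε hε _ => ?_
  set C := ENNReal.ofReal 10 ^ d * K with hCdef
  obtain ⟨U, hAU, hU, hνU⟩ := Set.exists_isOpen_le_add A ν (ε := ε / (C + 1)) (by
    refine (ENNReal.div_pos (by exact_mod_cast hε.ne') ?_).ne'
    finiteness)
  refine (open_bound U hU hAU).trans ?_
  calc C * ν U ≤ C * (ν A + ε / (C + 1)) := by gcongr
    _ = C * ν A + C * (ε / (C + 1)) := mul_add _ _ _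
    _ ≤ C * ν A + (C + 1) * (ε / (C + 1)) := by gcongr; exact le_self_add
    _ ≤ _ := by gcongr; exact ENNReal.mul_div_le

variable {n : ℕ}

lemma le_surf_closedBall (hn : 1 ≤ n) (x : Sph n) {ρ : ℝ} (h0 : 0 < ρ) (h1 : ρ < 1) :
    ENNReal.ofReal (ρ ^ n) * volume (ball (0 : Eucl n) 1) ≤
      ENNReal.ofReal (2 ^ n * ρ) * surf n (closedBall x (2 * ρ)) := by
  have : Nonempty (Fin n) := ⟨⟨0, hn⟩⟩
  have hpol := lintegral_polar' hn ((ball (x : Eucl n) ρ).indicator 1)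
    (measurable_one.indicator measurableSet_ball)
  rw [lintegral_indicator_one measurableSet_ball, Measure.addHaar_ball _ _ h0.le,
    finrank_euclideanSpace_fin] at hpol
  rw [hpol, ← setLIntegral_const, ← lintegral_indicator measurableSet_closedBall]
  refine lintegral_mono fun y => ?_
  have key : ∀ r : ℝ, 0 < r → r • (y : Eucl n) ∈ ball (x : Eucl n) ρ →
      r ∈ Set.Ioo (1 - ρ) (1 + ρ) ∧ y ∈ closedBall x (2 * ρ) := by
    intro r hr hmem
    rw [mem_ball_iff_norm] at hmem
    have hr1 : |r - 1| < ρ := by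
      have := abs_norm_sub_norm_le (r • (y : Eucl n)) x
      rw [norm_smul, Sph.norm_eq, Sph.norm_eq, mul_one, Real.norm_of_nonneg hr.le] at this
      linarith
    refine ⟨⟨by linarith [(abs_lt.1 hr1).1], by linarith [(abs_lt.1 hr1).2]⟩, ?_⟩
    rw [mem_closedBall, Subtype.dist_eq, dist_eq_norm]
    have e : (y : Eucl n) - x = (r • (y : Eucl n) - x) - (r - 1) • (y : Eucl n) := by module
    rw [e]
    refine (norm_sub_le _ _).trans ?_
    rw [norm_smul, Sph.norm_eq, mul_one, Real.norm_eq_abs]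
    linarith
  by_cases hy : y ∈ closedBall x (2 * ρ)
  · rw [Set.indicator_of_mem hy]
    calc _ ≤ ∫⁻ r in Set.Ioi (0 : ℝ), (Set.Ioo (1 - ρ) (1 + ρ)).indicator
          (fun _ => ENNReal.ofReal (2 ^ (n - 1))) r := by
          refine setLIntegral_mono' measurableSet_Ioi fun r hr => ?_
          by_cases hm : r • (y : Eucl n) ∈ ball (x : Eucl n) ρ
          · have hI := (key r hr hm).1
            rw [Set.indicator_of_mem hm, Set.indicator_of_mem hI, Pi.one_apply, mul_one]
            apply ENNReal.ofReal_le_ofReal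
            have hr0 : 0 < r := hr
            have : r ≤ 2 := by linarith [hI.2]
            gcongr
          · rw [Set.indicator_of_notMem hm, mul_zero]
            exact zero_le
      _ ≤ ∫⁻ r, (Set.Ioo (1 - ρ) (1 + ρ)).indicator
          (fun _ => ENNReal.ofReal (2 ^ (n - 1))) r := setLIntegral_le_lintegral _ _
      _ = ENNReal.ofReal (2 ^ n * ρ) := by
          rw [lintegral_indicator measurableSet_Ioo, setLIntegral_const, Real.volume_Ioo,
            ← ENNReal.ofReal_mul (by positivity)]
          congr 1
          have : (2 : ℝ) ^ n = 2 ^ (n - 1) * 2 := by rw [← pow_succ, Nat.sub_add_cancel hn]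
          rw [this]; ring
  · rw [Set.indicator_of_notMem hy, nonpos_iff_eq_zero]
    refine (setLIntegral_congr_fun measurableSet_Ioi fun r hr => ?_).trans lintegral_zero
    rw [Set.indicator_of_notMem fun hm => hy (key r hr hm).2, mul_zero]

lemma exists_hausdorffMeasure_sphere_le (hn : 1 ≤ n) : ∃ C : ℝ≥0∞, C ≠ ⊤ ∧
    (Measure.hausdorffMeasure ((n : ℝ) - 1) : Measure (Sph n)) ≤ C • surf n := by
  have : Nonempty (Fin n) := ⟨⟨0, hn⟩⟩
  have hn1 : (1 : ℝ) ≤ n := by exact_mod_cast hn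
  set ω := volume (ball (0 : Eucl n) 1) with hω
  have hω0 : ω ≠ 0 := (measure_ball_pos _ _ one_pos).ne'
  have hωt : ω ≠ ⊤ := measure_ball_lt_top.ne
  have hd : (0 : ℝ) ≤ (n : ℝ) - 1 := by linarith
  refine ⟨ENNReal.ofReal 10 ^ ((n : ℝ) - 1) * (ENNReal.ofReal (2 ^ n * 2 ^ n) / ω), ?_, ?_⟩
  · exact ENNReal.mul_ne_top (ENNReal.rpow_ne_top_of_nonneg hd ENNReal.ofReal_ne_top)
      (ENNReal.div_ne_top ENNReal.ofReal_ne_top hω0)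
  · refine Measure.le_iff.2 fun A _ => ?_
    rw [Measure.smul_apply, smul_eq_mul]
    refine hausdorffMeasure_le_of_growth (surf n) hd (r₀ := 2) two_pos
      (ENNReal.div_ne_top ENNReal.ofReal_ne_top hω0) (fun x r h0 h2 => ?_) A
    have h := le_surf_closedBall hn x (ρ := r / 2) (by linarith) (by linarith)
    rw [mul_div_cancel₀ _ (two_ne_zero' ℝ)] at h
    rw [ENNReal.div_eq_inv_mul, mul_assoc, ← ENNReal.mul_le_mul_iff_right hω0 hωt, ← mul_assoc ω,
      ENNReal.mul_inv_cancel hω0 hωt, one_mul]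
    have hr2 : ENNReal.ofReal (r / 2) ≠ 0 := (ENNReal.ofReal_pos.2 (by linarith)).ne'
    rw [← ENNReal.mul_le_mul_iff_right hr2 ENNReal.ofReal_ne_top]
    have e1 : ENNReal.ofReal (r / 2) * (ω * ENNReal.ofReal r ^ ((n : ℝ) - 1)) =
        ENNReal.ofReal (2 ^ (n - 1)) * (ENNReal.ofReal ((r / 2) ^ n) * ω) := by
      have : ENNReal.ofReal r ^ ((n : ℝ) - 1) = ENNReal.ofReal (r ^ (n - 1)) := by
        rw [ENNReal.ofReal_rpow_of_pos h0, ← Nat.cast_one, ← Nat.cast_sub hn, Real.rpow_natCast]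
      rw [this, mul_comm ω, ← mul_assoc, ← mul_assoc, ← ENNReal.ofReal_mul (by linarith),
        ← ENNReal.ofReal_mul (by positivity)]
      congr 2
      obtain ⟨k, rfl⟩ : ∃ k, n = k + 1 := ⟨n - 1, by omega⟩
      rw [Nat.add_sub_cancel, div_pow, pow_succ, pow_succ]
      field_simp
    have e2 : ENNReal.ofReal (r / 2) * (ENNReal.ofReal (2 ^ n * 2 ^ n) * surf n (closedBall x r)) =
        ENNReal.ofReal (2 ^ n) * (ENNReal.ofReal (2 ^ n * (r / 2)) * surf n (closedBall x r)) := by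
      rw [← mul_assoc, ← mul_assoc, ← ENNReal.ofReal_mul (by linarith),
        ← ENNReal.ofReal_mul (by positivity)]
      congr 2; ring
    rw [e1, e2]
    refine mul_le_mul' (ENNReal.ofReal_le_ofReal ?_) h
    exact pow_le_pow_right₀ one_le_two (by omega)

/-- Integration over the sphere against Hausdorff measure is controlled by the surface measure. -/
lemma exists_setIntegral_hausdorff_le (hn : 1 ≤ n) : ∃ C : ℝ, 0 < C ∧ ∀ f : Eucl n → ℝ,
    Continuous (fun x : Sph n => f x) →
      ∫ x in sphere (0 : Eucl n) 1, |f x| ∂(Measure.hausdorffMeasure ((n : ℝ) - 1)) ≤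
        C * ∫ x : Sph n, |f x| ∂(surf n) := by
  have hn1 : (1 : ℝ) ≤ n := by exact_mod_cast hn
  obtain ⟨C, hC, hle⟩ := exists_hausdorffMeasure_sphere_le hn
  refine ⟨C.toReal + 1, by positivity, fun f hf => ?_⟩
  have hmap := (isometry_subtype_coe (s := Sph n)).map_hausdorffMeasure
    (d := (n : ℝ) - 1) (Or.inl (by linarith))
  rw [Subtype.range_coe] at hmap
  have hi : Integrable (fun x : Sph n => |f x|) (surf n) := integrable_of_continuous_sph hf.abs
  rw [← hmap, (MeasurableEmbedding.subtype_coe isClosed_sphere.measurableSet).integral_map]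
  refine (integral_mono_measure hle (Eventually.of_forall fun x => abs_nonneg _)
    (hi.smul_measure hC)).trans ?_
  rw [integral_smul_measure, smul_eq_mul]
  have : 0 ≤ ∫ x : Sph n, |f x| ∂(surf n) := integral_nonneg fun x => abs_nonneg _
  linarith

end HausdorffComparison

section RadialGraph

open Filter Topology

variable {n : ℕ}

/-- A bounded open set whose boundary is a radial graph is the region below the graph. -/
lemma smul_mem_iff_of_frontier_eq {E : Set (Eucl n)} {R : Eucl n → ℝ} (hE : IsOpen E)
    (hb : IsBounded E) (hne : E.Nonempty) (hR : ∀ x ∈ sphere (0 : Eucl n) 1, 0 < R x)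
    (hfr : frontier E = (fun x => R x • x) '' sphere (0 : Eucl n) 1) (x : Sph n) {r : ℝ}
    (hr : 0 < r) : r • (x : Eucl n) ∈ E ↔ r < R x := by
  have hfront : ∀ (y : Sph n) (t : ℝ), 0 ≤ t → t • (y : Eucl n) ∈ frontier E → t = R y := by
    intro y t ht hmem
    rw [hfr] at hmem
    obtain ⟨z, hz, hzt⟩ := hmem
    have hz1 : ‖z‖ = 1 := by simpa using hz
    have hRz := hR z hz
    have hn := congrArg norm hzt
    simp only [norm_smul, hz1, Sph.norm_eq, mul_one, Real.norm_eq_abs, abs_of_pos hRz,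
      abs_of_nonneg ht] at hn
    have : z = y := by
      rw [← hn] at hzt
      exact smul_right_injective _ hRz.ne' hzt
    rw [← hn, this]
  have hsub : ∀ S : Set (Eucl n), IsPreconnected S → (S ∩ E).Nonempty →
      Disjoint S (frontier E) → S ⊆ E := by
    intro S hS hSE hd
    refine hS.subset_of_closure_inter_subset hE hSE fun z hz => ?_
    by_contra hzE
    exact Set.disjoint_left.1 hd hz.2 (by rw [hE.frontier_eq]; exact ⟨hz.1, hzE⟩)
  have hlt : ∀ (y : Sph n) (t : ℝ), 0 ≤ t → t • (y : Eucl n) ∈ E → t < R y := by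
    intro y t ht hmem
    by_contra! hle
    have hRy : t • (y : Eucl n) ∉ frontier E := by
      rw [hE.frontier_eq]; exact fun h => h.2 hmem
    have hlt : R y < t := by
      refine lt_of_le_of_ne hle fun h => hRy ?_
      rw [hfr]; exact ⟨y, y.2, by simp only; rw [h]⟩
    have hray : (fun ρ : ℝ => ρ • (y : Eucl n)) '' Set.Ici t ⊆ E := by
      refine hsub _ (isPreconnected_Ici.image _ (by fun_prop))
        ⟨_, ⟨t, Set.self_mem_Ici, rfl⟩, hmem⟩ (Set.disjoint_left.2 ?_)
      rintro _ ⟨ρ, hρ, rfl⟩ hf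
      have hρ : t ≤ ρ := hρ
      have := hfront y ρ (ht.trans hρ) hf
      linarith
    obtain ⟨D, hD⟩ := hb.subset_closedBall 0
    have h1 := hD (hray ⟨max t (|D| + 1), Set.mem_Ici.2 (le_max_left _ _), rfl⟩)
    rw [mem_closedBall_zero_iff, norm_smul, Sph.norm_eq, mul_one, Real.norm_eq_abs] at h1
    have h2 := (le_max_right t (|D| + 1)).trans (le_abs_self _)
    linarith [le_abs_self D]
  refine ⟨hlt x r hr.le, fun hrR => ?_⟩
  set G : Set (Eucl n) := {z | ∃ (y : Sph n) (t : ℝ), 0 ≤ t ∧ t < R y ∧ z = t • (y : Eucl n)} with hG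
  have h0 : (0 : Eucl n) ∈ G := ⟨x, 0, le_rfl, hR x x.2, by simp⟩
  have hstar : StarConvex ℝ 0 G := by
    rintro z ⟨y, t, ht, htR, rfl⟩ a b ha hb hab
    refine ⟨y, b * t, by positivity, ?_, by simp [smul_smul]⟩
    nlinarith
  have hGE : G ⊆ E := by
    refine hsub G (hstar.isPathConnected h0).isConnected.isPreconnected ?_ ?_
    · obtain ⟨z, hz⟩ := hne
      refine ⟨z, ?_, hz⟩
      by_cases hz0 : z = 0
      · rw [hz0]; exact h0
      · have e : z = ‖z‖ • (((⟨‖z‖⁻¹ • z, by simp [norm_smul, hz0]⟩ : Sph n)) : Eucl n) := by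
          simp [smul_smul, hz0]
        rw [e] at hz
        exact ⟨_, ‖z‖, norm_nonneg _, hlt _ _ (norm_nonneg _) hz, e⟩
    · refine Set.disjoint_left.2 ?_
      rintro _ ⟨y, t, ht, htR, rfl⟩ hf
      exact htR.ne (hfront y t ht hf)
  exact hGE ⟨x, r, hr.le, hrR, rfl⟩

lemma setLIntegral_polarSet_homogeneous (hn : 1 ≤ n) {R : Sph n → ℝ} (hR : Continuous R)
    (hpos : ∀ x, 0 < R x) {ψ : Eucl n → ℝ} (hψ : Continuous ψ)
    (hhom : ∀ (r : ℝ) (x : Sph n), 0 < r → ψ (r • (x : Eucl n)) = r * ψ x)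
    (hψ0 : ∀ z, 0 ≤ ψ z) :
    ∫⁻ z in polarSet R, ENNReal.ofReal (ψ z) =
      ENNReal.ofReal (∫ x : Sph n, ψ x * (R x ^ (n + 1) / (n + 1)) ∂(surf n)) := by
  rw [setLIntegral_polarSet hn hR.measurable hψ.measurable.ennreal_ofReal,
    ofReal_integral_eq_lintegral_ofReal]
  · refine lintegral_congr fun x => ?_
    rw [ENNReal.ofReal_mul (hψ0 _), ← lintegral_Ioo_pow n (hpos x).le,
      ← lintegral_const_mul' _ _ ENNReal.ofReal_ne_top]
    refine setLIntegral_congr_fun measurableSet_Ioo fun r hr => ?_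
    have hr0 : 0 < r := hr.1
    rw [hhom r x hr0, ← ENNReal.ofReal_mul (by positivity), ← ENNReal.ofReal_mul (hψ0 _)]
    congr 1
    obtain ⟨k, rfl⟩ : ∃ k, n = k + 1 := ⟨n - 1, by omega⟩
    rw [Nat.add_sub_cancel]; ring
  · exact integrable_of_continuous_sph
      ((hψ.comp continuous_subtype_val).mul ((hR.pow _).div_const _))
  · exact Eventually.of_forall fun x =>
      mul_nonneg (hψ0 _) (div_nonneg (pow_nonneg (hpos x).le _) (by positivity))

lemma setIntegral_coord_eq (hn : 1 ≤ n) {R : Sph n → ℝ} (hR : Continuous R) (hpos : ∀ x, 0 < R x)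
    {E : Set (Eucl n)} (hb : IsBounded E) (hE : E =ᵐ[volume] polarSet R) (i : Fin n) :
    ∫ z in E, z i = (∫ x : Sph n, (x : Eucl n) i * R x ^ (n + 1) ∂(surf n)) / (n + 1) := by
  obtain ⟨D, hD⟩ := hb.subset_closedBall 0
  have hintble : ∀ ψ : Eucl n → ℝ, Continuous ψ → IntegrableOn ψ E := fun ψ hψ =>
    (hψ.continuousOn.integrableOn_compact (isCompact_closedBall 0 D)).mono_set hD
  have hmain : ∀ ψ : Eucl n → ℝ, Continuous ψ →
      (∀ (r : ℝ) (x : Sph n), 0 < r → ψ (r • (x : Eucl n)) = r * ψ x) → (∀ z, 0 ≤ ψ z) →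
      ∫ z in E, ψ z = ∫ x : Sph n, ψ x * (R x ^ (n + 1) / (n + 1)) ∂(surf n) := by
    intro ψ hψ hhom hψ0
    rw [integral_eq_lintegral_of_nonneg_ae (Eventually.of_forall hψ0)
      hψ.aestronglyMeasurable, setLIntegral_congr hE,
      setLIntegral_polarSet_homogeneous hn hR hpos hψ hhom hψ0, ENNReal.toReal_ofReal]
    exact integral_nonneg fun x =>
      mul_nonneg (hψ0 _) (div_nonneg (pow_nonneg (hpos x).le _) (by positivity))
  have hc : Continuous fun z : Eucl n => z i := by fun_prop
  have h1 := hmain (fun z => z i + ‖z‖) (hc.add continuous_norm)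
    (fun r x hr => by
      simp only [PiLp.smul_apply, smul_eq_mul, norm_smul, Real.norm_of_nonneg hr.le]; ring)
    (fun z => by
      have := PiLp.norm_apply_le z i
      rw [Real.norm_eq_abs] at this
      linarith [neg_abs_le (z i)])
  have h2 := hmain (fun z => ‖z‖) continuous_norm
    (fun r x hr => by rw [norm_smul, Real.norm_of_nonneg hr.le]) (fun z => norm_nonneg z)
  rw [integral_add (hintble _ hc) (hintble _ continuous_norm), h2] at h1
  have j1 : Integrable (fun x : Sph n => ((x : Eucl n) i * R x ^ (n + 1)) / (n + 1)) (surf n) :=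
    integrable_of_continuous_sph (by fun_prop)
  have j2 : Integrable (fun x : Sph n => ‖(x : Eucl n)‖ * (R x ^ (n + 1) / (n + 1))) (surf n) :=
    integrable_of_continuous_sph (by fun_prop)
  have e : ∀ x : Sph n, ((x : Eucl n) i + ‖(x : Eucl n)‖) * (R x ^ (n + 1) / (n + 1)) =
      ((x : Eucl n) i * R x ^ (n + 1)) / (n + 1) + ‖(x : Eucl n)‖ * (R x ^ (n + 1) / (n + 1)) :=
    fun x => by ring
  simp_rw [e] at h1
  rw [integral_add j1 j2, integral_div] at h1
  linarith

lemma integral_coord_of_barycenter_eq_zero (hn : 1 ≤ n) {R : Sph n → ℝ} (hR : Continuous R)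
    (hpos : ∀ x, 0 < R x) {E : Set (Eucl n)} (hb : IsBounded E) (hE : E =ᵐ[volume] polarSet R)
    (hvol : volume E = volume (ball (0 : Eucl n) 1)) (hbar : barycenter n E = 0) (i : Fin n) :
    ∫ x : Sph n, (x : Eucl n) i * R x ^ (n + 1) ∂(surf n) = 0 := by
  have hv : 0 < (volume E).toReal := by
    rw [hvol]
    exact ENNReal.toReal_pos (measure_ball_pos _ _ one_pos).ne' measure_ball_lt_top.ne
  have h0 : ∫ x in E, x = 0 := by
    rw [barycenter] at hbar
    exact (smul_eq_zero.1 hbar).resolve_left (inv_ne_zero hv.ne')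
  obtain ⟨D, hD⟩ := hb.subset_closedBall 0
  have hintble : IntegrableOn (fun x : Eucl n => x) E :=
    (continuous_id.continuousOn.integrableOn_compact (isCompact_closedBall 0 D)).mono_set hD
  have h1 := (EuclideanSpace.proj i : Eucl n →L[ℝ] ℝ).integral_comp_comm hintble
  rw [h0, map_zero] at h1
  change ∫ x in E, x i = 0 at h1
  rw [setIntegral_coord_eq hn hR hpos hb hE i] at h1
  have : (n : ℝ) + 1 ≠ 0 := by positivity
  exact (div_eq_zero_iff.1 h1).resolve_right this

end RadialGraph

/-- There are `ε₀ ∈ (0,1/2)` and `c₀ > 0`, depending only on `n ≥ 2`, such that: if `E ⊆ ℝⁿ`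
is open and bounded with `|E| = |B|`, barycenter at the origin, and boundary
`∂E = {(1 + u(x)) x : x ∈ ∂B}` for a Lipschitz function `u` with
`‖u‖_{W^{1,∞}(∂B)} = ‖u‖_{L^∞(∂B)} + ‖∇u‖_{L^∞(∂B)} < ε₀` (the gradient bound being encoded by
the Lipschitz constant `L` of `u` on the sphere), then for every `s ∈ (0,1)`,
`P_s(E) - P_s(B) ≥ (c₀ s P_s(B)/(n ω_n)) ‖u‖²_{L¹(∂B)}`, the surface integral being taken with
respect to the `(n-1)`-dimensional Hausdorff measure on the unit sphere. -/
theorem fractional_fuglede_L1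
    (n : ℕ) (hn : 2 ≤ n) :
    ∃ ε₀ ∈ Set.Ioo (0 : ℝ) (1 / 2), ∃ c₀ : ℝ, 0 < c₀ ∧
      ∀ (E : Set (EuclideanSpace ℝ (Fin n))) (u : EuclideanSpace ℝ (Fin n) → ℝ)
        (M : ℝ) (L : NNReal),
        IsOpen E → IsBounded E →
        volume E = volume (ball (0 : EuclideanSpace ℝ (Fin n)) 1) →
        barycenter n E = 0 →
        frontier E = (fun x => (1 + u x) • x) '' sphere (0 : EuclideanSpace ℝ (Fin n)) 1 →
        LipschitzOnWith L u (sphere (0 : EuclideanSpace ℝ (Fin n)) 1) →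
        (∀ x ∈ sphere (0 : EuclideanSpace ℝ (Fin n)) 1, |u x| ≤ M) →
        M + (L : ℝ) < ε₀ →
        ∀ s ∈ Set.Ioo (0 : ℝ) 1,
          c₀ * s * (fracPer n s (ball (0 : EuclideanSpace ℝ (Fin n)) 1)).toReal
              / (n * (volume (ball (0 : EuclideanSpace ℝ (Fin n)) 1)).toReal)
              * (∫ x in sphere (0 : EuclideanSpace ℝ (Fin n)) 1, |u x| ∂(μH[(n : ℝ) - 1])) ^ 2
            ≤ (fracPer n s E).toReal
              - (fracPer n s (ball (0 : EuclideanSpace ℝ (Fin n)) 1)).toReal := by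
  have hn' : 1 ≤ n := by omega
  obtain ⟨ε, hε, hε2, c, hc, hdef⟩ := exists_deficit_polarSet hn'
  obtain ⟨C, hC, hHaus⟩ := exists_setIntegral_hausdorff_le hn'
  have hω : 0 < (volume (ball (0 : EuclideanSpace ℝ (Fin n)) 1)).toReal :=
    ENNReal.toReal_pos (measure_ball_pos _ _ one_pos).ne' measure_ball_lt_top.ne
  have hn0 : (0 : ℝ) < n := by exact_mod_cast hn'
  refine ⟨ε, ⟨hε, hε2⟩,
    c * (n * (volume (ball (0 : EuclideanSpace ℝ (Fin n)) 1)).toReal) / C ^ 2, by positivity, ?_⟩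
  intro E u M L hE hb hvol hbar hfr hL hM hML s hs
  have hne : E.Nonempty := by
    refine nonempty_of_measure_ne_zero (μ := volume) ?_
    rw [hvol]
    exact (measure_ball_pos _ _ one_pos).ne'
  have hM0 : 0 ≤ M := by
    let e : EuclideanSpace ℝ (Fin n) := EuclideanSpace.single ⟨0, by omega⟩ 1
    exact (abs_nonneg _).trans (hM e (by simp [e]))
  have hL0 : (0 : ℝ) ≤ L := L.2
  have hu : ∀ x ∈ sphere (0 : EuclideanSpace ℝ (Fin n)) 1, |u x| ≤ ε :=
    fun x hx => (hM x hx).trans (by linarith)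
  have hpos : ∀ x ∈ sphere (0 : EuclideanSpace ℝ (Fin n)) 1, 0 < 1 + u x := fun x hx => by
    linarith [neg_le_of_abs_le (hu x hx)]
  have hcont : Continuous fun x : Sph n => u x := hL.continuousOn.domRestrict
  have hR : Continuous fun x : Sph n => 1 + u x := continuous_const.add hcont
  have hmem : ∀ (x : Sph n) (r : ℝ), 0 < r → (r • (x : Eucl n) ∈ E ↔ r < 1 + u x) := fun x r hr =>
    smul_mem_iff_of_frontier_eq (R := fun x => 1 + u x) hE hb hne hpos hfr x hr
  have hEp : E =ᵐ[volume] polarSet fun x : Sph n => 1 + u x := ae_eq_polarSet hn' hmem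
  have key := hdef (fun x => u x) (fun x => hu x x.2)
    (fun x y => by
      have h := hL.dist_le_mul x x.2 y y.2
      rw [Real.dist_eq, dist_eq_norm] at h
      exact h.trans (by gcongr; linarith))
    (integral_pow_of_volume_eq hn' hR (fun x => hpos x x.2) hEp hvol)
    (integral_coord_of_barycenter_eq_zero hn' hR (fun x => hpos x x.2) hb hEp hvol hbar)
    s hs.1 hs.2
  rw [← fracPer_congr_ae s hEp] at key
  refine le_trans ?_ key
  set H := ∫ x in sphere (0 : EuclideanSpace ℝ (Fin n)) 1, |u x| ∂(μH[(n : ℝ) - 1])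
  have hH0 : 0 ≤ H := integral_nonneg fun _ => abs_nonneg _
  have hs0 := hs.1
  have hle : H ^ 2 ≤ (C * ∫ x : Sph n, |u x| ∂(surf n)) ^ 2 := pow_le_pow_left₀ hH0 (hHaus u hcont) 2
  set P := (fracPer n s (ball (0 : EuclideanSpace ℝ (Fin n)) 1)).toReal
  have hP : 0 ≤ P := ENNReal.toReal_nonneg
  calc _ = c * s * P * (H ^ 2 / C ^ 2) := by field_simp
    _ ≤ c * s * P * (∫ x : Sph n, |u x| ∂(surf n)) ^ 2 := by
      gcongr
      rw [div_le_iff₀ (by positivity)]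
      linarith
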